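/- Let G = ⟨X; Rⁿ⟩ be a freely indecomposable one-relator group with torsion, and let T be the normal closure in G of the image of R. Suppose G splits nontrivially as an amalgamated free product A ∗_C B over a virtually-ℤ group C. Then one of the following occurs: (1) the image of C in G is not contained in T, and C is contained in a malnormal infinite cyclic subgroup of G; (2) both A and C are infinite dihedral; (3) both B and C are infinite dihedral. -/

import Mathlib

/-- A group is *virtually-ℤ* if it has a finite-index subgroup isomorphic to `ℤ`. -/
def VirtuallyZ (G : Type*) [Group G] : Prop :=
  ∃ H : Subgroup G, H.FiniteIndex ∧ Nonempty (H ≃* Multiplicative ℤ)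

/-- A subgroup `M` of `G` is *malnormal* if `g M g⁻¹ ∩ M ≠ 1` implies `g ∈ M`. -/
def Subgroup.IsMalnormal {G : Type*} [Group G] (M : Subgroup G) : Prop :=
  ∀ g : G, (∃ x : G, x ≠ 1 ∧ x ∈ M ∧ g * x * g⁻¹ ∈ M) → g ∈ M

/-- A group is a *free product of cyclic groups* if it is isomorphic to the free product
(`Monoid.CoprodI`) of a family of cyclic groups; every cyclic group is isomorphic to
`Multiplicative (ZMod m)` for some `m : ℕ` (with `m = 0` giving the infinite cyclic group). -/
def IsFreeProductOfCyclics (G : Type*) [Group G] : Prop :=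
  ∃ (ι : Type) (m : ι → ℕ),
    Nonempty (G ≃* Monoid.CoprodI fun i => Multiplicative (ZMod (m i)))

/-- A group is *freely decomposable* if it is isomorphic to a free product of two
nontrivial groups. -/
def FreelyDecomposable (G : Type*) [Group G] : Prop :=
  ∃ (H K : Type) (gH : Group H) (gK : Group K),
    Nontrivial H ∧ Nontrivial K ∧
      Nonempty (G ≃* (letI := gH; letI := gK; Monoid.Coprod H K))

/-- A group is *freely indecomposable* if it is not isomorphic to a free product of two
nontrivial groups. -/
def FreelyIndecomposable (G : Type*) [Group G] : Prop := ¬ FreelyDecomposable G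

namespace OR

/-- `R` is not a proper power. -/
def NotPow {F : Type*} [Group F] (R : F) : Prop := ∀ (S : F) (k : ℕ), 1 ≤ k → R = S ^ k → k = 1

theorem NotPow.ne_one {F : Type*} [Group F] {R : F} (h : NotPow R) : R ≠ 1 := by
  intro h1
  have := h 1 2 (by norm_num) (by simp [h1])
  omega

/-- A free group is cyclic or has two elements which can be sent anywhere. -/
theorem free_dichotomy (K : Type) [Group K] [IsFreeGroup K] :
    (∃ h : K, ∀ g : K, g ∈ Subgroup.zpowers h) ∨
    ∃ b₁ b₂ : K, ∀ (P : Type) [Group P] (p₁ p₂ : P), ∃ θ : K →* P, θ b₁ = p₁ ∧ θ b₂ = p₂ := by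
  classical
  by_cases hs : Subsingleton (IsFreeGroup.Generators K)
  · left
    rcases isEmpty_or_nonempty (IsFreeGroup.Generators K) with he | ⟨⟨a⟩⟩
    · refine ⟨1, fun g => ?_⟩
      have : MonoidHom.id K = 1 := IsFreeGroup.ext_hom (fun a => (he.false a).elim)
      have h2 := DFunLike.congr_fun this g
      simp at h2
      simp [h2]
    · refine ⟨IsFreeGroup.of a, fun g => ?_⟩
      let Z := Subgroup.zpowers (IsFreeGroup.of a)
      let φ : K →* Z := IsFreeGroup.lift (fun b => ⟨IsFreeGroup.of a, Subgroup.mem_zpowers _⟩)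
      have : Z.subtype.comp φ = MonoidHom.id K := by
        apply IsFreeGroup.ext_hom
        intro b
        have hb : b = a := Subsingleton.elim _ _
        subst hb
        simp [φ]
      have h2 := DFunLike.congr_fun this g
      have h3 : (φ g : K) = g := h2
      rw [← h3]
      exact (φ g).2
  · right
    rw [not_subsingleton_iff_nontrivial] at hs
    obtain ⟨a, b, hab⟩ := hs
    refine ⟨IsFreeGroup.of a, IsFreeGroup.of b, fun P _ p₁ p₂ => ?_⟩
    refine ⟨IsFreeGroup.lift (fun c => if c = a then p₁ else p₂), ?_, ?_⟩
    · simp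
    · simp [hab.symm]

theorem NotPow.of_zpowers {F : Type*} [Group F] {R : F} (hR : NotPow R) {h : F}
    (hm : R ∈ Subgroup.zpowers h) : Subgroup.zpowers h = Subgroup.zpowers R := by
  obtain ⟨m, hm⟩ := hm
  simp only at hm
  have h0 : m ≠ 0 := by
    rintro rfl
    exact hR.ne_one (by simpa using hm.symm)
  rcases Int.natAbs_eq m with h1 | h1
  · have : R = h ^ m.natAbs := by rw [← zpow_natCast, ← h1, hm]
    have h2 := hR h _ (by omega) this
    rw [this, h2, pow_one]
  · have : R = h⁻¹ ^ m.natAbs := by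
      rw [← zpow_natCast, inv_zpow, ← zpow_neg, ← h1, hm]
    have h2 := hR _ _ (by omega) this
    rw [this, h2, pow_one, Subgroup.zpowers_inv]

theorem exists_functional {F : Type} [Group F] [IsFreeGroup F] {R : F} (hR : NotPow R)
    (K : Subgroup F) (hRK : R ∈ K) (hK : ∃ g ∈ K, g ∉ Subgroup.zpowers R) :
    ∃ χ : K →* Multiplicative ℤ, χ ⟨R, hRK⟩ = 1 ∧ χ ≠ 1 := by
  rcases free_dichotomy K with ⟨h, hh⟩ | ⟨b₁, b₂, hb⟩
  · exfalso
    obtain ⟨g, hg, hgR⟩ := hK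
    have h1 : ∀ x ∈ K, x ∈ Subgroup.zpowers (h : F) := by
      intro x hx
      obtain ⟨m, hm⟩ := hh ⟨x, hx⟩
      refine ⟨m, ?_⟩
      have := congrArg Subtype.val hm
      simpa using this
    have := hR.of_zpowers (h1 R hRK)
    rw [← this] at hgR
    exact hgR (h1 g hg)
  · obtain ⟨e₁, h11, h12⟩ := hb (Multiplicative ℤ) (Multiplicative.ofAdd 1) 1
    obtain ⟨e₂, h21, h22⟩ := hb (Multiplicative ℤ) 1 (Multiplicative.ofAdd 1)
    set r₁ := Multiplicative.toAdd (e₁ ⟨R, hRK⟩) with hr₁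
    set r₂ := Multiplicative.toAdd (e₂ ⟨R, hRK⟩) with hr₂
    by_cases h0 : r₁ = 0
    · refine ⟨e₁, ?_, ?_⟩
      · apply Multiplicative.toAdd.injective
        rw [← hr₁, h0]; rfl
      · intro h
        rw [h] at h11
        have := congrArg Multiplicative.toAdd h11
        simp at this
    · refine ⟨e₁ ^ r₂ * (e₂ ^ r₁)⁻¹, ?_, ?_⟩
      · apply Multiplicative.toAdd.injective
        simp only [MonoidHom.mul_apply, MonoidHom.inv_apply, toAdd_mul, toAdd_inv, toAdd_one]
        have h1 : (e₁ ^ r₂) ⟨R, hRK⟩ = (e₁ ⟨R, hRK⟩) ^ r₂ := rfl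
        have h2 : (e₂ ^ r₁) ⟨R, hRK⟩ = (e₂ ⟨R, hRK⟩) ^ r₁ := rfl
        rw [h1, h2, toAdd_zpow, toAdd_zpow, ← hr₁, ← hr₂]
        simp only [smul_eq_mul]; ring
      · intro h
        have := DFunLike.congr_fun h b₂
        have h1 : (e₁ ^ r₂) b₂ = (e₁ b₂) ^ r₂ := rfl
        have h2 : (e₂ ^ r₁) b₂ = (e₂ b₂) ^ r₁ := rfl
        simp only [MonoidHom.mul_apply, MonoidHom.inv_apply, h1, h2, h12, h22, one_zpow, one_mul,
          MonoidHom.one_apply] at this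
        have := congrArg Multiplicative.toAdd this
        simp at this
        exact h0 this

theorem stacking {F : Type} [Group F] [IsFreeGroup F] {R : F} (hR : NotPow R) (c : ℕ) :
    ∀ A : Finset F, A.card ≤ c → (∀ g ∈ A, g ∉ Subgroup.zpowers R) →
    ∃ Pos : Set F, (∀ a ∈ Pos, ∀ b ∈ Pos, a * b ∈ Pos) ∧
      (∀ a ∈ Pos, ∀ r ∈ Subgroup.zpowers R, r * a ∈ Pos ∧ a * r ∈ Pos) ∧
      (∀ a ∈ Pos, a ∉ Subgroup.zpowers R) ∧ ∀ g ∈ A, g ∈ Pos ∨ g⁻¹ ∈ Pos := by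
  classical
  induction c with
  | zero =>
    intro A hA _
    have : A = ∅ := by simpa using hA
    subst this
    exact ⟨∅, by simp, by simp, by simp, by simp⟩
  | succ c ih =>
    intro A hA hAR
    rcases A.eq_empty_or_nonempty with rfl | ⟨g, hg⟩
    · exact ⟨∅, by simp, by simp, by simp, by simp⟩
    let K : Subgroup F := Subgroup.closure (insert R (A : Set F))
    have hRK : R ∈ K := Subgroup.subset_closure (Set.mem_insert _ _)
    have hAK : ∀ a ∈ A, a ∈ K := fun a ha => Subgroup.subset_closure (Set.mem_insert_of_mem _ ha)
    obtain ⟨χ, hχR, hχ⟩ := exists_functional hR K hRK ⟨g, hAK g hg, hAR g hg⟩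
    have hex : ∃ a, ∃ ha : a ∈ A, χ ⟨a, hAK a ha⟩ ≠ 1 := by
      by_contra hcon
      push Not at hcon
      apply hχ
      ext ⟨k, hk⟩
      have : ∀ k (hk : k ∈ K), χ ⟨k, hk⟩ = 1 := by
        intro k hk
        induction hk using Subgroup.closure_induction with
        | mem x hx =>
          rcases hx with rfl | hx
          · exact hχR
          · exact hcon x hx
        | one => exact χ.map_one
        | mul x y hx hy h1 h2 =>
          have : χ (⟨x, hx⟩ * ⟨y, hy⟩) = 1 := by rw [map_mul, h1, h2, one_mul]
          exact this
        | inv x hx h1 =>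
          have : χ (⟨x, hx⟩⁻¹) = 1 := by rw [map_inv, h1, inv_one]
          exact this
      rw [this k hk]; rfl
    let v : F → ℤ := fun k => if hk : k ∈ K then Multiplicative.toAdd (χ ⟨k, hk⟩) else 0
    have hv : ∀ k (hk : k ∈ K), v k = Multiplicative.toAdd (χ ⟨k, hk⟩) := fun k hk => dif_pos hk
    have hvmul : ∀ a ∈ K, ∀ b ∈ K, v (a * b) = v a + v b := by
      intro a ha b hb
      rw [hv a ha, hv b hb, hv _ (K.mul_mem ha hb), ← toAdd_mul, ← map_mul]; rfl
    have hvinv : ∀ a ∈ K, v a⁻¹ = - v a := by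
      intro a ha
      rw [hv a ha, hv _ (K.inv_mem ha), ← toAdd_inv, ← map_inv]; rfl
    have hRK' : ∀ r ∈ Subgroup.zpowers R, r ∈ K := fun r hr =>
      (Subgroup.zpowers_le.2 hRK) hr
    have hvR : ∀ r ∈ Subgroup.zpowers R, v r = 0 := by
      intro r hr
      rw [hv r (hRK' r hr)]
      obtain ⟨m, rfl⟩ := hr
      have : χ (⟨R, hRK⟩ ^ m) = 1 := by rw [map_zpow, hχR, one_zpow]
      have h2 : χ ⟨R ^ m, hRK' _ ⟨m, rfl⟩⟩ = 1 := this
      simp only [h2, toAdd_one]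
    obtain ⟨Pos₀, h1, h2, h3, h4⟩ := ih (A.filter (fun a => v a = 0)) (by
      obtain ⟨a, ha, hna⟩ := hex
      have : A.filter (fun a => v a = 0) ⊂ A := by
        refine Finset.filter_ssubset.2 ⟨a, ha, ?_⟩
        rw [hv a (hAK a ha)]
        intro h
        exact hna (Multiplicative.toAdd.injective h)
      have := Finset.card_lt_card this
      omega) (fun g hg => hAR g (Finset.mem_filter.1 hg).1)
    refine ⟨{k | k ∈ K ∧ (0 < v k ∨ v k = 0 ∧ k ∈ Pos₀)}, ?_, ?_, ?_, ?_⟩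
    · rintro a ⟨ha, ha'⟩ b ⟨hb, hb'⟩
      refine ⟨K.mul_mem ha hb, ?_⟩
      rw [hvmul a ha b hb]
      rcases ha' with ha' | ⟨ha', ha''⟩ <;> rcases hb' with hb' | ⟨hb', hb''⟩
      · left; omega
      · left; omega
      · left; omega
      · right; exact ⟨by omega, h1 _ ha'' _ hb''⟩
    · rintro a ⟨ha, ha'⟩ r hr
      have hrK := hRK' r hr
      refine ⟨⟨K.mul_mem hrK ha, ?_⟩, ⟨K.mul_mem ha hrK, ?_⟩⟩
      · rw [hvmul r hrK a ha, hvR r hr]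
        rcases ha' with ha' | ⟨ha', ha''⟩
        · left; omega
        · right; exact ⟨by omega, (h2 a ha'' r hr).1⟩
      · rw [hvmul a ha r hrK, hvR r hr]
        rcases ha' with ha' | ⟨ha', ha''⟩
        · left; omega
        · right; exact ⟨by omega, (h2 a ha'' r hr).2⟩
    · rintro a ⟨ha, ha'⟩ har
      have := hvR a har
      rcases ha' with ha' | ⟨ha', ha''⟩
      · omega
      · exact h3 a ha'' har
    · intro a ha
      have haK := hAK a ha
      rcases lt_trichotomy (v a) 0 with h | h | h
      · right; exact ⟨K.inv_mem haK, Or.inl (by rw [hvinv a haK]; omega)⟩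
      · rcases h4 a (Finset.mem_filter.2 ⟨ha, h⟩) with h5 | h5
        · left; exact ⟨haK, Or.inr ⟨h, h5⟩⟩
        · right; exact ⟨K.inv_mem haK, Or.inr ⟨by rw [hvinv a haK]; omega, h5⟩⟩
      · left; exact ⟨haK, Or.inl h⟩

end OR

namespace OR

/-- A cyclically reduced periodic word. -/
structure CW (X : Type) where
  l : ℕ → X × Bool
  L : ℕ
  hL : 0 < L
  per : ∀ j, l (j + L) = l j
  red : ∀ j, (l (j+1)).1 = (l j).1 → (l (j+1)).2 = (l j).2

namespace CW
variable {X : Type} (W : CW X)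

/-- The `j`-th initial part (read from the right). -/
def s : ℕ → FreeGroup X
  | 0 => 1
  | j + 1 => FreeGroup.mk [W.l j] * s j

/-- The relator. -/
def R : FreeGroup X := W.s W.L

/-- The tail index of the `j`-th letter. -/
def sig (j : ℕ) : ℕ := if (W.l j).2 then j else j + 1

@[simp] theorem s_zero : W.s 0 = 1 := rfl
theorem s_succ (j : ℕ) : W.s (j+1) = FreeGroup.mk [W.l j] * W.s j := rfl

theorem s_add_L (j : ℕ) : W.s (j + W.L) = W.s j * W.R := by
  induction j with
  | zero => simp [R]
  | succ j ih =>
    rw [show j + 1 + W.L = (j + W.L) + 1 by ring, s_succ, s_succ, W.per, ih, mul_assoc]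

theorem s_add_mul (j q : ℕ) : W.s (j + q * W.L) = W.s j * W.R ^ q := by
  induction q with
  | zero => simp
  | succ q ih =>
    rw [show j + (q+1) * W.L = (j + q * W.L) + W.L by ring, s_add_L, ih, pow_succ, mul_assoc]

theorem s_mul (q : ℕ) : W.s (q * W.L) = W.R ^ q := by
  have := W.s_add_mul 0 q
  simpa using this

theorem l_add_mul (j q : ℕ) : W.l (j + q * W.L) = W.l j := by
  induction q with
  | zero => simp
  | succ q ih =>
    rw [show j + (q+1) * W.L = (j + q * W.L) + W.L by ring, W.per, ih]

theorem s_mod (j : ℕ) : W.s j = W.s (j % W.L) * W.R ^ (j / W.L) := by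
  rw [← s_add_mul, mul_comm, Nat.mod_add_div]

theorem l_mod (j : ℕ) : W.l j = W.l (j % W.L) := by
  conv_lhs => rw [← Nat.mod_add_div j W.L, mul_comm, l_add_mul]

theorem sig_add_mul (j q : ℕ) : W.sig (j + q * W.L) = W.sig j + q * W.L := by
  unfold sig
  rw [l_add_mul]
  split_ifs <;> ring

/-- the word spelling `s j` -/
def w : ℕ → List (X × Bool)
  | 0 => []
  | j + 1 => W.l j :: w j

theorem mk_w (j : ℕ) : FreeGroup.mk (W.w j) = W.s j := by
  induction j with
  | zero => rfl
  | succ j ih => rw [s_succ, ← ih]; simp [w]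

theorem w_length (j : ℕ) : (W.w j).length = j := by
  induction j with
  | zero => rfl
  | succ j ih => simp [w, ih]

theorem w_reduced (j : ℕ) : FreeGroup.IsReduced (W.w j) := by
  induction j with
  | zero => exact FreeGroup.IsReduced.nil
  | succ j ih =>
    cases j with
    | zero => exact FreeGroup.IsReduced.singleton
    | succ j =>
      simp only [w] at ih ⊢
      rw [FreeGroup.isReduced_cons_cons]
      exact ⟨W.red j, ih⟩

theorem s_inj {i j : ℕ} (h : W.s i = W.s j) : i = j := by
  classical
  rw [← mk_w, ← mk_w] at h
  have := congrArg FreeGroup.toWord h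
  rw [FreeGroup.toWord_mk, FreeGroup.toWord_mk, (W.w_reduced i).reduce_eq,
    (W.w_reduced j).reduce_eq] at this
  rw [← W.w_length i, this, W.w_length]

theorem D_not_mem {i j : ℕ} (h : i % W.L ≠ j % W.L) :
    (W.s i)⁻¹ * W.s j ∉ Subgroup.zpowers W.R := by
  rintro ⟨m, hm⟩
  simp only at hm
  have h1 : W.s j = W.s i * W.R ^ m := by rw [hm]; group
  rcases Int.eq_nat_or_neg m with ⟨a, rfl | rfl⟩
  · rw [zpow_natCast, ← s_add_mul] at h1
    have := W.s_inj h1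
    rw [this] at h
    simp at h
  · have h2 : W.s i = W.s j * W.R ^ a := by rw [h1]; simp
    rw [← s_add_mul] at h2
    have := W.s_inj h2
    rw [this] at h
    simp at h

/-- rotation -/
def rot (r : ℕ) : CW X where
  l := fun j => W.l (j + r)
  L := W.L
  hL := W.hL
  per := fun j => by rw [show j + W.L + r = (j + r) + W.L by ring]; exact W.per _
  red := fun j => by rw [show j + 1 + r = (j + r) + 1 by ring]; exact W.red _

theorem rot_s (r j : ℕ) : (W.rot r).s j = W.s (j + r) * (W.s r)⁻¹ := by
  induction j with
  | zero => simp
  | succ j ih =>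
    rw [s_succ, ih, show j + 1 + r = (j + r) + 1 by ring, s_succ, mul_assoc]
    rfl

theorem rot_R (r : ℕ) : (W.rot r).R = W.s r * W.R * (W.s r)⁻¹ := by
  unfold R
  rw [rot_s]
  change W.s (W.L + r) * _ = _
  rw [add_comm, s_add_L]; rfl

end CW

theorem exists_CW {X : Type} (l : List (X × Bool)) (hl : FreeGroup.IsCyclicallyReduced l)
    (hne : l ≠ []) : ∃ W : CW X, W.R = FreeGroup.mk l ∧ ∀ a ∈ l, ∃ j, W.l j = a := by
  classical
  set m := l.reverse with hm
  have hmlen : 0 < m.length := by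
    rw [hm, List.length_reverse]; exact List.length_pos_iff.2 hne
  have hchain : m.IsChain (fun a b => b.1 = a.1 → b.2 = a.2) := by
    rw [hm, List.isChain_reverse]; exact hl.1
  rw [List.isChain_iff_getElem] at hchain
  let f : ℕ → X × Bool := fun j => m[j % m.length]'(Nat.mod_lt _ hmlen)
  have hf : ∀ j (h : j < m.length), f j = m[j] := by
    intro j h
    simp only [f, Nat.mod_eq_of_lt h]
  have hfp : ∀ j, f (j + m.length) = f j := by
    intro j; simp [f]
  have hfm : ∀ j, f j = f (j % m.length) := by
    intro j; simp [f]
  have hred : ∀ j, (f (j+1)).1 = (f j).1 → (f (j+1)).2 = (f j).2 := by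
    intro j
    rw [hfm (j+1), hfm j]
    have hj := Nat.mod_lt j hmlen
    by_cases hlt : j % m.length + 1 < m.length
    · have : (j+1) % m.length = j % m.length + 1 := by
        rw [Nat.add_mod]
        rcases Nat.lt_or_ge 1 m.length with h1 | h1
        · rw [Nat.mod_eq_of_lt h1, Nat.mod_eq_of_lt hlt]
        · omega
      rw [this, hf _ hlt, hf _ hj]
      exact hchain _ hlt
    · have hjl : j % m.length = m.length - 1 := by omega
      have : (j+1) % m.length = 0 := by
        rw [← Nat.mod_add_mod, hjl, Nat.sub_add_cancel hmlen, Nat.mod_self]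
      rw [this, hjl, hf _ hmlen, hf _ (by omega)]
      intro h
      have h1 : m[0] ∈ l.getLast? := by
        rw [← List.head?_reverse, ← hm, List.head?_eq_getElem?]
        simp [hmlen]
      have h2 : m[m.length - 1] ∈ l.head? := by
        rw [← List.getLast?_reverse, ← hm, List.getLast?_eq_getElem?]
        simp [hmlen]
      exact hl.2 _ h1 _ h2 h
  let W : CW X := ⟨f, m.length, hmlen, hfp, hred⟩
  have hw : ∀ j, j ≤ m.length → W.w j = (m.take j).reverse := by
    intro j
    induction j with
    | zero => intro _; simp [CW.w]
    | succ j ih =>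
      intro hj
      have : W.l j = m[j] := hf j (by omega)
      rw [CW.w, ih (by omega), this, List.take_add_one,
        List.getElem?_eq_getElem (show j < m.length by omega)]
      rw [List.reverse_append]
      rfl
  refine ⟨W, ?_, ?_⟩
  · change W.s m.length = _
    rw [← CW.mk_w, hw _ le_rfl, List.take_length, hm, List.reverse_reverse]
  · intro a ha
    have : a ∈ m := by rw [hm]; simpa using ha
    obtain ⟨j, hj, rfl⟩ := List.getElem_of_mem this
    exact ⟨j, hf j hj⟩

/-- A stacked word: a cyclic word with a compatible ordering of its positions. -/
structure SW (X : Type) extends CW X where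
  lt : ℕ → ℕ → Prop
  trans : ∀ {i j k}, lt i j → lt j k → lt i k
  ne : ∀ {i j}, lt i j → i % L ≠ j % L
  total : ∀ {i j}, i % L ≠ j % L → lt i j ∨ lt j i
  same : ∀ {i j}, l i = l j → (lt i j ↔ lt (i+1) (j+1))
  opp : ∀ {i j}, (l i).1 = (l j).1 → (l i).2 ≠ (l j).2 → (lt i (j+1) ↔ lt (i+1) j)
  bot : ∀ j, (l j).1 = (l 0).1 → j % L ≠ 0 → lt (toCW.sig 0) (toCW.sig j)

theorem exists_max {α : Type*} (r : α → α → Prop) (ht : ∀ a b c, r a b → r b c → r a c)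
    (hi : ∀ a, ¬ r a a) (A : Finset α) (hA : A.Nonempty) : ∃ m ∈ A, ∀ x ∈ A, ¬ r m x := by
  classical
  induction A using Finset.induction_on with
  | empty => simp at hA
  | insert a A ha ih =>
    rcases A.eq_empty_or_nonempty with rfl | hne
    · exact ⟨a, by simp, by simpa using hi a⟩
    · obtain ⟨m, hm, hmax⟩ := ih hne
      by_cases h : r m a
      · refine ⟨a, by simp, fun x hx => ?_⟩
        rcases Finset.mem_insert.1 hx with rfl | hx
        · exact hi _
        · exact fun h2 => hmax x hx (ht _ _ _ h h2)
      · refine ⟨m, by simp [hm], fun x hx => ?_⟩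
        rcases Finset.mem_insert.1 hx with rfl | hx
        · exact h
        · exact hmax x hx

theorem bool_mk_mul {X : Type} {a b : X × Bool} (h1 : a.1 = b.1) (h2 : a.2 ≠ b.2) :
    FreeGroup.mk [a] * FreeGroup.mk [b] = 1 := by
  obtain ⟨a1, a2⟩ := a
  obtain ⟨b1, b2⟩ := b
  simp only at h1 h2
  subst h1
  have : b2 = !a2 := by cases a2 <;> cases b2 <;> simp_all
  subst this
  have := FreeGroup.Red.Step.not (L₁ := []) (L₂ := []) (x := a1) (b := a2)
  have := FreeGroup.Red.exact.2 ⟨[], Relation.ReflTransGen.single this, Relation.ReflTransGen.refl⟩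
  exact this

theorem CW.sig_mod_ne {X : Type} (W : CW X) {i j : ℕ} (h : (W.l i).1 = (W.l j).1)
    (hij : i % W.L ≠ j % W.L) : W.sig i % W.L ≠ W.sig j % W.L := by
  have key : ∀ {i j : ℕ}, (W.l i).1 = (W.l j).1 → (W.l i).2 = true → (W.l j).2 = false →
      i % W.L ≠ (j+1) % W.L := by
    intro i j h hi hj hm
    have h1 : W.l i = W.l (j+1) := by rw [W.l_mod i, W.l_mod (j+1), hm]
    have := W.red j (by rw [← h1, h])
    rw [← h1, hi, hj] at this
    simp at this
  unfold CW.sig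
  by_cases hi : (W.l i).2 = true <;> by_cases hj : (W.l j).2 = true
  · simp only [hi, hj]; exact hij
  · simp only [hi, hj]
    exact key h hi (by simpa using hj)
  · simp only [hi, hj]
    exact fun h2 => key h.symm hj (by simpa using hi) h2.symm
  · simp only [hi, hj]
    intro h2
    apply hij
    exact Nat.ModEq.add_right_cancel' 1 h2

theorem exists_SW_aux {X : Type} (W : CW X) (hR : NotPow W.R) :
    ∃ lt : ℕ → ℕ → Prop, 
    (∀ {i j k}, lt i j → lt j k → lt i k) ∧
    (∀ {i j}, lt i j → i % W.L ≠ j % W.L) ∧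
    (∀ {i j}, i % W.L ≠ j % W.L → lt i j ∨ lt j i) ∧
    (∀ {i j}, W.l i = W.l j → (lt i j ↔ lt (i+1) (j+1))) ∧
    (∀ {i j}, (W.l i).1 = (W.l j).1 → (W.l i).2 ≠ (W.l j).2 → (lt i (j+1) ↔ lt (i+1) j)) := by
  classical
  let A : Finset (FreeGroup X) := ((Finset.range W.L ×ˢ Finset.range W.L).filter
    (fun p => p.1 ≠ p.2)).image (fun p => (W.s p.1)⁻¹ * W.s p.2)
  obtain ⟨Pos, h1, h2, h3, h4⟩ := stacking hR A.card A le_rfl (by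
    intro g hg
    simp only [A, Finset.mem_image, Finset.mem_filter, Finset.mem_product, Finset.mem_range] at hg
    obtain ⟨⟨i, j⟩, ⟨⟨hi, hj⟩, hij⟩, rfl⟩ := hg
    apply W.D_not_mem
    simp only at hi hj hij
    rwa [Nat.mod_eq_of_lt hi, Nat.mod_eq_of_lt hj])
  refine ⟨fun i j => (W.s i)⁻¹ * W.s j ∈ Pos, ?_, ?_, ?_, ?_, ?_⟩
  · intro i j k hij hjk
    have := h1 _ hij _ hjk
    simpa [mul_assoc] using this
  · intro i j hij hmod
    apply h3 _ hij
    rw [W.s_mod i, W.s_mod j, hmod]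
    refine ⟨-(i / W.L : ℕ) + (j / W.L : ℕ), ?_⟩
    simp only [mul_inv_rev]
    rw [zpow_add, zpow_neg, zpow_natCast, zpow_natCast]
    group
  · intro i j hij
    have hA : (W.s (i % W.L))⁻¹ * W.s (j % W.L) ∈ A := by
      simp only [A, Finset.mem_image, Finset.mem_filter, Finset.mem_product, Finset.mem_range]
      exact ⟨(i % W.L, j % W.L), ⟨⟨Nat.mod_lt _ W.hL, Nat.mod_lt _ W.hL⟩, hij⟩, rfl⟩
    have hpow : ∀ q : ℕ, W.R ^ q ∈ Subgroup.zpowers W.R := fun q =>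
      Subgroup.pow_mem _ (Subgroup.mem_zpowers _) _
    have key : ∀ i j : ℕ, (W.s (i % W.L))⁻¹ * W.s (j % W.L) ∈ Pos → (W.s i)⁻¹ * W.s j ∈ Pos := by
      intro i j h
      rw [W.s_mod i, W.s_mod j]
      have := (h2 _ ((h2 _ h _ (hpow (j / W.L))).2) _
        ((Subgroup.zpowers W.R).inv_mem (hpow (i / W.L)))).1
      simpa [mul_assoc] using this
    rcases h4 _ hA with h | h
    · left; exact key _ _ h
    · right; apply key
      simpa using h
  · intro i j hij
    beta_reduce
    rw [W.s_succ, W.s_succ, hij, mul_inv_rev, mul_assoc, inv_mul_cancel_left]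
  · intro i j ha hb
    have := bool_mk_mul ha hb
    have h5 : FreeGroup.mk [W.l j] = (FreeGroup.mk [W.l i])⁻¹ := eq_inv_of_mul_eq_one_right this
    beta_reduce
    rw [W.s_succ, W.s_succ, h5]
    rw [mul_inv_rev, mul_assoc]

theorem CW.lt_congr {X : Type} (W : CW X) {lt : ℕ → ℕ → Prop}
    (htr : ∀ {i j k}, lt i j → lt j k → lt i k)
    (hne : ∀ {i j}, lt i j → i % W.L ≠ j % W.L)
    (htot : ∀ {i j}, i % W.L ≠ j % W.L → lt i j ∨ lt j i) {i j i' j' : ℕ}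
    (hi : i % W.L = i' % W.L) (hj : j % W.L = j' % W.L) (h : lt i j) : lt i' j' := by
  have hd := hne h
  have h1 : lt i' j := by
    rcases htot (i := i') (j := j) (by rw [← hi]; exact hd) with h1 | h1
    · exact h1
    · exact absurd hi (hne (htr h h1))
  rcases htot (i := i') (j := j') (by rw [← hi, ← hj]; exact hd) with h2 | h2
  · exact h2
  · exact absurd hj.symm (hne (htr h2 h1))

theorem exists_SW {X : Type} (l : List (X × Bool)) (hl : FreeGroup.IsCyclicallyReduced l)
    (hR : NotPow (FreeGroup.mk l)) (a : X × Bool) (ha : a ∈ l) :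
    ∃ W : SW X, (∃ g, W.R = g * FreeGroup.mk l * g⁻¹) ∧ (W.l 0).1 = a.1 := by
  classical
  obtain ⟨W, hWR, hW⟩ := exists_CW l hl (by rintro rfl; simp at ha)
  obtain ⟨lt, htr, hne, htot, hsame, hopp⟩ := exists_SW_aux W (by rw [hWR]; exact hR)
  obtain ⟨j₀, hj₀⟩ := hW a ha
  have hirr : ∀ i, ¬ lt i i := fun i h => hne h rfl
  obtain ⟨m, hm, hmin⟩ := exists_max (fun i j => lt (W.sig j) (W.sig i))
    (fun a b c h1 h2 => htr h2 h1) (fun a => hirr _)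
    ((Finset.range W.L).filter (fun j => (W.l j).1 = a.1)) ⟨j₀ % W.L, by
      simp only [Finset.mem_filter, Finset.mem_range]
      refine ⟨Nat.mod_lt _ W.hL, ?_⟩
      rw [← W.l_mod, hj₀]⟩
  simp only [Finset.mem_filter, Finset.mem_range] at hm hmin
  have hrsig : ∀ j, W.sig (j + m) = (W.rot m).sig j + m := by
    intro j
    by_cases h : (W.l (j + m)).2 = true
    · simp [CW.sig, CW.rot, h]
    · simp only [CW.sig, CW.rot, h]
      simp; ring
  refine ⟨⟨W.rot m, fun i j => lt (i + m) (j + m), fun h1 h2 => htr h1 h2, ?_, ?_, ?_, ?_, ?_⟩,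
    ?_, ?_⟩
  · intro i j h h2
    exact hne h (Nat.ModEq.add_right m h2)
  · intro i j h
    apply htot
    intro h2
    exact h (Nat.ModEq.add_right_cancel' m h2)
  · intro i j h
    rw [show i + 1 + m = (i + m) + 1 by ring, show j + 1 + m = (j + m) + 1 by ring]
    exact hsame h
  · intro i j h h'
    rw [show i + 1 + m = (i + m) + 1 by ring, show j + 1 + m = (j + m) + 1 by ring]
    exact hopp h h'
  · intro j h hj
    rw [← hrsig, ← hrsig]
    have hl1 : (W.l (j + m)).1 = (W.l (0+m)).1 := h
    have hmod : (j + m) % W.L ≠ (0 + m) % W.L := by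
      intro h2
      apply hj
      have := Nat.ModEq.add_right_cancel' m h2
      have h3 : j % W.L = 0 % W.L := this
      rw [Nat.zero_mod] at h3
      exact h3
    rcases htot (W.sig_mod_ne hl1 hmod) with h3 | h3
    · exfalso
      have hl2 : (W.l ((j+m) % W.L)).1 = a.1 := by
        rw [← W.l_mod, hl1, zero_add, hm.2]
      apply hmin ((j+m) % W.L) ⟨Nat.mod_lt _ W.hL, hl2⟩
      refine W.lt_congr (lt := lt) htr hne htot (i := W.sig (j+m)) (j := W.sig (0+m)) ?_ ?_ h3
      · conv_lhs => rw [← Nat.mod_add_div (j+m) W.L, mul_comm, W.sig_add_mul]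
        simp
      · simp
    · exact h3
  · refine ⟨W.s m, ?_⟩
    rw [← hWR]; exact W.rot_R m
  · change (W.l (0 + m)).1 = a.1
    rw [zero_add, hm.2]

theorem exists_cyc {X : Type} (R : FreeGroup X) (hR : R ≠ 1) :
    ∃ (l : List (X × Bool)) (g : FreeGroup X), FreeGroup.IsCyclicallyReduced l ∧ l ≠ [] ∧
      FreeGroup.mk l = g * R * g⁻¹ := by
  classical
  have h := FreeGroup.reduceCyclically.conj_conjugator_reduceCyclically R.toWord
  have hc := FreeGroup.reduceCyclically.isCyclicallyReduced (FreeGroup.isReduced_toWord (x := R))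
  have h2 : FreeGroup.mk (FreeGroup.reduceCyclically R.toWord) =
    (FreeGroup.mk (FreeGroup.reduceCyclically.conjugator R.toWord))⁻¹ * R *
      (FreeGroup.mk (FreeGroup.reduceCyclically.conjugator R.toWord))⁻¹⁻¹ := by
    have h3 : R = FreeGroup.mk (FreeGroup.reduceCyclically.conjugator R.toWord) *
        FreeGroup.mk (FreeGroup.reduceCyclically R.toWord) *
        (FreeGroup.mk (FreeGroup.reduceCyclically.conjugator R.toWord))⁻¹ := by
      rw [FreeGroup.inv_mk, FreeGroup.mul_mk, FreeGroup.mul_mk, h, FreeGroup.mk_toWord]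
    conv_rhs => enter [1, 2]; rw [h3]
    group
  refine ⟨_, _, hc, ?_, h2⟩
  intro h0
  rw [h0, ← FreeGroup.one_eq_mk] at h2
  apply hR
  have := h2.symm
  rw [mul_inv_eq_one] at this
  simpa using this

theorem NotPow.conj {F : Type*} [Group F] {R : F} (h : NotPow R) (g : F) :
    NotPow (g * R * g⁻¹) := by
  intro S k hk hS
  apply h (g⁻¹ * S * g) k hk
  have : g⁻¹ * S * g = g⁻¹ * S * g⁻¹⁻¹ := by simp
  rw [this, conj_pow, ← hS]; group

theorem exists_SW' {X : Type} (R : FreeGroup X) (hR : NotPow R) :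
    ∃ W : SW X, ∃ g, W.R = g * R * g⁻¹ := by
  obtain ⟨l, g, hl, hne, hg⟩ := exists_cyc R hR.ne_one
  obtain ⟨a, ha⟩ := List.exists_mem_of_ne_nil _ hne
  obtain ⟨W, ⟨g', hW⟩, _⟩ := exists_SW l hl (by rw [hg]; exact hR.conj g) a ha
  refine ⟨W, g' * g, ?_⟩
  rw [hW, hg]; group

end OR

namespace OR

section
open scoped Classical
variable {X : Type} {Ω : Type} [MulAction (FreeGroup X) Ω]

/-- The edge traversed by the `j`-th letter from `ω`. -/
def CW.edge (W : CW X) (ω : Ω) (j : ℕ) : Ω × X := (W.s (W.sig j) • ω, (W.l j).1)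

theorem CW.edge_add_mul (W : CW X) (ω : Ω) (j q : ℕ) :
    W.edge ω (j + q * W.L) = W.edge (W.R ^ q • ω) j := by
  simp only [CW.edge, W.sig_add_mul, W.l_add_mul, W.s_add_mul, mul_smul]

theorem CW.edge_mod (W : CW X) (ω : Ω) (j : ℕ) :
    W.edge ω j = W.edge (W.R ^ (j / W.L) • ω) (j % W.L) := by
  rw [← CW.edge_add_mul, mul_comm, Nat.mod_add_div]

theorem CW.smul_mod (W : CW X) (ω : Ω) (j : ℕ) :
    W.s j • ω = W.s (j % W.L) • W.R ^ (j / W.L) • ω := by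
  rw [← mul_smul, ← W.s_mod]

/-- All edges of `S`. -/
noncomputable def CW.E (W : CW X) (S : Finset Ω) : Finset (Ω × X) :=
  (S ×ˢ Finset.range W.L).image (fun p => W.edge p.1 p.2)

/-- All vertices of `S`. -/
noncomputable def CW.V (W : CW X) (S : Finset Ω) : Finset Ω :=
  (S ×ˢ Finset.range W.L).image (fun p => W.s p.2 • p.1)

theorem CW.pow_mem (W : CW X) {S : Finset Ω} (hS : ∀ ω ∈ S, W.R • ω ∈ S) (q : ℕ) :
    ∀ ω ∈ S, W.R ^ q • ω ∈ S := by
  induction q with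
  | zero => simp
  | succ q ih => intro ω hω; rw [pow_succ', mul_smul]; exact hS _ (ih _ hω)

theorem CW.edge_mem_E (W : CW X) {S : Finset Ω} (hS : ∀ ω ∈ S, W.R • ω ∈ S) {ω : Ω} (hω : ω ∈ S)
    (j : ℕ) : W.edge ω j ∈ W.E S := by
  rw [W.edge_mod]
  exact Finset.mem_image.2 ⟨(_, _), Finset.mem_product.2 ⟨W.pow_mem hS _ _ hω,
    Finset.mem_range.2 (Nat.mod_lt _ W.hL)⟩, rfl⟩

theorem CW.smul_mem_V (W : CW X) {S : Finset Ω} (hS : ∀ ω ∈ S, W.R • ω ∈ S) {ω : Ω} (hω : ω ∈ S)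
    (j : ℕ) : W.s j • ω ∈ W.V S := by
  rw [W.smul_mod]
  exact Finset.mem_image.2 ⟨(_, _), Finset.mem_product.2 ⟨W.pow_mem hS _ _ hω,
    Finset.mem_range.2 (Nat.mod_lt _ W.hL)⟩, rfl⟩

theorem SW.ends (W : SW X) {ω ω' : Ω} {j k : ℕ} (he : W.edge ω' k = W.edge ω j)
    (h : W.lt (W.sig j) (W.sig k)) :
    (∃ k', W.s k' • ω' = W.s j • ω ∧ W.lt j k') ∧
    (∃ k', W.s k' • ω' = W.s (j+1) • ω ∧ W.lt (j+1) k') := by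
  have h1 : W.s (W.sig k) • ω' = W.s (W.sig j) • ω := congrArg Prod.fst he
  have h2 : (W.l k).1 = (W.l j).1 := congrArg Prod.snd he
  by_cases hj : (W.l j).2 = true <;> by_cases hk : (W.l k).2 = true
  · have hs : W.l j = W.l k := Prod.ext h2.symm (by rw [hj, hk])
    simp only [CW.sig, hj, hk, if_true] at h1 h
    refine ⟨⟨k, h1, h⟩, ⟨k+1, ?_, (W.same hs).1 h⟩⟩
    rw [W.s_succ, W.s_succ, mul_smul, h1, ← hs, mul_smul]
  · have hne : (W.l j).2 ≠ (W.l k).2 := by rw [hj]; exact fun h => hk h.symm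
    simp only [CW.sig, hj, hk, if_true] at h1 h
    refine ⟨⟨k+1, h1, h⟩, ⟨k, ?_, (W.opp h2.symm hne).1 h⟩⟩
    rw [W.s_succ j, mul_smul, ← h1]
    change _ = _ • W.s (k+1) • ω'
    rw [W.s_succ, mul_smul, smul_smul, bool_mk_mul h2.symm hne, one_smul]
  · have hne : (W.l k).2 ≠ (W.l j).2 := by rw [hk]; exact fun h => hj h.symm
    simp only [CW.sig, hj, hk, if_true] at h1 h
    refine ⟨⟨k+1, ?_, (W.opp h2.symm hne.symm).2 h⟩, ⟨k, h1, h⟩⟩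
    rw [W.s_succ k, mul_smul, h1]
    change _ • W.s (j+1) • ω = _
    rw [W.s_succ, mul_smul, smul_smul, bool_mk_mul h2 hne, one_smul]
  · have hs : W.l j = W.l k := Prod.ext h2.symm (by
      rw [Bool.eq_false_iff.2 hj, Bool.eq_false_iff.2 hk])
    simp only [CW.sig, hj, hk] at h1 h
    refine ⟨⟨k, ?_, (W.same hs).2 h⟩, ⟨k+1, h1, h⟩⟩
    change W.s (k+1) • ω' = W.s (j+1) • ω at h1
    rw [W.s_succ, W.s_succ, mul_smul, mul_smul, hs] at h1
    exact smul_left_cancel _ h1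

/-- top vertex pass -/
def SW.topV (W : SW X) (S : Finset Ω) (ω : Ω) (j : ℕ) : Prop :=
  ∀ ω' ∈ S, ∀ k, W.s k • ω' = W.s j • ω → ¬ W.lt j k

/-- top edge pass -/
def SW.topE (W : SW X) (S : Finset Ω) (ω : Ω) (j : ℕ) : Prop :=
  ∀ ω' ∈ S, ∀ k, W.edge ω' k = W.edge ω j → ¬ W.lt (W.sig j) (W.sig k)

theorem SW.irrefl (W : SW X) (i : ℕ) : ¬ W.lt i i := fun h => W.ne h rfl

theorem SW.lt_congr (W : SW X) {i j i' j' : ℕ}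
    (hi : i % W.L = i' % W.L) (hj : j % W.L = j' % W.L) (h : W.lt i j) : W.lt i' j' :=
  W.toCW.lt_congr (lt := W.lt) W.trans W.ne W.total hi hj h

theorem mod_add_mul_sig (W : CW X) (k : ℕ) : W.sig (k % W.L) % W.L = W.sig k % W.L := by
  conv_rhs => rw [← Nat.mod_add_div k W.L, mul_comm, W.sig_add_mul]
  simp

theorem SW.wlemma (W : SW X) (S : Finset Ω) (hS : ∀ ω ∈ S, W.R • ω ∈ S)
    (hstuck : ∀ ω ∈ S, ∃ ω' ∈ S, ∃ k < W.L, W.edge ω' k = W.edge ω 0 ∧ ¬ (ω' = ω ∧ k = 0)) :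
    (W.V S).card + S.card ≤ (W.E S).card := by
  let TE := (S ×ˢ Finset.range W.L).filter (fun p => W.topE S p.1 p.2)
  let TV := (S ×ˢ Finset.range W.L).filter (fun p => W.topV S p.1 p.2)
  have hTE : TE.card ≤ (W.E S).card := by
    apply Finset.card_le_card_of_injOn (fun p => W.edge p.1 p.2)
    · intro p hp
      exact Finset.mem_image_of_mem _ (Finset.mem_filter.1 hp).1
    · rintro ⟨ω, j⟩ hp ⟨ω', k⟩ hq he
      simp only [TE, Finset.coe_filter, Finset.mem_product, Finset.mem_range,
        Set.mem_ofPred_eq] at hp hq he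
      have hjk : j = k := by
        by_contra hne
        have h1 : j % W.L ≠ k % W.L := by
          rwa [Nat.mod_eq_of_lt hp.1.2, Nat.mod_eq_of_lt hq.1.2]
        have h2 : (W.l j).1 = (W.l k).1 := congrArg Prod.snd he
        rcases W.total (W.sig_mod_ne h2 h1) with h3 | h3
        · exact hp.2 _ hq.1.1 k he.symm h3
        · exact hq.2 _ hp.1.1 j he h3
      subst hjk
      have : W.s (W.sig j) • ω = W.s (W.sig j) • ω' := congrArg Prod.fst he
      rw [smul_left_cancel _ this]
  have hTV : (W.V S).card ≤ TV.card := by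
    have : W.V S ⊆ TV.image (fun p => W.s p.2 • p.1) := by
      intro v hv
      let B := (S ×ˢ Finset.range W.L).filter (fun p => W.s p.2 • p.1 = v)
      have hB : B.Nonempty := by
        obtain ⟨p, hp, hpv⟩ := Finset.mem_image.1 hv
        exact ⟨p, Finset.mem_filter.2 ⟨hp, hpv⟩⟩
      obtain ⟨⟨ω, j⟩, hm, hmax⟩ := exists_max (fun p q : Ω × ℕ => W.lt p.2 q.2)
        (fun a b c h1 h2 => W.trans h1 h2) (fun a => W.irrefl _) B hB
      obtain ⟨hm1, hm2⟩ := Finset.mem_filter.1 hm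
      refine Finset.mem_image.2 ⟨(ω, j), Finset.mem_filter.2 ⟨hm1, ?_⟩, hm2⟩
      intro ω' hω' k hk hlt
      refine hmax (W.R ^ (k / W.L) • ω', k % W.L) ?_ ?_
      · refine Finset.mem_filter.2 ⟨Finset.mem_product.2 ⟨W.pow_mem hS _ _ hω',
          Finset.mem_range.2 (Nat.mod_lt _ W.hL)⟩, ?_⟩
        change W.s (k % W.L) • W.R ^ (k / W.L) • ω' = v
        rw [← W.smul_mod, hk]; exact hm2
      · exact W.lt_congr rfl (by simp) hlt
    exact (Finset.card_le_card this).trans Finset.card_image_le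
  have hVE : ∀ ω j, W.topV S ω j → W.topE S ω j := by
    intro ω j h ω' hω' k hk hlt
    obtain ⟨⟨k', h1, h2⟩, _⟩ := W.ends hk hlt
    exact h _ hω' _ h1 h2
  have hVE' : ∀ ω j, W.topV S ω (j+1) → W.topE S ω j := by
    intro ω j h ω' hω' k hk hlt
    obtain ⟨_, ⟨k', h1, h2⟩⟩ := W.ends hk hlt
    exact h _ hω' _ h1 h2
  -- the greatest position of the letter
  obtain ⟨jp, hjp, hjmax⟩ := exists_max (fun i j => W.lt (W.sig i) (W.sig j))
    (fun a b c h1 h2 => W.trans h1 h2) (fun a => W.irrefl _)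
    ((Finset.range W.L).filter (fun j => (W.l j).1 = (W.l 0).1)) ⟨0, by simp [W.hL]⟩
  have htop : ∀ ω, W.topE S ω jp := by
    intro ω ω' hω' k hk hlt
    have h2 : (W.l k).1 = (W.l jp).1 := congrArg Prod.snd hk
    apply hjmax (k % W.L)
    · simp only [Finset.mem_filter, Finset.mem_range] at hjp ⊢
      refine ⟨Nat.mod_lt _ W.hL, ?_⟩
      rw [← W.l_mod, h2, hjp.2]
    · exact W.lt_congr rfl (mod_add_mul_sig W.toCW k).symm hlt
  have hbot : ∀ ω ∈ S, ¬ W.topE S ω 0 := by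
    intro ω hω h
    obtain ⟨ω', hω', k, hk, he, hne⟩ := hstuck ω hω
    refine h ω' hω' k he (W.bot k (congrArg Prod.snd he) ?_)
    rw [Nat.mod_eq_of_lt hk]
    rintro rfl
    apply hne
    have : W.s (W.sig 0) • ω' = W.s (W.sig 0) • ω := congrArg Prod.fst he
    exact ⟨smul_left_cancel _ this, rfl⟩
  have hj : ∀ ω, ∃ j, ω ∈ S → (j < W.L ∧ W.topE S ω j ∧ ¬ W.topV S ω j) := by
    intro ω
    have hex : ∃ j, W.topE S ω j := ⟨jp, htop ω⟩
    refine ⟨Nat.find hex, fun hω => ⟨?_, Nat.find_spec hex, ?_⟩⟩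
    · have : Nat.find hex ≤ jp := Nat.find_le (htop ω)
      have : jp < W.L := by simpa using (Finset.mem_filter.1 hjp).1
      omega
    · intro hv
      rcases Nat.eq_zero_or_pos (Nat.find hex) with h0 | h0
      · apply hbot ω hω
        rw [← h0]; exact Nat.find_spec hex
      · refine Nat.find_min hex (m := Nat.find hex - 1) (by omega) ?_
        apply hVE'
        rwa [Nat.sub_add_cancel h0]
  choose j hj using hj
  have hsub : TV ∪ S.image (fun ω => (ω, j ω)) ⊆ TE := by
    intro p hp
    rcases Finset.mem_union.1 hp with hp | hp
    · obtain ⟨h1, h2⟩ := Finset.mem_filter.1 hp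
      exact Finset.mem_filter.2 ⟨h1, hVE _ _ h2⟩
    · obtain ⟨ω, hω, rfl⟩ := Finset.mem_image.1 hp
      exact Finset.mem_filter.2 ⟨Finset.mem_product.2 ⟨hω, Finset.mem_range.2 (hj ω hω).1⟩,
        (hj ω hω).2.1⟩
  have hdis : Disjoint TV (S.image (fun ω => (ω, j ω))) := by
    rw [Finset.disjoint_right]
    intro p hp hp2
    obtain ⟨ω, hω, rfl⟩ := Finset.mem_image.1 hp
    exact (hj ω hω).2.2 (Finset.mem_filter.1 hp2).2
  have hc := Finset.card_le_card hsub
  rw [Finset.card_union_of_disjoint hdis, Finset.card_image_of_injective _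
    (fun a b h => congrArg Prod.fst h)] at hc
  omega

end
end OR

namespace OR
section
open scoped Classical
variable {X : Type} {Ω : Type} [MulAction (FreeGroup X) Ω] {P : Type} [Group P]

/-- the homomorphism underlying a cochain -/
def coc (f : Ω × X → P) :
    FreeGroup X →* (Ω → P) ⋊[mulAutArrow (G := FreeGroup X) (A := Ω) (M := P)] FreeGroup X :=
  FreeGroup.lift (fun x => ⟨fun ω => f ((FreeGroup.of x)⁻¹ • ω, x), FreeGroup.of x⟩)

theorem coc_right (f : Ω × X → P) (g : FreeGroup X) : (coc f g).right = g := by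
  have : SemidirectProduct.rightHom.comp (coc f) = MonoidHom.id (FreeGroup X) := by
    ext x; simp [coc]
  exact DFunLike.congr_fun this g

/-- the cocycle of a cochain -/
def cc (f : Ω × X → P) (g : FreeGroup X) (ω : Ω) : P := (coc f g).left (g • ω)

theorem cc_mul (f : Ω × X → P) (g h : FreeGroup X) (ω : Ω) :
    cc f (g * h) ω = cc f g (h • ω) * cc f h ω := by
  unfold cc
  rw [map_mul, SemidirectProduct.mul_left, coc_right]
  simp only [Pi.mul_apply]
  rw [mul_smul]
  congr 1
  change (coc f h).left (g⁻¹ • g • h • ω) = _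
  rw [inv_smul_smul]

@[simp] theorem cc_one (f : Ω × X → P) (ω : Ω) : cc f 1 ω = 1 := by
  simp [cc]

theorem cc_of (f : Ω × X → P) (x : X) (ω : Ω) : cc f (FreeGroup.of x) ω = f (ω, x) := by
  simp [cc, coc]

theorem cc_inv (f : Ω × X → P) (g : FreeGroup X) (ω : Ω) :
    cc f g⁻¹ (g • ω) = (cc f g ω)⁻¹ := by
  apply eq_inv_of_mul_eq_one_left
  rw [← cc_mul]; simp

theorem cc_inv' (f : Ω × X → P) (g : FreeGroup X) (ω : Ω) :
    cc f g⁻¹ ω = (cc f g (g⁻¹ • ω))⁻¹ := by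
  rw [← cc_inv, smul_inv_smul]

theorem cc_conj (f : Ω × X → P) (g h : FreeGroup X) (ω : Ω) (hh : h • ω = ω) :
    cc f (g * h * g⁻¹) (g • ω) = cc f g ω * cc f h ω * (cc f g ω)⁻¹ := by
  rw [cc_mul, cc_inv, inv_smul_smul, cc_mul, hh]

theorem cc_pow (f : Ω × X → P) (h : FreeGroup X) (ω : Ω) (hh : h • ω = ω) (q : ℕ) :
    cc f (h ^ q) ω = cc f h ω ^ q := by
  induction q with
  | zero => simp
  | succ q ih => rw [pow_succ, cc_mul, hh, ih, pow_succ]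

theorem cc_letter (W : CW X) (f : Ω × X → P) (ω : Ω) (j : ℕ) :
    cc f (FreeGroup.mk [W.l j]) (W.s j • ω) =
      if (W.l j).2 then f (W.edge ω j) else (f (W.edge ω j))⁻¹ := by
  rcases hl : W.l j with ⟨x, b⟩
  cases b
  · have h1 : FreeGroup.mk [(x, false)] = (FreeGroup.of x)⁻¹ := by simp [FreeGroup.of]; rfl
    have h2 : W.s (j+1) • ω = (FreeGroup.of x)⁻¹ • W.s j • ω := by
      rw [W.s_succ, hl, h1, mul_smul]
    simp only [CW.edge, CW.sig, hl, h1]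
    rw [cc_inv', cc_of]; simp [h2]
  · have h1 : FreeGroup.mk [(x, true)] = FreeGroup.of x := rfl
    simp only [CW.edge, CW.sig, hl, h1, cc_of]; simp

theorem cc_mem' (f : Ω × X → P) (H₀ : Subgroup P) (Y : Set X) (hf : ∀ ω, ∀ x ∈ Y, f (ω, x) ∈ H₀)
    (g : FreeGroup X) (hg : g ∈ Subgroup.closure (FreeGroup.of '' Y)) :
    ∀ ω, cc f g ω ∈ H₀ := by
  induction hg using Subgroup.closure_induction with
  | mem g hg => 
    obtain ⟨x, hx, rfl⟩ := hg
    intro ω; rw [cc_of]; exact hf ω x hx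
  | one => intro ω; rw [cc_one]; exact H₀.one_mem
  | mul g h _ _ h1 h2 => intro ω; rw [cc_mul]; exact H₀.mul_mem (h1 _) (h2 _)
  | inv g _ h1 => intro ω; rw [cc_inv']; exact H₀.inv_mem (h1 _)

theorem cc_mem (f : Ω × X → P) (H₀ : Subgroup P) (hf : ∀ e, f e ∈ H₀)
    (g : FreeGroup X) (ω : Ω) : cc f g ω ∈ H₀ := by
  apply cc_mem' f H₀ Set.univ (fun ω x _ => hf _)
  rw [Set.image_univ, FreeGroup.closure_range_of]; trivial

theorem cc_map {Q : Type} [Group Q] (φ : P →* Q) (f : Ω × X → P) (g : FreeGroup X) :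
    ∀ ω : Ω, cc (φ ∘ f) g ω = φ (cc f g ω) := by
  have hg : g ∈ Subgroup.closure (Set.range (FreeGroup.of (α := X))) := by
    rw [FreeGroup.closure_range_of]; trivial
  induction hg using Subgroup.closure_induction with
  | mem g hg => 
    obtain ⟨x, rfl⟩ := hg
    intro ω; rw [cc_of, cc_of]; rfl
  | one => intro ω; simp
  | mul g h _ _ h1 h2 => intro ω; rw [cc_mul, cc_mul, map_mul, h1, h2]
  | inv g _ h1 => intro ω; rw [cc_inv', cc_inv' f, map_inv, h1]

/-- values along a word: away from the first letter -/
theorem cc_s_mem (W : CW X) (f : Ω × X → P) (H₀ : Subgroup P) (ω : Ω) (m : ℕ)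
    (hf : ∀ j, 0 < j → j < m + 1 → f (W.edge ω j) ∈ H₀) :
    cc f (W.s (m+1)) ω * (cc f (W.s 1) ω)⁻¹ ∈ H₀ := by
  induction m with
  | zero => simp
  | succ m ih =>
    rw [W.s_succ (m+1), cc_mul, cc_letter, mul_assoc]
    refine H₀.mul_mem ?_ (ih (fun j h1 h2 => hf j h1 (by omega)))
    have := hf (m+1) (by omega) (by omega)
    split_ifs
    · exact this
    · exact H₀.inv_mem this

theorem cc_s_one (W : CW X) (f : Ω × X → P) (ω : Ω) :
    cc f (W.s 1) ω = if (W.l 0).2 then f (W.edge ω 0) else (f (W.edge ω 0))⁻¹ := by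
  have := cc_letter W f ω 0
  rw [← this]
  simp [W.s_succ]

theorem cc_s_congr (W : CW X) (f f' : Ω × X → P) (ω : Ω)
    (hf : ∀ j, f (W.edge ω j) = f' (W.edge ω j)) (m : ℕ) :
    cc f (W.s m) ω = cc f' (W.s m) ω := by
  induction m with
  | zero => simp
  | succ m ih =>
    rw [W.s_succ, cc_mul, cc_mul, cc_letter, cc_letter, ih, hf]

/-- update a cochain on one edge so as to prescribe the value of the word `s (m+1)` at `ω` -/
theorem cc_solve (W : CW X) (f : Ω × X → P) (ω : Ω) (m : ℕ)
    (hf : ∀ j, 0 < j → j < m + 1 → W.edge ω j ≠ W.edge ω 0) (p : P) :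
    ∃ f' : Ω × X → P, (∀ e, e ≠ W.edge ω 0 → f' e = f e) ∧ cc f' (W.s (m+1)) ω = p := by
  set t := cc f (W.s (m+1)) ω * (cc f (W.s 1) ω)⁻¹ with ht
  set v : P := if (W.l 0).2 then t⁻¹ * p else (t⁻¹ * p)⁻¹ with hv
  let f' := Function.update f (W.edge ω 0) v
  have hf' : ∀ e, e ≠ W.edge ω 0 → f' e = f e := fun e he => Function.update_of_ne he _ _
  refine ⟨f', hf', ?_⟩
  have h1 : cc f' (W.s 1) ω = t⁻¹ * p := by
    rw [cc_s_one]
    simp only [f', Function.update_self, hv]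
    split_ifs <;> simp
  have h2 : ∀ m', m' ≤ m → cc f' (W.s (m'+1)) ω * (cc f' (W.s 1) ω)⁻¹ =
      cc f (W.s (m'+1)) ω * (cc f (W.s 1) ω)⁻¹ := by
    intro m' hm'
    induction m' with
    | zero => simp
    | succ m' ih =>
      have he := hf (m'+1) (by omega) (by omega)
      rw [W.s_succ (m'+1), cc_mul, cc_mul, cc_letter, cc_letter, mul_assoc, mul_assoc,
        ih (by omega), hf' _ he]
  have h3 := h2 m le_rfl
  rw [← ht, h1] at h3
  rw [mul_inv_eq_iff_eq_mul] at h3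
  rw [h3, mul_inv_cancel_left]

/-- collapsing sequences -/
inductive Coll (W : CW X) (S : Finset Ω) : Finset Ω → Finset (Ω × X) → Finset Ω → Prop
  | nil : Coll W S S ∅ ∅
  | cons (S' : Finset Ω) (Z : Finset (Ω × X)) (V : Finset Ω) (ω : Ω) (hc : Coll W S S' Z V)
      (hω : ω ∈ S') (alone : ∀ ω' ∈ S', ∀ k < W.L, W.edge ω' k = W.edge ω 0 → ω' = ω ∧ k = 0) :
      Coll W S (S'.filter (fun ω' => ∀ q : ℕ, W.R ^ q • ω ≠ ω')) (insert (W.edge ω 0) Z)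
        (insert ω V)

/-- invariants of a collapsing sequence -/
structure CollInv (W : CW X) (S S' : Finset Ω) (Z : Finset (Ω × X)) (V : Finset Ω) : Prop where
  sub : S' ⊆ S
  inv : ∀ ω ∈ S', W.R • ω ∈ S'
  dis : ∀ e ∈ Z, e ∉ W.E S'
  VS : V ⊆ S
  Vdis : ∀ v ∈ V, ∀ q : ℕ, W.R ^ q • v ∉ S'
  cov : ∀ ω ∈ S, ω ∈ S' ∨ ∃ v ∈ V, ∃ q : ℕ, W.R ^ q • v = ω
  dist : ∀ v ∈ V, ∀ v' ∈ V, ∀ q : ℕ, W.R ^ q • v = v' → v = v'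
  card : Z.card = V.card
  let0 : ∀ e ∈ Z, e.2 = (W.l 0).1

theorem Coll.collInv {W : CW X} {S S' : Finset Ω} {Z : Finset (Ω × X)} {V : Finset Ω}
    (h : Coll W S S' Z V) (hS : ∀ ω ∈ S, W.R • ω ∈ S) (n : ℕ) (hn : 0 < n)
    (hSn : ∀ ω ∈ S, W.R ^ n • ω = ω) : CollInv W S S' Z V := by
  induction h with
  | nil => exact ⟨by simp, hS, by simp, by simp, by simp, fun ω h => Or.inl h, by simp, by simp,
      by simp⟩
  | cons S' Z V ω hc hω alone ih =>
    have hback : ∀ ω' ∈ S, ∀ q : ℕ, W.R ^ q • ω = W.R • ω' → ∃ q : ℕ, W.R ^ q • ω = ω' := by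
      intro ω' hω' q hq
      refine ⟨n - 1 + q, ?_⟩
      rw [pow_add, mul_smul, hq, smul_smul, ← pow_succ, Nat.sub_add_cancel hn, hSn _ hω']
    have hback2 : ∀ v ∈ S, ∀ q : ℕ, W.R ^ q • v = ω → ∃ q' : ℕ, W.R ^ q' • ω = v := by
      intro v hv q hq
      refine ⟨n * (q + 1) - q, ?_⟩
      have h1 : q ≤ n * (q + 1) := by nlinarith
      rw [← hq, smul_smul, ← pow_add, Nat.sub_add_cancel h1, pow_mul]
      generalize q + 1 = t
      induction t with
      | zero => simp
      | succ t ih => rw [pow_succ, mul_smul, hSn _ hv, ih]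
    have hinv' : ∀ ω' ∈ S'.filter (fun ω' => ∀ q : ℕ, W.R ^ q • ω ≠ ω'),
        W.R • ω' ∈ S'.filter (fun ω' => ∀ q : ℕ, W.R ^ q • ω ≠ ω') := by
      intro ω' hω'
      obtain ⟨h1, h2⟩ := Finset.mem_filter.1 hω'
      refine Finset.mem_filter.2 ⟨ih.inv _ h1, fun q hq => ?_⟩
      obtain ⟨q', hq'⟩ := hback ω' (ih.sub h1) q hq
      exact h2 q' hq'
    refine ⟨(Finset.filter_subset _ _).trans ih.sub, hinv', ?_, ?_, ?_, ?_, ?_, ?_, ?_⟩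
    · intro e he heE
      obtain ⟨⟨ω', k⟩, hp, rfl⟩ := Finset.mem_image.1 heE
      rw [Finset.mem_product, Finset.mem_filter, Finset.mem_range] at hp
      rcases Finset.mem_insert.1 he with he | he
      · have := alone ω' hp.1.1 k hp.2 he
        exact hp.1.2 0 (by simp [this.1])
      · exact ih.dis _ he (W.edge_mem_E ih.inv hp.1.1 k)
    · exact Finset.insert_subset (ih.sub hω) ih.VS
    · intro v hv q hq
      rcases Finset.mem_insert.1 hv with rfl | hv
      · exact (Finset.mem_filter.1 hq).2 q rfl
      · exact ih.Vdis v hv q (Finset.mem_filter.1 hq).1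
    · intro ω' hω'
      rcases ih.cov ω' hω' with h | ⟨v, hv, q, hq⟩
      · by_cases h2 : ∀ q : ℕ, W.R ^ q • ω ≠ ω'
        · left; exact Finset.mem_filter.2 ⟨h, h2⟩
        · push Not at h2
          obtain ⟨q, hq⟩ := h2
          exact Or.inr ⟨ω, Finset.mem_insert_self _ _, q, hq⟩
      · exact Or.inr ⟨v, Finset.mem_insert_of_mem hv, q, hq⟩
    · intro v hv v' hv' q hq
      rcases Finset.mem_insert.1 hv with rfl | hv2 <;>
        rcases Finset.mem_insert.1 hv' with rfl | hv2'
      · rfl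
      · exfalso
        exact ih.Vdis v' hv2' 0 (by rw [← hq]; simpa using W.pow_mem ih.inv q _ hω)
      · exfalso
        exact ih.Vdis v hv2 q (by rw [hq]; exact hω)
      · exact ih.dist v hv2 v' hv2' q hq
    · rw [Finset.card_insert_of_notMem, Finset.card_insert_of_notMem, ih.card]
      · intro h; exact ih.Vdis _ h 0 (by simpa using hω)
      · intro h; exact ih.dis _ h (W.edge_mem_E ih.inv hω 0)
    · intro e he
      rcases Finset.mem_insert.1 he with rfl | he
      · rfl
      · exact ih.let0 e he

/-- the period of `ω` -/
noncomputable def CW.d (W : CW X) (ω : Ω) : ℕ := MulAction.period W.R ω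

theorem CW.d_pos (W : CW X) (ω : Ω) {n : ℕ} (hn : 0 < n) (h : W.R ^ n • ω = ω) : 0 < W.d ω :=
  Nat.pos_of_dvd_of_pos (MulAction.pow_smul_eq_iff_period_dvd.1 h) hn

theorem CW.edge_ne (W : CW X) {S : Finset Ω} (hS : ∀ ω ∈ S, W.R • ω ∈ S) {ω : Ω} (hω : ω ∈ S)
    (alone : ∀ ω' ∈ S, ∀ k < W.L, W.edge ω' k = W.edge ω 0 → ω' = ω ∧ k = 0) (j : ℕ)
    (hj : 0 < j) (hj2 : j < W.d ω * W.L) : W.edge ω j ≠ W.edge ω 0 := by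
  intro he
  rw [W.edge_mod] at he
  obtain ⟨h1, h2⟩ := alone _ (W.pow_mem hS _ _ hω) _ (Nat.mod_lt _ W.hL) he
  have h3 : W.d ω ∣ j / W.L := MulAction.pow_smul_eq_iff_period_dvd.1 h1
  have h4 : j / W.L < W.d ω := Nat.div_lt_of_lt_mul (by rwa [mul_comm])
  have h5 : j / W.L = 0 := Nat.eq_zero_of_dvd_of_lt h3 h4
  have := Nat.mod_add_div j W.L
  rw [h2, h5] at this
  omega

theorem Coll.extend {W : CW X} {S S' : Finset Ω} {Z : Finset (Ω × X)} {V : Finset Ω}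
    (h : Coll W S S' Z V) (hS : ∀ ω ∈ S, W.R • ω ∈ S) (n : ℕ) (hn : 0 < n)
    (hSn : ∀ ω ∈ S, W.R ^ n • ω = ω) (p : Ω → P) :
    ∀ f₀ : Ω × X → P, ∃ f : Ω × X → P, (∀ e, e ∉ Z → f e = f₀ e) ∧
      ∀ v ∈ V, cc f (W.R ^ W.d v) v = p v := by
  induction h with
  | nil => intro f₀; exact ⟨f₀, by simp, by simp⟩
  | cons S' Z V ω hc hω alone ih =>
    intro f₀
    have hi := hc.collInv hS n hn hSn
    have hd := W.d_pos ω hn (hSn _ (hi.sub hω))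
    have hm : W.d ω * W.L = (W.d ω * W.L - 1) + 1 := (Nat.sub_add_cancel
      (Nat.mul_pos hd W.hL)).symm
    obtain ⟨f₁, h1, h2⟩ := cc_solve W f₀ ω (W.d ω * W.L - 1) (by
      intro j hj hj2
      rw [← hm] at hj2
      exact W.edge_ne hi.inv hω alone j hj hj2) (p ω)
    rw [← hm, W.s_mul] at h2
    obtain ⟨f, h3, h4⟩ := ih f₁
    refine ⟨f, ?_, ?_⟩
    · intro e he
      rw [Finset.mem_insert, not_or] at he
      rw [h3 e he.2, h1 e he.1]
    · intro v hv
      rcases Finset.mem_insert.1 hv with rfl | hv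
      · rw [← h2, ← W.s_mul]
        apply cc_s_congr
        intro j
        apply h3
        intro hZ
        exact hi.dis _ hZ (W.edge_mem_E hi.inv hω j)
      · exact h4 v hv

theorem Coll.closed {W : CW X} {S S' : Finset Ω} {Z : Finset (Ω × X)} {V : Finset Ω}
    (h : Coll W S S' Z V) (hS : ∀ ω ∈ S, W.R • ω ∈ S) (n : ℕ) (hn : 0 < n)
    (hSn : ∀ ω ∈ S, W.R ^ n • ω = ω) (H₀ : Subgroup P) (f : Ω × X → P) :
    (∀ e, e ∉ Z → f e ∈ H₀) → (∀ v ∈ V, cc f (W.R ^ W.d v) v ∈ H₀) → ∀ e, f e ∈ H₀ := by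
  induction h with
  | nil => intro h1 _ e; exact h1 e (by simp)
  | cons S' Z V ω hc hω alone ih =>
    intro h1 h2
    have hi := hc.collInv hS n hn hSn
    have hd := W.d_pos ω hn (hSn _ (hi.sub hω))
    have hm : W.d ω * W.L = (W.d ω * W.L - 1) + 1 := (Nat.sub_add_cancel
      (Nat.mul_pos hd W.hL)).symm
    have h3 := cc_s_mem W f H₀ ω (W.d ω * W.L - 1) (by
      intro j hj hj2
      rw [← hm] at hj2
      apply h1
      rw [Finset.mem_insert, not_or]
      exact ⟨W.edge_ne hi.inv hω alone j hj hj2, fun hZ =>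
        hi.dis _ hZ (W.edge_mem_E hi.inv hω j)⟩)
    rw [← hm, W.s_mul, H₀.mul_mem_cancel_left (h2 ω (Finset.mem_insert_self _ _)),
      H₀.inv_mem_iff, cc_s_one] at h3
    have h4 : f (W.edge ω 0) ∈ H₀ := by
      split_ifs at h3
      · exact h3
      · exact H₀.inv_mem_iff.1 h3
    apply ih
    · intro e he
      by_cases hee : e = W.edge ω 0
      · rw [hee]; exact h4
      · apply h1
        rw [Finset.mem_insert, not_or]; exact ⟨hee, he⟩
    · intro v hv; exact h2 v (Finset.mem_insert_of_mem hv)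

/-- one can always collapse until stuck -/
theorem exists_coll (W : CW X) (S : Finset Ω) (c : ℕ) :
    ∀ (S₁ : Finset Ω) (Z₁ : Finset (Ω × X)) (V₁ : Finset Ω), S₁.card ≤ c → Coll W S S₁ Z₁ V₁ →
    ∃ (S' : Finset Ω) (Z : Finset (Ω × X)) (V : Finset Ω), Coll W S S' Z V ∧
      ∀ ω ∈ S', ∃ ω' ∈ S', ∃ k < W.L, W.edge ω' k = W.edge ω 0 ∧ ¬ (ω' = ω ∧ k = 0) := by
  induction c with
  | zero =>
    intro S₁ Z₁ V₁ hc h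
    refine ⟨S₁, Z₁, V₁, h, ?_⟩
    have : S₁ = ∅ := by simpa using hc
    simp [this]
  | succ c ih =>
    intro S₁ Z₁ V₁ hc h
    by_cases hex : ∃ ω ∈ S₁, ∀ ω' ∈ S₁, ∀ k < W.L, W.edge ω' k = W.edge ω 0 → ω' = ω ∧ k = 0
    · obtain ⟨ω, hω, alone⟩ := hex
      refine ih _ _ _ ?_ (Coll.cons S₁ Z₁ V₁ ω h hω alone)
      have : S₁.filter (fun ω' => ∀ q : ℕ, W.R ^ q • ω ≠ ω') ⊂ S₁ :=
        Finset.filter_ssubset.2 ⟨ω, hω, fun h => h 0 (by simp)⟩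
      have := Finset.card_lt_card this
      omega
    · push Not at hex
      refine ⟨S₁, Z₁, V₁, h, fun ω hω => ?_⟩
      obtain ⟨ω', h1, k, h2, h3, h4⟩ := hex ω hω
      exact ⟨ω', h1, k, h2, h3, fun h5 => h4 h5.1 h5.2⟩

end
end OR

namespace OR
section
open scoped Classical
variable {X : Type} {Ω : Type} [MulAction (FreeGroup X) Ω] {P : Type} [Group P]

theorem cc_unique (f : Ω × X → P) (k : FreeGroup X → Ω → P)
    (h1 : ∀ g h ω, k (g * h) ω = k g (h • ω) * k h ω) (h2 : ∀ x ω, k (FreeGroup.of x) ω = f (ω, x))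
    (g : FreeGroup X) : ∀ ω : Ω, k g ω = cc f g ω := by
  have hone : ∀ ω, k 1 ω = 1 := by
    intro ω
    have := h1 1 1 ω
    simpa using this
  have hg : g ∈ Subgroup.closure (Set.range (FreeGroup.of (α := X))) := by
    rw [FreeGroup.closure_range_of]; trivial
  induction hg using Subgroup.closure_induction with
  | mem g hg => 
    obtain ⟨x, rfl⟩ := hg
    intro ω; rw [cc_of, h2]
  | one => intro ω; simp [hone]
  | mul g h _ _ h3 h4 => intro ω; rw [cc_mul, h1, h3, h4]
  | inv g _ h3 =>
    intro ω
    rw [cc_inv', ← h3]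
    apply eq_inv_of_mul_eq_one_right
    have := h1 g g⁻¹ ω
    rw [← this]; simp [hone]

/-- rational cocycle, as a linear functional of the cochain -/
def qc (g : FreeGroup X) (ω : Ω) : (Ω × X → ℚ) →ₗ[ℚ] ℚ where
  toFun f := Multiplicative.toAdd (cc (fun e => Multiplicative.ofAdd (f e)) g ω)
  map_add' f f' := by
    have := cc_unique (fun e => Multiplicative.ofAdd ((f + f') e))
      (fun g ω => cc (fun e => Multiplicative.ofAdd (f e)) g ω *
        cc (fun e => Multiplicative.ofAdd (f' e)) g ω) (by
        intro g h ω; simp only [cc_mul]; exact mul_mul_mul_comm _ _ _ _) (by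
        intro x ω; simp only [cc_of]; rfl) g ω
    rw [← this]; rfl
  map_smul' c f := by
    have := cc_unique (fun e => Multiplicative.ofAdd ((c • f) e))
      (fun g ω => Multiplicative.ofAdd (c * Multiplicative.toAdd
        (cc (fun e => Multiplicative.ofAdd (f e)) g ω))) (by
        intro g h ω; simp only [cc_mul, toAdd_mul, mul_add, ofAdd_add]) (by
        intro x ω; simp only [cc_of]; rfl) g ω
    rw [← this]; rfl

theorem qc_mul (g h : FreeGroup X) (ω : Ω) (f : Ω × X → ℚ) :
    qc (g * h) ω f = qc g (h • ω) f + qc h ω f := by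
  simp only [qc, LinearMap.coe_mk, AddHom.coe_mk, cc_mul, toAdd_mul]

theorem qc_of (x : X) (ω : Ω) (f : Ω × X → ℚ) : qc (FreeGroup.of x) ω f = f (ω, x) := by
  simp only [qc, LinearMap.coe_mk, AddHom.coe_mk, cc_of]; rfl

@[simp] theorem qc_one (ω : Ω) (f : Ω × X → ℚ) : qc 1 ω f = 0 := by
  simp [qc]

theorem qc_conj (g h : FreeGroup X) (ω : Ω) (hh : h • ω = ω) (f : Ω × X → ℚ) :
    qc (g * h * g⁻¹) (g • ω) f = qc h ω f := by
  have h1 := qc_mul (g * h * g⁻¹) g ω f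
  have h2 : g * h * g⁻¹ * g = g * h := by group
  rw [h2, qc_mul, hh] at h1
  linarith

theorem qc_pow (h : FreeGroup X) (ω : Ω) (hh : h • ω = ω) (q : ℕ) (f : Ω × X → ℚ) :
    qc (h ^ q) ω f = q * qc h ω f := by
  induction q with
  | zero => simp
  | succ q ih => rw [pow_succ, qc_mul, hh, ih]; push_cast; ring

theorem CW.d_smul (W : CW X) (ω : Ω) (q : ℕ) : W.d (W.R ^ q • ω) = W.d ω := by
  apply Nat.dvd_antisymm
  · apply MulAction.pow_smul_eq_iff_period_dvd.1
    rw [smul_smul, ← pow_add, add_comm, pow_add, mul_smul]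
    congr 1
    exact MulAction.pow_smul_eq_iff_period_dvd.2 dvd_rfl
  · apply MulAction.pow_smul_eq_iff_period_dvd.1
    have : W.R ^ W.d (W.R ^ q • ω) • W.R ^ q • ω = W.R ^ q • ω :=
      MulAction.pow_smul_eq_iff_period_dvd.2 dvd_rfl
    rw [smul_smul, ← pow_add, add_comm, pow_add, mul_smul] at this
    exact smul_left_cancel _ this

theorem CW.pow_d_smul (W : CW X) (ω : Ω) : W.R ^ W.d ω • ω = ω :=
  MulAction.pow_smul_eq_iff_period_dvd.2 dvd_rfl

theorem CW.qc_orbit (W : CW X) (ω : Ω) (q : ℕ) (f : Ω × X → ℚ) :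
    qc (W.R ^ W.d (W.R ^ q • ω)) (W.R ^ q • ω) f = qc (W.R ^ W.d ω) ω f := by
  rw [W.d_smul, ← qc_conj (W.R ^ q) (W.R ^ W.d ω) ω (W.pow_d_smul ω)]
  congr 2
  rw [← pow_add, add_comm, pow_add, mul_inv_cancel_right]

theorem CW.ends_mem (W : CW X) {S : Finset Ω} (hS : ∀ ω ∈ S, W.R • ω ∈ S) {e : Ω × X}
    (he : e ∈ W.E S) : e.1 ∈ W.V S ∧ FreeGroup.of e.2 • e.1 ∈ W.V S := by
  obtain ⟨⟨ω, j⟩, hp, rfl⟩ := Finset.mem_image.1 he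
  rw [Finset.mem_product] at hp
  refine ⟨W.smul_mem_V hS hp.1 _, ?_⟩
  rcases hl : W.l j with ⟨x, b⟩
  cases b
  · have h1 : FreeGroup.mk [(x, false)] = (FreeGroup.of x)⁻¹ := by simp [FreeGroup.of]; rfl
    have h2 : W.s (j+1) • ω = (FreeGroup.of x)⁻¹ • W.s j • ω := by
      rw [W.s_succ, hl, h1, mul_smul]
    simp only [CW.edge, CW.sig, hl]
    simp only [Bool.false_eq_true, if_false]
    rw [h2, smul_inv_smul]
    exact W.smul_mem_V hS hp.1 _
  · have h1 : FreeGroup.mk [(x, true)] = FreeGroup.of x := rfl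
    have h2 : W.s (j+1) • ω = (FreeGroup.of x) • W.s j • ω := by
      rw [W.s_succ, hl, h1, mul_smul]
    simp only [CW.edge, CW.sig, hl]
    simp only [if_true]
    rw [← h2]
    exact W.smul_mem_V hS hp.1 _

theorem dim_count [MulAction.IsPretransitive (FreeGroup X) Ω] (ω₀ : Ω) (W : SW X)
    {S S' : Finset Ω} {Z : Finset (Ω × X)} {V : Finset Ω}
    (h : Coll W.toCW S S' Z V) (hS : ∀ ω ∈ S, W.R • ω ∈ S) (n : ℕ) (hn : 0 < n)
    (hSn : ∀ ω ∈ S, W.R ^ n • ω = ω)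
    (hstuck : ∀ ω ∈ S', ∃ ω' ∈ S', ∃ k < W.L, W.edge ω' k = W.edge ω 0 ∧ ¬ (ω' = ω ∧ k = 0))
    (hne : S'.Nonempty) (δ : ℕ) (y : Fin δ → FreeGroup X) (V'' : Finset Ω)
    (hV'' : ∀ ω ∈ S', ∃ v ∈ V'', ∃ q : ℕ, W.R ^ q • v = ω)
    (hyp : ∀ f : Ω × X → ℚ, (∀ i, qc (y i) ω₀ f = 0) → (∀ v ∈ S, qc (W.R ^ W.d v) v f = 0) →
      ∀ g : FreeGroup X, g • ω₀ = ω₀ → qc g ω₀ f = 0) :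
    S'.card + 1 ≤ δ + V''.card ∧ (S'.card + 1 = δ + V''.card → ∀ (a : Fin δ → ℚ) (b : Ω → ℚ),
      ∃ f : Ω × X → ℚ, (∀ i, qc (y i) ω₀ f = a i) ∧ (∀ v ∈ V, qc (W.R ^ W.d v) v f = b v) ∧
        ∀ v ∈ V'', qc (W.R ^ W.d v) v f = b v) := by
  have hi := h.collInv hS n hn hSn
  have hw := W.wlemma S' hi.inv hstuck
  obtain ⟨v₀, hv₀⟩ := hne
  have hv₀V : v₀ ∈ W.V S' := by simpa using W.smul_mem_V hi.inv hv₀ 0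
  have htr : ∀ v : Ω, ∃ t : FreeGroup X, t • v₀ = v := fun v =>
    MulAction.exists_smul_eq _ v₀ v
  choose t ht using htr
  let Y := Z ∪ W.E S'
  have hYcard : Y.card = V.card + (W.E S').card := by
    rw [← hi.card]
    apply Finset.card_union_of_disjoint
    rw [Finset.disjoint_left]
    exact hi.dis
  let ι := Fin δ ⊕ V ⊕ V'' ⊕ ((W.V S').erase v₀)
  let ext : (Y → ℚ) →ₗ[ℚ] (Ω × X → ℚ) := Function.ExtendByZero.linearMap ℚ Subtype.val
  have hext1 : ∀ f e (he : e ∈ Y), ext f e = f ⟨e, he⟩ := by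
    intro f e he
    change Function.extend Subtype.val f 0 e = _
    exact Subtype.val_injective.extend_apply f 0 ⟨e, he⟩
  have hext2 : ∀ f e, e ∉ Y → ext f e = 0 := by
    intro f e he
    change Function.extend Subtype.val f 0 e = _
    rw [Function.extend_apply']
    · rfl
    · rintro ⟨⟨a, ha⟩, rfl⟩; exact he ha
  let comp : ι → ((Ω × X → ℚ) →ₗ[ℚ] ℚ) := fun i => match i with
    | Sum.inl i => qc (y i) ω₀
    | Sum.inr (Sum.inl v) => qc (W.R ^ W.d v.1) v.1
    | Sum.inr (Sum.inr (Sum.inl v)) => qc (W.R ^ W.d v.1) v.1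
    | Sum.inr (Sum.inr (Sum.inr v)) => qc (t v.1) v₀
  let Θ : (Y → ℚ) →ₗ[ℚ] (ι → ℚ) := (LinearMap.pi comp).comp ext
  have hinj : Function.Injective Θ := by
    rw [injective_iff_map_eq_zero]
    intro f hf
    have hf' : ∀ i, comp i (ext f) = 0 := fun i => congrFun hf i
    have hS0 : ∀ v ∈ S, qc (W.R ^ W.d v) v (ext f) = 0 := by
      intro ω hω
      rcases hi.cov ω hω with h1 | ⟨v, hv, q, rfl⟩
      · obtain ⟨v, hv, q, rfl⟩ := hV'' ω h1
        rw [W.qc_orbit]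
        exact hf' (Sum.inr (Sum.inr (Sum.inl ⟨v, hv⟩)))
      · rw [W.qc_orbit]
        exact hf' (Sum.inr (Sum.inl ⟨v, hv⟩))
    have hstab := hyp (ext f) (fun i => hf' (Sum.inl i)) hS0
    have hwd : ∀ (g g' : FreeGroup X) (ω : Ω), g • ω = g' • ω →
        qc g ω (ext f) = qc g' ω (ext f) := by
      intro g g' ω hg
      obtain ⟨u, hu⟩ := MulAction.exists_smul_eq (FreeGroup X) ω₀ ω
      have h1 := hstab (u⁻¹ * g'⁻¹ * g * u) (by
        simp only [mul_smul, hu, hg, inv_smul_smul]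
        rw [← hu, inv_smul_smul])
      have h2 := qc_mul (g' * u) (u⁻¹ * g'⁻¹ * g * u) ω₀ (ext f)
      have h3 : g' * u * (u⁻¹ * g'⁻¹ * g * u) = g * u := by group
      have h4 : (u⁻¹ * g'⁻¹ * g * u) • ω₀ = ω₀ := by
        simp only [mul_smul, hu, hg, inv_smul_smul]
        rw [← hu, inv_smul_smul]
      rw [h3, h1, h4, qc_mul, qc_mul, hu] at h2
      linarith
    have hV0 : ∀ v ∈ W.V S', qc (t v) v₀ (ext f) = 0 := by
      intro v hv
      by_cases hvv : v = v₀
      · subst hvv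
        rw [hwd (t v) 1 v (by rw [ht, one_smul]), qc_one]
      · exact hf' (Sum.inr (Sum.inr (Sum.inr ⟨v, Finset.mem_erase.2 ⟨hvv, hv⟩⟩)))
    have hE0 : ∀ e ∈ W.E S', ext f e = 0 := by
      rintro ⟨ν, x⟩ he
      obtain ⟨h1, h2⟩ := W.ends_mem hi.inv he
      have h3 := hwd (t (FreeGroup.of x • ν)) (FreeGroup.of x * t ν) v₀ (by
        rw [ht, mul_smul, ht])
      rw [hV0 _ h2, qc_mul, hV0 _ h1, ht, qc_of] at h3
      linarith
    have hall := h.closed hS n hn hSn (⊥ : Subgroup (Multiplicative ℚ))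
      (fun e => Multiplicative.ofAdd (ext f e)) (by
        intro e he
        rw [Subgroup.mem_bot]
        by_cases heE : e ∈ W.E S'
        · rw [hE0 e heE]; rfl
        · rw [hext2 f e (by simp [Y, he, heE])]; rfl) (by
        intro v hv
        rw [Subgroup.mem_bot]
        exact hS0 v (hi.VS hv))
    funext ⟨e, he⟩
    have := hall e
    rw [Subgroup.mem_bot, hext1 f e he] at this
    exact this
  have hcardι : Fintype.card ι = δ + (V.card + (V''.card + ((W.V S').card - 1))) := by
    simp only [ι, Fintype.card_sum, Fintype.card_fin, Fintype.card_coe]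
    rw [Finset.card_erase_of_mem hv₀V]
  have hVpos : 0 < (W.V S').card := Finset.card_pos.2 ⟨_, hv₀V⟩
  have hle := LinearMap.finrank_le_finrank_of_injective hinj
  rw [Module.finrank_fintype_fun_eq_card, Module.finrank_fintype_fun_eq_card, hcardι,
    Fintype.card_coe, hYcard] at hle
  refine ⟨by omega, ?_⟩
  intro heq a b
  have hfr : Module.finrank ℚ (Y → ℚ) = Module.finrank ℚ (ι → ℚ) := by
    rw [Module.finrank_fintype_fun_eq_card, Module.finrank_fintype_fun_eq_card, hcardι,
      Fintype.card_coe, hYcard]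
    omega
  have hsurj := (LinearMap.injective_iff_surjective_of_finrank_eq_finrank hfr).1 hinj
  obtain ⟨f, hf⟩ := hsurj (fun i => match i with
    | Sum.inl i => a i
    | Sum.inr (Sum.inl v) => b v.1
    | Sum.inr (Sum.inr (Sum.inl v)) => b v.1
    | Sum.inr (Sum.inr (Sum.inr v)) => 0)
  refine ⟨ext f, fun i => congrFun hf (Sum.inl i), fun v hv =>
    congrFun hf (Sum.inr (Sum.inl ⟨v, hv⟩)), fun v hv =>
    congrFun hf (Sum.inr (Sum.inr (Sum.inl ⟨v, hv⟩)))⟩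

/-- orbit representatives for orbits of length at least two -/
theorem exists_reps (W : CW X) (n : ℕ) (hn : 0 < n) (c : ℕ) : ∀ S : Finset Ω, S.card ≤ c →
    (∀ ω ∈ S, W.R • ω ∈ S) → (∀ ω ∈ S, W.R ^ n • ω = ω) → (∀ ω ∈ S, W.R • ω ≠ ω) →
    ∃ V : Finset Ω, V ⊆ S ∧ (∀ ω ∈ S, ∃ v ∈ V, ∃ q : ℕ, W.R ^ q • v = ω) ∧
      2 * V.card ≤ S.card := by
  induction c with
  | zero =>
    intro S hc _ _ _
    have : S = ∅ := by simpa using hc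
    exact ⟨∅, by simp, by simp [this], by simp⟩
  | succ c ih =>
    intro S hc hS hSn h2
    rcases S.eq_empty_or_nonempty with rfl | ⟨ω, hω⟩
    · exact ⟨∅, by simp, by simp, by simp⟩
    let S₁ := S.filter (fun ω' => ∀ q : ℕ, W.R ^ q • ω ≠ ω')
    have hsub : S₁ ∪ {ω, W.R • ω} ⊆ S := by
      intro a ha
      simp only [S₁, Finset.mem_union, Finset.mem_filter, Finset.mem_insert,
        Finset.mem_singleton] at ha
      rcases ha with ha | rfl | rfl
      · exact ha.1
      · exact hω
      · exact hS _ hω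
    have hdis : Disjoint S₁ {ω, W.R • ω} := by
      rw [Finset.disjoint_right]
      intro a ha ha2
      have := (Finset.mem_filter.1 ha2).2
      simp only [Finset.mem_insert, Finset.mem_singleton] at ha
      rcases ha with rfl | rfl
      · exact this 0 (by simp)
      · exact this 1 (by simp)
    have hcard : S₁.card + 2 ≤ S.card := by
      have := Finset.card_le_card hsub
      rwa [Finset.card_union_of_disjoint hdis, Finset.card_pair (h2 ω hω).symm] at this
    obtain ⟨V, hV1, hV2, hV3⟩ := ih S₁ (by omega) (by
      intro ω' hω'
      obtain ⟨h1, h3⟩ := Finset.mem_filter.1 hω'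
      refine Finset.mem_filter.2 ⟨hS _ h1, fun q hq => h3 (n - 1 + q) ?_⟩
      rw [pow_add, mul_smul, hq, smul_smul, ← pow_succ, Nat.sub_add_cancel hn, hSn _ h1])
      (fun ω' h => hSn _ (Finset.mem_filter.1 h).1) (fun ω' h => h2 _ (Finset.mem_filter.1 h).1)
    refine ⟨insert ω V, ?_, ?_, ?_⟩
    · exact Finset.insert_subset hω (hV1.trans (Finset.filter_subset _ _))
    · intro ω' hω'
      by_cases h : ∀ q : ℕ, W.R ^ q • ω ≠ ω'
      · obtain ⟨v, hv, q, hq⟩ := hV2 ω' (Finset.mem_filter.2 ⟨hω', h⟩)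
        exact ⟨v, Finset.mem_insert_of_mem hv, q, hq⟩
      · push Not at h
        obtain ⟨q, hq⟩ := h
        exact ⟨ω, Finset.mem_insert_self _ _, q, hq⟩
    · have := Finset.card_insert_le ω V
      omega

/-- Conclusion for `δ = 0`. -/
theorem coll_zero [MulAction.IsPretransitive (FreeGroup X) Ω] (ω₀ : Ω) (W : SW X)
    (S : Finset Ω) (hS : ∀ ω ∈ S, W.R • ω ∈ S) (n : ℕ) (hn : 0 < n)
    (hSn : ∀ ω ∈ S, W.R ^ n • ω = ω)
    (hyp : ∀ f : Ω × X → ℚ, (∀ v ∈ S, qc (W.R ^ W.d v) v f = 0) →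
      ∀ g : FreeGroup X, g • ω₀ = ω₀ → qc g ω₀ f = 0) :
    ∃ Z V, Coll W.toCW S ∅ Z V := by
  obtain ⟨S', Z, V, hc, hst⟩ := exists_coll W.toCW S S.card S ∅ ∅ le_rfl Coll.nil
  rcases S'.eq_empty_or_nonempty with rfl | hne
  · exact ⟨Z, V, hc⟩
  · have := (dim_count ω₀ W hc hS n hn hSn hst hne 0 Fin.elim0 S'
      (fun ω hω => ⟨ω, hω, 0, by simp⟩) (fun f _ => hyp f)).1
    omega

/-- Conclusion for `δ = 1` and periods at least two. -/
theorem coll_one [MulAction.IsPretransitive (FreeGroup X) Ω] (ω₀ : Ω) (W : SW X)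
    (S : Finset Ω) (hS : ∀ ω ∈ S, W.R • ω ∈ S) (n : ℕ) (hn : 0 < n)
    (hSn : ∀ ω ∈ S, W.R ^ n • ω = ω) (h2 : ∀ ω ∈ S, W.R • ω ≠ ω) (y : FreeGroup X)
    (hyp : ∀ f : Ω × X → ℚ, qc y ω₀ f = 0 → (∀ v ∈ S, qc (W.R ^ W.d v) v f = 0) →
      ∀ g : FreeGroup X, g • ω₀ = ω₀ → qc g ω₀ f = 0) :
    ∃ Z V, Coll W.toCW S ∅ Z V := by
  obtain ⟨S', Z, V, hc, hst⟩ := exists_coll W.toCW S S.card S ∅ ∅ le_rfl Coll.nil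
  rcases S'.eq_empty_or_nonempty with rfl | hne
  · exact ⟨Z, V, hc⟩
  · have hi := hc.collInv hS n hn hSn
    obtain ⟨V'', _, h3, h4⟩ := exists_reps W.toCW n hn _ S' le_rfl hi.inv
      (fun ω h => hSn _ (hi.sub h)) (fun ω h => h2 _ (hi.sub h))
    have := (dim_count ω₀ W hc hS n hn hSn hst hne 1 (fun _ => y) V'' h3
      (fun f hf => hyp f (hf 0))).1
    have := Finset.card_pos.2 hne
    omega

/-- Conclusion for `δ = 2` and periods at least two. -/
theorem coll_two [MulAction.IsPretransitive (FreeGroup X) Ω] (ω₀ : Ω) (W : SW X)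
    (S : Finset Ω) (hS : ∀ ω ∈ S, W.R • ω ∈ S) (n : ℕ) (hn : 0 < n)
    (hSn : ∀ ω ∈ S, W.R ^ n • ω = ω) (h2 : ∀ ω ∈ S, W.R • ω ≠ ω) (y : Fin 2 → FreeGroup X)
    (hyp : ∀ f : Ω × X → ℚ, (∀ i, qc (y i) ω₀ f = 0) → (∀ v ∈ S, qc (W.R ^ W.d v) v f = 0) →
      ∀ g : FreeGroup X, g • ω₀ = ω₀ → qc g ω₀ f = 0) :
    (∃ Z V, Coll W.toCW S ∅ Z V) ∨ ∃ V : Finset Ω, V ⊆ S ∧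
      (∀ ω ∈ S, ∃ v ∈ V, ∃ q : ℕ, W.R ^ q • v = ω) ∧ ∀ (a : Fin 2 → ℚ) (b : Ω → ℚ),
      ∃ f : Ω × X → ℚ, (∀ i, qc (y i) ω₀ f = a i) ∧ (∀ v ∈ V, qc (W.R ^ W.d v) v f = b v) := by
  obtain ⟨S', Z, V, hc, hst⟩ := exists_coll W.toCW S S.card S ∅ ∅ le_rfl Coll.nil
  rcases S'.eq_empty_or_nonempty with rfl | hne
  · exact Or.inl ⟨Z, V, hc⟩
  · right
    have hi := hc.collInv hS n hn hSn
    obtain ⟨V'', h5, h3, h4⟩ := exists_reps W.toCW n hn _ S' le_rfl hi.inv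
      (fun ω h => hSn _ (hi.sub h)) (fun ω h => h2 _ (hi.sub h))
    obtain ⟨h6, h7⟩ := dim_count ω₀ W hc hS n hn hSn hst hne 2 y V'' h3 hyp
    have hp := Finset.card_pos.2 hne
    have hp2 : 0 < V''.card := by
      obtain ⟨ω, hω⟩ := hne
      obtain ⟨v, hv, _⟩ := h3 ω hω
      exact Finset.card_pos.2 ⟨v, hv⟩
    refine ⟨V ∪ V'', Finset.union_subset hi.VS (h5.trans hi.sub), ?_, ?_⟩
    · intro ω hω
      rcases hi.cov ω hω with h | ⟨v, hv, q, hq⟩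
      · obtain ⟨v, hv, q, hq⟩ := h3 ω h
        exact ⟨v, Finset.mem_union_right _ hv, q, hq⟩
      · exact ⟨v, Finset.mem_union_left _ hv, q, hq⟩
    · intro a b
      obtain ⟨f, h8, h9, h10⟩ := h7 (by omega) a b
      refine ⟨f, h8, fun v hv => ?_⟩
      rcases Finset.mem_union.1 hv with hv | hv
      · exact h9 v hv
      · exact h10 v hv

end
end OR

namespace OR
section
open scoped Classical
variable {X : Type} {P : Type} [Group P]

/-- period of the coset of `u⁻¹` under `R` -/
noncomputable def per (R : FreeGroup X) (H : Subgroup (FreeGroup X)) (u : FreeGroup X) : ℕ :=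
  MulAction.period R (u⁻¹ • ((1 : FreeGroup X) : FreeGroup X ⧸ H))

theorem smul_base (H : Subgroup (FreeGroup X)) (g : FreeGroup X) :
    g • ((1 : FreeGroup X) : FreeGroup X ⧸ H) = ((1 : FreeGroup X) : FreeGroup X ⧸ H) ↔ g ∈ H := by
  rw [MulAction.Quotient.smul_coe, smul_eq_mul, mul_one, eq_comm, QuotientGroup.eq]
  simp

theorem conj_pt {H : Subgroup (FreeGroup X)} {g u : FreeGroup X} :
    g • u⁻¹ • ((1 : FreeGroup X) : FreeGroup X ⧸ H) = u⁻¹ • ((1 : FreeGroup X) : FreeGroup X ⧸ H) ↔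
      u * g * u⁻¹ ∈ H := by
  rw [← smul_base, eq_inv_smul_iff, mul_smul, mul_smul]

theorem per_iff {R : FreeGroup X} {H : Subgroup (FreeGroup X)} {u : FreeGroup X} {m : ℕ} :
    u * R ^ m * u⁻¹ ∈ H ↔ per R H u ∣ m := by
  rw [← conj_pt]; exact MulAction.pow_smul_eq_iff_period_dvd

theorem per_mem (R : FreeGroup X) (H : Subgroup (FreeGroup X)) (u : FreeGroup X) :
    u * R ^ per R H u * u⁻¹ ∈ H := per_iff.2 dvd_rfl

theorem per_conj (R : FreeGroup X) (H : Subgroup (FreeGroup X)) (u g : FreeGroup X) :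
    per R H (u * g) = per (g * R * g⁻¹) H u := by
  apply Nat.dvd_right_iff_eq.1
  intro m
  rw [← per_iff, ← per_iff, conj_pow]
  simp [mul_assoc]

theorem per_trans (R : FreeGroup X) (H : Subgroup (FreeGroup X)) (v h : FreeGroup X) (hh : h ∈ H)
    (i : ℕ) : per R H (h * v * R ^ i) = per R H v := by
  apply Nat.dvd_right_iff_eq.1
  intro m
  rw [← per_iff, ← per_iff]
  have : h * v * R ^ i * R ^ m * (h * v * R ^ i)⁻¹ = h * (v * R ^ m * v⁻¹) * h⁻¹ := by
    rw [mul_assoc (h * v), ← pow_add, add_comm, pow_add]; group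
  rw [this]
  constructor
  · intro h1
    have := H.mul_mem (H.mul_mem (H.inv_mem hh) h1) hh
    simpa [mul_assoc] using this
  · intro h1; exact H.mul_mem (H.mul_mem hh h1) (H.inv_mem hh)

/-- the loop at `u` -/
noncomputable def loop (R : FreeGroup X) (H : Subgroup (FreeGroup X)) (u : FreeGroup X) : H :=
  ⟨u * R ^ per R H u * u⁻¹, per_mem R H u⟩

structure Outcome (R : FreeGroup X) (H : Subgroup (FreeGroup X)) (x₀ : X)
    (V : Finset (FreeGroup X)) : Prop where
  dist : ∀ v ∈ V, ∀ v' ∈ V, ∀ h ∈ H, ∀ i : ℕ, v' = h * v * R ^ i → v = v'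
  map : ∀ (P : Type) [Group P] (p : FreeGroup X → P), ∃ θ : H →* P, ∀ v ∈ V, ∃ q,
    θ (loop R H v) = q * p v * q⁻¹
  rho : ∃ ρ : H →* FreeGroup X, (∀ v ∈ V, ρ (loop R H v) = 1) ∧
    (∀ h, ρ h = 1 → h ∈ Subgroup.normalClosure (loop R H '' (V : Set (FreeGroup X)))) ∧
    ((∀ h, ρ h = 1) → (∃ k : FreeGroup X → FreeGroup X, (∀ v ∈ V, k v ∈ H) ∧
        H = Subgroup.closure ((fun v => k v * (v * R ^ per R H v * v⁻¹) * (k v)⁻¹) ''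
          (V : Set (FreeGroup X)))) ∧
      ∀ h ∈ H, h ∈ Subgroup.closure (FreeGroup.of '' {x | x ≠ x₀}) → h = 1)

/-- the homomorphism of a cochain on the coset space -/
noncomputable def ccHom (H : Subgroup (FreeGroup X)) (f : (FreeGroup X ⧸ H) × X → P) : H →* P where
  toFun h := cc f h ((1 : FreeGroup X) : FreeGroup X ⧸ H)
  map_one' := by simp
  map_mul' a b := by
    rw [Subgroup.coe_mul, cc_mul, (smul_base H b).2 b.2]

theorem ccHom_apply (H : Subgroup (FreeGroup X)) (f : (FreeGroup X ⧸ H) × X → P) (h : H) :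
    ccHom H f h = cc f h ((1 : FreeGroup X) : FreeGroup X ⧸ H) := rfl

theorem ccHom_conj (H : Subgroup (FreeGroup X)) (f : (FreeGroup X ⧸ H) × X → P)
    (u g : FreeGroup X) (hg : u * g * u⁻¹ ∈ H) :
    ccHom H f ⟨u * g * u⁻¹, hg⟩ =
      cc f u (u⁻¹ • ((1 : FreeGroup X) : FreeGroup X ⧸ H)) *
      cc f g (u⁻¹ • ((1 : FreeGroup X) : FreeGroup X ⧸ H)) *
      (cc f u (u⁻¹ • ((1 : FreeGroup X) : FreeGroup X ⧸ H)))⁻¹ := by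
  rw [ccHom_apply]
  have := cc_conj f u g (u⁻¹ • ((1 : FreeGroup X) : FreeGroup X ⧸ H)) (conj_pt.2 hg)
  rw [smul_inv_smul] at this
  exact this

/-- the tautological cochain -/
theorem taut {H : Subgroup (FreeGroup X)} (w : FreeGroup X ⧸ H → FreeGroup X)
    (g : FreeGroup X) (ω : FreeGroup X ⧸ H) :
    cc (fun e : (FreeGroup X ⧸ H) × X =>
      (w (FreeGroup.of e.2 • e.1))⁻¹ * FreeGroup.of e.2 * w e.1) g ω =
      (w (g • ω))⁻¹ * g * w ω := by
  symm
  apply cc_unique _ (fun g ω => (w (g • ω))⁻¹ * g * w ω)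
  · intro g h ω
    simp only [mul_smul]; group
  · intro x ω; rfl

theorem cc_prod {Ω Q : Type} [MulAction (FreeGroup X) Ω] [Group Q] (f : Ω × X → P)
    (f' : Ω × X → Q) (g : FreeGroup X) (ω : Ω) :
    cc (fun e => (f e, f' e)) g ω = (cc f g ω, cc f' g ω) := by
  apply Prod.ext
  · exact (cc_map (MonoidHom.fst P Q) _ g ω).symm
  · exact (cc_map (MonoidHom.snd P Q) _ g ω).symm

theorem coll_outcome (W : CW X) (H : Subgroup (FreeGroup X)) (S : Finset (FreeGroup X ⧸ H))
    (hS : ∀ ω ∈ S, W.R • ω ∈ S) (n : ℕ) (hn : 0 < n)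
    (hSn : ∀ ω ∈ S, W.R ^ n • ω = ω) {Z : Finset ((FreeGroup X ⧸ H) × X)}
    {V : Finset (FreeGroup X ⧸ H)} (hc : Coll W S ∅ Z V)
    (w : FreeGroup X ⧸ H → FreeGroup X)
    (hw : ∀ ν, w ν • ((1 : FreeGroup X) : FreeGroup X ⧸ H) = ν)
    (hw1 : w ((1 : FreeGroup X) : FreeGroup X ⧸ H) = 1) :
    Outcome W.R H (W.l 0).1 (V.image (fun v => (w v)⁻¹)) := by
  have hi := hc.collInv hS n hn hSn
  set o := ((1 : FreeGroup X) : FreeGroup X ⧸ H) with ho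
  have hpt : ∀ v, ((w v)⁻¹)⁻¹ • o = v := fun v => by rw [inv_inv, hw]
  have hper : ∀ v, per W.R H (w v)⁻¹ = W.d v := fun v => by
    unfold per CW.d; rw [← ho, hpt]
  refine ⟨?_, ?_, ?_⟩
  · simp only [Finset.mem_image]
    rintro _ ⟨v, hv, rfl⟩ _ ⟨v', hv', rfl⟩ h hh i he
    have h1 : W.R ^ i • v' = v := by
      rw [← hpt v', ← hpt v, inv_inv, inv_inv]
      have : w v = W.R ^ i * w v' * h := by
        rw [inv_eq_iff_eq_inv] at he
        rw [he]; group
      rw [this, mul_smul, mul_smul, (smul_base H h).2 hh]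
    rw [hi.dist v' hv' v hv i h1]
  · intro P _ p
    obtain ⟨f, h1, h2⟩ := hc.extend hS n hn hSn (fun v => p (w v)⁻¹) (fun _ => 1)
    refine ⟨ccHom H f, ?_⟩
    simp only [Finset.mem_image]
    rintro _ ⟨v, hv, rfl⟩
    unfold loop
    rw [ccHom_conj, hper, ← ho, hpt, h2 v hv]
    exact ⟨_, rfl⟩
  · set f₀ : (FreeGroup X ⧸ H) × X → FreeGroup X := fun e =>
      (w (FreeGroup.of e.2 • e.1))⁻¹ * FreeGroup.of e.2 * w e.1 with hf0
    have hf0H : ∀ e, f₀ e ∈ H := by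
      rintro ⟨ν, x⟩
      rw [← smul_base]
      simp only [hf0, mul_smul]
      rw [← ho, hw, inv_smul_eq_iff, hw]
    obtain ⟨f, h1, h2⟩ := hc.extend hS n hn hSn (fun _ => 1) f₀
    have hfH : ∀ e, f e ∈ H := by
      apply hc.closed hS n hn hSn
      · intro e he; rw [h1 e he]; exact hf0H e
      · intro v hv; rw [h2 v hv]; exact H.one_mem
    refine ⟨ccHom H f, ?_, ?_, ?_⟩
    · simp only [Finset.mem_image]
      rintro _ ⟨v, hv, rfl⟩
      unfold loop
      rw [ccHom_conj, hper, ← ho, hpt, h2 v hv]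
      simp
    · intro h hρ
      set K := Subgroup.normalClosure (loop W.R H '' ((V.image (fun v => (w v)⁻¹) :
        Finset (FreeGroup X)) : Set (FreeGroup X))) with hK
      -- the subgroup of pairs congruent mod K
      let q := QuotientGroup.mk' K
      let HH : Subgroup (H × H) := (MonoidHom.eqLocus (q.comp (MonoidHom.fst H H))
        (q.comp (MonoidHom.snd H H)))
      let H₀ : Subgroup (FreeGroup X × FreeGroup X) := HH.map (H.subtype.prodMap H.subtype)
      have hH0 : ∀ a b : H, (q a = q b) → ((a : FreeGroup X), (b : FreeGroup X)) ∈ H₀ := by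
        intro a b hab
        exact ⟨(a, b), hab, rfl⟩
      have key : ∀ e, (f₀ e, f e) ∈ H₀ := by
        apply hc.closed hS n hn hSn H₀ (fun e => (f₀ e, f e))
        · intro e he
          rw [h1 e he]
          exact hH0 ⟨f₀ e, hf0H e⟩ ⟨f₀ e, hf0H e⟩ rfl
        · intro v hv
          rw [cc_prod, h2 v hv, hf0, taut, W.pow_d_smul]
          have h3 := hH0 (loop W.R H (w v)⁻¹) 1 (by
            rw [map_one]
            apply (QuotientGroup.eq_one_iff _).2
            apply Subgroup.subset_normalClosure
            exact ⟨(w v)⁻¹, by simpa using ⟨v, hv, rfl⟩, rfl⟩)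
          simpa [loop, hper] using h3
      have h3 := cc_mem (fun e => (f₀ e, f e)) H₀ key (h : FreeGroup X) o
      rw [cc_prod, hf0, taut, (smul_base H h).2 h.2, hw1] at h3
      have h4 : cc f (h : FreeGroup X) o = 1 := hρ
      rw [h4] at h3
      obtain ⟨⟨a, b⟩, hab, he⟩ := h3
      have ha : (a : FreeGroup X) = h := by simpa using congrArg Prod.fst he
      have hb : (b : FreeGroup X) = 1 := by simpa using congrArg Prod.snd he
      have hb' : b = 1 := Subtype.ext hb
      have ha' : a = h := Subtype.ext ha
      subst hb' ha'
      have h5 : q a = q 1 := hab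
      rw [map_one] at h5
      exact (QuotientGroup.eq_one_iff _).1 h5
    · intro htriv
      have htriv' : ∀ h ∈ H, cc f h o = 1 := fun h hh => htriv ⟨h, hh⟩
      set β : FreeGroup X ⧸ H → FreeGroup X := fun ν => cc f (w ν) o with hβ
      have hβ1 : ∀ g, β (g • o) = cc f g o := by
        intro g
        have hm : (w (g • o))⁻¹ * g ∈ H := by
          rw [← smul_base, mul_smul, ← ho, inv_smul_eq_iff, hw]
        have : g = w (g • o) * ((w (g • o))⁻¹ * g) := by group
        conv_rhs => rw [this]
        rw [cc_mul, (smul_base H _).2 hm, ← ho, htriv' _ hm, mul_one]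
      have hβx : ∀ ν x, f (ν, x) = β (FreeGroup.of x • ν) * (β ν)⁻¹ := by
        intro ν x
        have h3 := hβ1 (FreeGroup.of x * w ν)
        rw [mul_smul, hw] at h3
        rw [h3, cc_mul, hw, cc_of]
        simp [hβ]
      have hβH : ∀ ν, β ν ∈ H := fun ν => cc_mem f H hfH _ _
      set w' : FreeGroup X ⧸ H → FreeGroup X := fun ν => w ν * β ν with hw'
      have hw'o : ∀ ν, w' ν • o = ν := by
        intro ν
        rw [hw', mul_smul, (smul_base H _).2 (hβH ν), hw]
      have hw'1 : w' o = 1 := by simp [hw', hβ, hw1]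
      set f' : (FreeGroup X ⧸ H) × X → FreeGroup X := fun e =>
        (w' (FreeGroup.of e.2 • e.1))⁻¹ * FreeGroup.of e.2 * w' e.1 with hf'
      have hf'Z : ∀ e, e ∉ Z → f' e = 1 := by
        rintro ⟨ν, x⟩ he
        have h3 := h1 _ he
        rw [hβx] at h3
        have h4 : f' (ν, x) = (β (FreeGroup.of x • ν))⁻¹ * f₀ (ν, x) * β ν := by
          simp only [hf', hw', hf0]; group
        rw [h4, ← h3]; group
      have hh : ∀ h ∈ H, cc f' h o = h := by
        intro h hh
        rw [hf', taut, (smul_base H h).2 hh, ← ho, hw'1]; simp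
      constructor
      · refine ⟨fun u => (w' (u⁻¹ • o))⁻¹ * u⁻¹, ?_, ?_⟩
        · simp only [Finset.mem_image]
          rintro _ ⟨v, hv, rfl⟩
          rw [hpt, ← smul_base, mul_smul, ← ho, hpt, inv_smul_eq_iff, hw'o]
        · set H₀ := Subgroup.closure ((fun v => (w' (v⁻¹ • o))⁻¹ * v⁻¹ * (v * W.R ^ per W.R H v * v⁻¹)
            * ((w' (v⁻¹ • o))⁻¹ * v⁻¹)⁻¹) '' ((V.image (fun v => (w v)⁻¹) :
              Finset (FreeGroup X)) : Set (FreeGroup X))) with hH0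
          apply le_antisymm
          · intro h hhH
            rw [← hh h hhH]
            apply cc_mem
            apply hc.closed hS n hn hSn
            · intro e he; rw [hf'Z e he]; exact H₀.one_mem
            · intro v hv
              rw [hf', taut, W.pow_d_smul]
              apply Subgroup.subset_closure
              refine ⟨(w v)⁻¹, by simpa using ⟨v, hv, rfl⟩, ?_⟩
              simp only [hpt, hper]
              group
          · rw [hH0, Subgroup.closure_le]
            rintro _ ⟨u, hu, rfl⟩
            have : (w' (u⁻¹ • o))⁻¹ * u⁻¹ ∈ H := by
              rw [← smul_base, mul_smul, ← ho, inv_smul_eq_iff, hw'o]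
            exact H.mul_mem (H.mul_mem this (per_mem _ _ _)) (H.inv_mem this)
      · intro h hhH hcl
        rw [← hh h hhH]
        have := cc_mem' f' ⊥ {x | x ≠ (W.l 0).1} (by
          intro ω x hx
          rw [hf'Z]; exact Subgroup.one_mem _
          intro hZ
          exact hx (hi.let0 _ hZ)) h hcl o
        simpa using this

end
end OR

namespace OR
section
open scoped Classical
variable {X : Type} {P : Type} [Group P]

theorem loop_conj (R : FreeGroup X) (H : Subgroup (FreeGroup X)) (u g : FreeGroup X) :
    loop R H (u * g) = loop (g * R * g⁻¹) H u := by
  apply Subtype.ext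
  simp only [loop, per_conj, conj_pow]
  group

theorem Outcome.conj {R : FreeGroup X} {H : Subgroup (FreeGroup X)} {x₀ : X} {g : FreeGroup X}
    {V : Finset (FreeGroup X)} (h : Outcome (g * R * g⁻¹) H x₀ V) :
    Outcome R H x₀ (V.image (fun v => v * g)) := by
  refine ⟨?_, ?_, ?_⟩
  · simp only [Finset.mem_image]
    rintro _ ⟨v, hv, rfl⟩ _ ⟨v', hv', rfl⟩ a ha i he
    rw [h.dist v hv v' hv' a ha i]
    rw [conj_pow]
    rw [← mul_left_inj g, he]; group
  · intro P _ p
    obtain ⟨θ, hθ⟩ := h.map P (fun v => p (v * g))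
    refine ⟨θ, ?_⟩
    simp only [Finset.mem_image]
    rintro _ ⟨v, hv, rfl⟩
    rw [loop_conj]
    exact hθ v hv
  · obtain ⟨ρ, h1, h2, h3⟩ := h.rho
    have e1 : loop R H '' ((V.image (fun v => v * g) : Finset _) : Set (FreeGroup X)) =
        loop (g * R * g⁻¹) H '' (V : Set (FreeGroup X)) := by
      rw [Finset.coe_image, Set.image_image]
      simp only [loop_conj]
    refine ⟨ρ, ?_, ?_, ?_⟩
    · simp only [Finset.mem_image]
      rintro _ ⟨v, hv, rfl⟩
      rw [loop_conj]
      exact h1 v hv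
    · rw [e1]; exact h2
    · intro ht
      obtain ⟨⟨k, h4, h5⟩, h6⟩ := h3 ht
      refine ⟨⟨fun v => k (v * g⁻¹), ?_, ?_⟩, h6⟩
      · simp only [Finset.mem_image]
        rintro _ ⟨v, hv, rfl⟩
        simpa using h4 v hv
      · rw [Finset.coe_image, Set.image_image]
        convert h5 using 4
        · simp only [mul_inv_cancel_right, conj_pow, per_conj]
          simp [mul_assoc]
        · simp only [mul_inv_cancel_right]

theorem zpow_nat {R : FreeGroup X} {H : Subgroup (FreeGroup X)} {n : ℕ} (hn : 0 < n)
    {u : FreeGroup X} (hu : u * R ^ n * u⁻¹ ∈ H) (i : ℤ) :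
    ∃ h ∈ H, ∃ j : ℕ, u * R ^ i = h * u * R ^ j := by
  refine ⟨(u * R ^ n * u⁻¹) ^ (i / n), H.zpow_mem hu _, (i % n).toNat, ?_⟩
  have h1 : 0 ≤ i % n := Int.emod_nonneg _ (by positivity)
  rw [conj_zpow, ← zpow_natCast R n, ← zpow_mul, ← zpow_natCast R (i % n).toNat,
    Int.toNat_of_nonneg h1]
  conv_lhs => rw [← Int.mul_ediv_add_emod i n, zpow_add]
  group

/-- `V` and `U` represent the same double cosets -/
def Cov (R : FreeGroup X) (H : Subgroup (FreeGroup X)) (U V : Finset (FreeGroup X)) : Prop :=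
  (∀ u ∈ U, ∃ v ∈ V, ∃ h ∈ H, ∃ i : ℤ, u = h * v * R ^ i) ∧
  (∀ v ∈ V, ∃ u ∈ U, ∃ h ∈ H, ∃ i : ℤ, v = h * u * R ^ i)

theorem mem_trans_iff (R : FreeGroup X) (H : Subgroup (FreeGroup X)) (v h : FreeGroup X)
    (hh : h ∈ H) (i : ℤ) (m : ℕ) :
    (h * v * R ^ i) * R ^ m * (h * v * R ^ i)⁻¹ ∈ H ↔ v * R ^ m * v⁻¹ ∈ H := by
  have : h * v * R ^ i * R ^ m * (h * v * R ^ i)⁻¹ = h * (v * R ^ m * v⁻¹) * h⁻¹ := by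
    rw [← zpow_natCast, mul_assoc (h * v), ← zpow_add, add_comm, zpow_add]; group
  rw [this]
  constructor
  · intro h1
    have := H.mul_mem (H.mul_mem (H.inv_mem hh) h1) hh
    simpa [mul_assoc] using this
  · intro h1; exact H.mul_mem (H.mul_mem hh h1) (H.inv_mem hh)

theorem per_trans' (R : FreeGroup X) (H : Subgroup (FreeGroup X)) (v h : FreeGroup X) (hh : h ∈ H)
    (i : ℤ) : per R H (h * v * R ^ i) = per R H v := by
  apply Nat.dvd_right_iff_eq.1
  intro m
  rw [← per_iff, ← per_iff, mem_trans_iff R H v h hh]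

theorem loop_trans (R : FreeGroup X) (H : Subgroup (FreeGroup X)) (v h : FreeGroup X) (hh : h ∈ H)
    (i : ℤ) : loop R H (h * v * R ^ i) = ⟨h, hh⟩ * loop R H v * ⟨h, hh⟩⁻¹ := by
  apply Subtype.ext
  simp only [loop, per_trans' R H v h hh, Subgroup.coe_mul, Subgroup.coe_inv]
  rw [← zpow_natCast, mul_assoc (h * v), ← zpow_add, add_comm, zpow_add]; group

theorem Cov.conj {R : FreeGroup X} {H : Subgroup (FreeGroup X)} {g : FreeGroup X}
    {U V : Finset (FreeGroup X)} (h : Cov (g * R * g⁻¹) H (U.image (fun u => u * g⁻¹)) V) :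
    Cov R H U (V.image (fun v => v * g)) := by
  constructor
  · intro u hu
    obtain ⟨v, hv, a, ha, i, h1⟩ := h.1 _ (Finset.mem_image_of_mem _ hu)
    refine ⟨v * g, Finset.mem_image_of_mem _ hv, a, ha, i, ?_⟩
    rw [conj_zpow] at h1
    rw [mul_inv_eq_iff_eq_mul] at h1
    rw [h1]; group
  · simp only [Finset.mem_image]
    rintro _ ⟨v, hv, rfl⟩
    obtain ⟨_, hu', a, ha, i, h1⟩ := h.2 v hv
    obtain ⟨u, hu, rfl⟩ := Finset.mem_image.1 hu'
    refine ⟨u, hu, a, ha, i, ?_⟩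
    rw [h1, conj_zpow]; group

/-- a rational cochain as a multiplicative one -/
def mq {Ω : Type} (f : Ω × X → ℚ) : Ω × X → Multiplicative ℚ := fun e => Multiplicative.ofAdd (f e)

/-- the set of points -/
noncomputable def pts (R : FreeGroup X) (H : Subgroup (FreeGroup X)) (n : ℕ)
    (U : Finset (FreeGroup X)) : Finset (FreeGroup X ⧸ H) :=
  (U ×ˢ Finset.range n).image (fun a => R ^ a.2 • a.1⁻¹ • ((1 : FreeGroup X) : FreeGroup X ⧸ H))

theorem mem_pts {R : FreeGroup X} {H : Subgroup (FreeGroup X)} {n : ℕ} (hn : 0 < n)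
    {U : Finset (FreeGroup X)} (hU : ∀ u ∈ U, u * R ^ n * u⁻¹ ∈ H) (ω : FreeGroup X ⧸ H) :
    ω ∈ pts R H n U ↔ ∃ u ∈ U, ∃ i : ℕ, ω = R ^ i • u⁻¹ • ((1 : FreeGroup X) : FreeGroup X ⧸ H) := by
  unfold pts
  simp only [Finset.mem_image, Finset.mem_product, Finset.mem_range, Prod.exists]
  constructor
  · rintro ⟨u, i, ⟨h1, h2⟩, rfl⟩; exact ⟨u, h1, i, rfl⟩
  · rintro ⟨u, h1, i, rfl⟩
    refine ⟨u, i % n, ⟨h1, Nat.mod_lt _ hn⟩, ?_⟩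
    have h2 := conj_pt.2 (hU u h1)
    have h3 : ∀ q : ℕ, (R ^ n) ^ q • u⁻¹ • ((1 : FreeGroup X) : FreeGroup X ⧸ H) =
        u⁻¹ • ((1 : FreeGroup X) : FreeGroup X ⧸ H) := by
      intro q
      induction q with
      | zero => simp
      | succ q ih => rw [pow_succ, mul_smul, h2, ih]
    conv_rhs => rw [← Nat.mod_add_div i n, pow_add, pow_mul, mul_smul, h3]

theorem pts_inv {R : FreeGroup X} {H : Subgroup (FreeGroup X)} {n : ℕ} (hn : 0 < n)
    {U : Finset (FreeGroup X)} (hU : ∀ u ∈ U, u * R ^ n * u⁻¹ ∈ H) :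
    ∀ ω ∈ pts R H n U, R • ω ∈ pts R H n U := by
  intro ω hω
  rw [mem_pts hn hU] at hω ⊢
  obtain ⟨u, hu, i, rfl⟩ := hω
  exact ⟨u, hu, i + 1, by rw [pow_succ', mul_smul]⟩

theorem pts_n {R : FreeGroup X} {H : Subgroup (FreeGroup X)} {n : ℕ} (hn : 0 < n)
    {U : Finset (FreeGroup X)} (hU : ∀ u ∈ U, u * R ^ n * u⁻¹ ∈ H) :
    ∀ ω ∈ pts R H n U, R ^ n • ω = ω := by
  intro ω hω
  rw [mem_pts hn hU] at hω
  obtain ⟨u, hu, i, rfl⟩ := hω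
  rw [← mul_smul, ← pow_add, add_comm, pow_add, mul_smul, conj_pt.2 (hU u hu)]

theorem exists_w (H : Subgroup (FreeGroup X)) : ∃ w : FreeGroup X ⧸ H → FreeGroup X,
    (∀ ν, w ν • ((1 : FreeGroup X) : FreeGroup X ⧸ H) = ν) ∧
    w ((1 : FreeGroup X) : FreeGroup X ⧸ H) = 1 := by
  refine ⟨fun ν => if ν = ((1 : FreeGroup X) : FreeGroup X ⧸ H) then 1 else ν.out, ?_, by simp⟩
  intro ν
  by_cases h : ν = ((1 : FreeGroup X) : FreeGroup X ⧸ H)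
  · simp [h]
  · simp only [h, if_false]
    rw [MulAction.Quotient.smul_coe, smul_eq_mul, mul_one]
    exact QuotientGroup.out_eq' ν

theorem coll_fin (W : CW X) (H : Subgroup (FreeGroup X)) (n : ℕ) (hn : 0 < n)
    (U : Finset (FreeGroup X)) (hU : ∀ u ∈ U, u * W.R ^ n * u⁻¹ ∈ H)
    (h : ∃ Z V, Coll W (pts W.R H n U) ∅ Z V) :
    ∃ V, Outcome W.R H (W.l 0).1 V ∧ Cov W.R H U V := by
  obtain ⟨Z, V, hc⟩ := h
  obtain ⟨w, hw, hw1⟩ := exists_w H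
  have hi := hc.collInv (pts_inv hn hU) n hn (pts_n hn hU)
  refine ⟨_, coll_outcome W H _ (pts_inv hn hU) n hn (pts_n hn hU) hc w hw hw1, ?_, ?_⟩
  · intro u hu
    rcases hi.cov (u⁻¹ • ((1 : FreeGroup X) : FreeGroup X ⧸ H))
      ((mem_pts hn hU _).2 ⟨u, hu, 0, by simp⟩) with h | ⟨v, hv, q, hq⟩
    · simp at h
    · refine ⟨(w v)⁻¹, Finset.mem_image_of_mem _ hv, u * W.R ^ q * w v, ?_, ?_⟩
      · rw [← smul_base, mul_smul, mul_smul, hw, hq, smul_inv_smul]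
      · exact ⟨-q, by rw [zpow_neg, zpow_natCast]; group⟩
  · simp only [Finset.mem_image]
    rintro _ ⟨v, hv, rfl⟩
    obtain ⟨u, hu, i, hi⟩ := (mem_pts hn hU _).1 (hi.VS hv)
    refine ⟨u, hu, (w v)⁻¹ * W.R ^ i * u⁻¹, ?_, -i, by rw [zpow_neg, zpow_natCast]; group⟩
    rw [← smul_base, mul_smul, mul_smul, ← hi, inv_smul_eq_iff, hw]

/-- translating the rational hypothesis -/
theorem hyp_trans (W : CW X) (H : Subgroup (FreeGroup X)) (n : ℕ) (hn : 0 < n)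
    (U : Finset (FreeGroup X)) (hU : ∀ u ∈ U, u * W.R ^ n * u⁻¹ ∈ H)
    (f : (FreeGroup X ⧸ H) × X → ℚ)
    (h : ∀ v ∈ pts W.R H n U, qc (W.R ^ W.d v) v f = 0) (u : FreeGroup X) (hu : u ∈ U) :
    ccHom H (mq f) (loop W.R H u) = 1 := by
  have h1 := h (u⁻¹ • ((1 : FreeGroup X) : FreeGroup X ⧸ H))
    ((mem_pts hn hU _).2 ⟨u, hu, 0, by simp⟩)
  unfold loop
  rw [ccHom_conj]
  have h2 : cc (mq f) (W.R ^ per W.R H u) (u⁻¹ • ((1 : FreeGroup X) : FreeGroup X ⧸ H)) = 1 := h1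
  rw [h2]; simp

theorem qc_ccHom (H : Subgroup (FreeGroup X)) (f : (FreeGroup X ⧸ H) × X → ℚ) (h : H) :
    qc (h : FreeGroup X) ((1 : FreeGroup X) : FreeGroup X ⧸ H) f =
      Multiplicative.toAdd (ccHom H (mq f) h) := rfl

theorem master_zero' (W : SW X) (H : Subgroup (FreeGroup X)) (n : ℕ) (hn : 0 < n)
    (U : Finset (FreeGroup X)) (hU : ∀ u ∈ U, u * W.R ^ n * u⁻¹ ∈ H)
    (hyp : ∀ χ : H →* Multiplicative ℚ, (∀ u ∈ U, χ (loop W.R H u) = 1) → ∀ h, χ h = 1) :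
    ∃ V, Outcome W.R H (W.l 0).1 V ∧ Cov W.R H U V := by
  apply coll_fin W.toCW H n hn U hU
  apply coll_zero ((1 : FreeGroup X) : FreeGroup X ⧸ H) W _ (pts_inv hn hU) n hn (pts_n hn hU)
  intro f hf g hg
  rw [smul_base] at hg
  have := hyp (ccHom H (mq f)) (hyp_trans W.toCW H n hn U hU f hf) ⟨g, hg⟩
  exact (qc_ccHom H f ⟨g, hg⟩).trans (by rw [this]; rfl)

theorem pts_two {R : FreeGroup X} {H : Subgroup (FreeGroup X)} {n : ℕ} (hn : 0 < n)
    {U : Finset (FreeGroup X)} (hU : ∀ u ∈ U, u * R ^ n * u⁻¹ ∈ H)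
    (h2 : ∀ u ∈ U, u * R * u⁻¹ ∉ H) : ∀ ω ∈ pts R H n U, R • ω ≠ ω := by
  intro ω hω he
  rw [mem_pts hn hU] at hω
  obtain ⟨u, hu, i, rfl⟩ := hω
  apply h2 u hu
  rw [← conj_pt]
  rw [← mul_smul, ← pow_succ', pow_succ, mul_smul] at he
  exact MulAction.injective _ he

theorem master_one' (W : SW X) (H : Subgroup (FreeGroup X)) (n : ℕ) (hn : 0 < n)
    (U : Finset (FreeGroup X)) (hU : ∀ u ∈ U, u * W.R ^ n * u⁻¹ ∈ H)
    (h2 : ∀ u ∈ U, u * W.R * u⁻¹ ∉ H) (y : H)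
    (hyp : ∀ χ : H →* Multiplicative ℚ, χ y = 1 → (∀ u ∈ U, χ (loop W.R H u) = 1) → ∀ h, χ h = 1) :
    ∃ V, Outcome W.R H (W.l 0).1 V ∧ Cov W.R H U V := by
  apply coll_fin W.toCW H n hn U hU
  apply coll_one ((1 : FreeGroup X) : FreeGroup X ⧸ H) W _ (pts_inv hn hU) n hn (pts_n hn hU)
    (pts_two hn hU h2) y
  intro f hy hf g hg
  rw [smul_base] at hg
  have := hyp (ccHom H (mq f)) (by rw [qc_ccHom] at hy; exact hy)
    (hyp_trans W.toCW H n hn U hU f hf) ⟨g, hg⟩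
  exact (qc_ccHom H f ⟨g, hg⟩).trans (by rw [this]; rfl)

/-- transport along conjugation -/
theorem transport (R : FreeGroup X) (g : FreeGroup X) (H : Subgroup (FreeGroup X)) (n : ℕ)
    (U : Finset (FreeGroup X)) (hU : ∀ u ∈ U, u * R ^ n * u⁻¹ ∈ H) :
    (∀ u ∈ U.image (fun u => u * g⁻¹), u * (g * R * g⁻¹) ^ n * u⁻¹ ∈ H) ∧
    (∀ (χ : H → Prop), (∀ u ∈ U.image (fun u => u * g⁻¹), χ (loop (g * R * g⁻¹) H u)) →
      ∀ u ∈ U, χ (loop R H u)) := by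
  constructor
  · simp only [Finset.mem_image]
    rintro _ ⟨u, hu, rfl⟩
    rw [conj_pow]
    convert hU u hu using 1
    group
  · intro χ h u hu
    have := h _ (Finset.mem_image_of_mem _ hu)
    rw [← loop_conj] at this
    simpa using this

/-- the rational Heisenberg group -/
@[ext] structure Heis where
  a : ℚ
  b : ℚ
  c : ℚ

namespace Heis

instance : Mul Heis := ⟨fun p q => ⟨p.a + q.a, p.b + q.b, p.c + q.c + p.a * q.b⟩⟩
instance : One Heis := ⟨⟨0, 0, 0⟩⟩
instance : Inv Heis := ⟨fun p => ⟨-p.a, -p.b, -p.c + p.a * p.b⟩⟩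

@[simp] theorem mul_a (p q : Heis) : (p * q).a = p.a + q.a := rfl
@[simp] theorem mul_b (p q : Heis) : (p * q).b = p.b + q.b := rfl
@[simp] theorem mul_c (p q : Heis) : (p * q).c = p.c + q.c + p.a * q.b := rfl
@[simp] theorem one_a : (1 : Heis).a = 0 := rfl
@[simp] theorem one_b : (1 : Heis).b = 0 := rfl
@[simp] theorem one_c : (1 : Heis).c = 0 := rfl
@[simp] theorem inv_a (p : Heis) : (p⁻¹).a = -p.a := rfl
@[simp] theorem inv_b (p : Heis) : (p⁻¹).b = -p.b := rfl
@[simp] theorem inv_c (p : Heis) : (p⁻¹).c = -p.c + p.a * p.b := rfl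

instance : Group Heis := Group.ofLeftAxioms
  (by intro p q r; ext <;> simp <;> ring)
  (by intro p; ext <;> simp)
  (by intro p; ext <;> simp)

/-- first coordinate -/
def fa : Heis →* Multiplicative ℚ where
  toFun p := Multiplicative.ofAdd p.a
  map_one' := rfl
  map_mul' _ _ := rfl

/-- second coordinate -/
def fb : Heis →* Multiplicative ℚ where
  toFun p := Multiplicative.ofAdd p.b
  map_one' := rfl
  map_mul' _ _ := rfl

theorem pow_a (p : Heis) (k : ℤ) : (p ^ k).a = k * p.a := by
  have := map_zpow fa p k
  have h2 : (p ^ k).a = Multiplicative.toAdd (fa (p ^ k)) := rfl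
  rw [h2, this, toAdd_zpow]; simp [fa]

theorem pow_b (p : Heis) (k : ℤ) : (p ^ k).b = k * p.b := by
  have := map_zpow fb p k
  have h2 : (p ^ k).b = Multiplicative.toAdd (fb (p ^ k)) := rfl
  rw [h2, this, toAdd_zpow]; simp [fb]

/-- noncommuting -/
theorem not_comm (p q : Heis) (hp : p.a = 1 ∧ p.b = 0) (hq : q.a = 0 ∧ q.b = 1) (k : ℤ)
    (hk : k ≠ 0) : q * p ^ k ≠ p ^ k * q := by
  intro h
  have := congrArg Heis.c h
  simp [pow_a, pow_b, hp.1, hp.2, hq.1, hq.2] at this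
  rw [add_comm] at this
  apply hk
  have h3 : (k : ℚ) = 0 := by linarith
  exact_mod_cast h3

end Heis

theorem cell_orbit {Ω : Type} [MulAction (FreeGroup X) Ω] (W : CW X) (f : Ω × X → P) (v : Ω)
    (q : ℕ) (h : cc f (W.R ^ W.d v) v = 1) :
    cc f (W.R ^ W.d (W.R ^ q • v)) (W.R ^ q • v) = 1 := by
  have := cc_conj f (W.R ^ q) (W.R ^ W.d v) v (W.pow_d_smul v)
  rw [h] at this
  have h2 : W.R ^ q * W.R ^ W.d v * (W.R ^ q)⁻¹ = W.R ^ W.d v := by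
    rw [← pow_add, add_comm, pow_add]; simp
  rw [W.d_smul, ← h2, this]; simp

theorem master_two' (W : SW X) (H : Subgroup (FreeGroup X)) (n : ℕ) (hn : 0 < n)
    (U : Finset (FreeGroup X)) (hU : ∀ u ∈ U, u * W.R ^ n * u⁻¹ ∈ H)
    (h2 : ∀ u ∈ U, u * W.R * u⁻¹ ∉ H) (y z : H)
    (hyp : ∀ χ : H →* Multiplicative ℚ, χ y = 1 → χ z = 1 →
      (∀ u ∈ U, χ (loop W.R H u) = 1) → ∀ h, χ h = 1) :
    (∃ V, Outcome W.R H (W.l 0).1 V ∧ Cov W.R H U V) ∨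
    ∃ θ : H →* Heis, ((θ y).a = 1 ∧ (θ y).b = 0) ∧ ((θ z).a = 0 ∧ (θ z).b = 1) ∧
      ∀ u ∈ U, θ (loop W.R H u) = 1 := by
  rcases coll_two ((1 : FreeGroup X) : FreeGroup X ⧸ H) W _ (pts_inv hn hU) n hn (pts_n hn hU)
    (pts_two hn hU h2) ![(y : FreeGroup X), (z : FreeGroup X)] (by
      intro f hy hf g hg
      rw [smul_base] at hg
      have := hyp (ccHom H (mq f)) (by have := hy 0; exact this) (by have := hy 1; exact this)
        (hyp_trans W.toCW H n hn U hU f hf) ⟨g, hg⟩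
      exact (qc_ccHom H f ⟨g, hg⟩).trans (by rw [this]; rfl)) with h | ⟨V, hVS, hcov, hsurj⟩
  · exact Or.inl (coll_fin W.toCW H n hn U hU h)
  · right
    obtain ⟨φ, hφ1, hφ2⟩ := hsurj ![1, 0] (fun _ => 0)
    obtain ⟨ψ, hψ1, hψ2⟩ := hsurj ![0, 1] (fun _ => 0)
    let f₁ : (FreeGroup X ⧸ H) × X → Heis := fun e => ⟨φ e, ψ e, 0⟩
    have ha : ∀ g ω, (cc f₁ g ω).a = qc g ω φ := by
      intro g ω
      have := cc_map Heis.fa f₁ g ω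
      exact (congrArg Multiplicative.toAdd this).symm
    have hb : ∀ g ω, (cc f₁ g ω).b = qc g ω ψ := by
      intro g ω
      have := cc_map Heis.fb f₁ g ω
      exact (congrArg Multiplicative.toAdd this).symm
    obtain ⟨χ, _, hχ⟩ := hsurj ![0, 0] (fun v => - (cc f₁ (W.R ^ W.d v) v).c)
    let f : (FreeGroup X ⧸ H) × X → Heis := fun e => ⟨φ e, ψ e, χ e⟩
    have hf : ∀ g ω, cc f g ω = cc f₁ g ω * ⟨0, 0, qc g ω χ⟩ := by
      intro g ω
      symm
      apply cc_unique f (fun g ω => cc f₁ g ω * ⟨0, 0, qc g ω χ⟩)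
      · intro g h ω
        ext
        · simp [cc_mul]
        · simp [cc_mul]
        · simp [cc_mul, qc_mul]; ring
      · intro x ω
        rw [cc_of, qc_of]
        ext <;> simp [f₁, f]
    refine ⟨ccHom H f, ⟨?_, ?_⟩, ⟨?_, ?_⟩, ?_⟩
    · rw [ccHom_apply, hf]
      have := hφ1 0
      simp [ha]
      exact this
    · rw [ccHom_apply, hf]
      have := hψ1 0
      simp [hb]
      exact this
    · rw [ccHom_apply, hf]
      have := hφ1 1
      simp [ha]
      exact this
    · rw [ccHom_apply, hf]
      have := hψ1 1
      simp [hb]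
      exact this
    · intro u hu
      obtain ⟨v, hv, q, hq⟩ := hcov (u⁻¹ • ((1 : FreeGroup X) : FreeGroup X ⧸ H))
        ((mem_pts hn hU _).2 ⟨u, hu, 0, by simp⟩)
      have h3 : cc f (W.R ^ W.d v) v = 1 := by
        rw [hf]
        ext
        · simp [ha, hφ2 v hv]
        · simp [hb, hψ2 v hv]
        · simp [hχ v hv]
      have h4 := cell_orbit W.toCW f v q h3
      rw [hq] at h4
      unfold loop
      rw [ccHom_conj]
      have h5 : cc f (W.R ^ per W.R H u) (u⁻¹ • ((1 : FreeGroup X) : FreeGroup X ⧸ H)) = 1 := h4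
      rw [h5]; simp

theorem master_zero {R : FreeGroup X} (hR : NotPow R) (H : Subgroup (FreeGroup X)) (n : ℕ)
    (hn : 0 < n) (U : Finset (FreeGroup X)) (hU : ∀ u ∈ U, u * R ^ n * u⁻¹ ∈ H)
    (hyp : ∀ χ : H →* Multiplicative ℚ, (∀ u ∈ U, χ (loop R H u) = 1) → ∀ h, χ h = 1) :
    ∃ x₀ V, Outcome R H x₀ V ∧ Cov R H U V := by
  obtain ⟨W, g, hg⟩ := exists_SW' R hR
  obtain ⟨t1, t2⟩ := transport R g H n U hU
  obtain ⟨V, h1, h2⟩ := master_zero' W H n hn (U.image (fun u => u * g⁻¹)) (by rw [hg]; exact t1)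
    (by rw [hg]; intro χ h; exact hyp χ (t2 (fun h => χ h = 1) h))
  rw [hg] at h1 h2
  exact ⟨_, _, h1.conj, h2.conj⟩

theorem transport2 {R : FreeGroup X} (g : FreeGroup X) {H : Subgroup (FreeGroup X)}
    {U : Finset (FreeGroup X)} (h : ∀ u ∈ U, u * R * u⁻¹ ∉ H) :
    ∀ u ∈ U.image (fun u => u * g⁻¹), u * (g * R * g⁻¹) * u⁻¹ ∉ H := by
  simp only [Finset.mem_image]
  rintro _ ⟨u, hu, rfl⟩
  convert h u hu using 2
  group

theorem master_one {R : FreeGroup X} (hR : NotPow R) (H : Subgroup (FreeGroup X)) (n : ℕ)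
    (hn : 0 < n) (U : Finset (FreeGroup X)) (hU : ∀ u ∈ U, u * R ^ n * u⁻¹ ∈ H)
    (h2 : ∀ u ∈ U, u * R * u⁻¹ ∉ H) (y : H)
    (hyp : ∀ χ : H →* Multiplicative ℚ, χ y = 1 → (∀ u ∈ U, χ (loop R H u) = 1) → ∀ h, χ h = 1) :
    ∃ x₀ V, Outcome R H x₀ V ∧ Cov R H U V := by
  obtain ⟨W, g, hg⟩ := exists_SW' R hR
  obtain ⟨t1, t2⟩ := transport R g H n U hU
  obtain ⟨V, h1, h2⟩ := master_one' W H n hn (U.image (fun u => u * g⁻¹)) (by rw [hg]; exact t1)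
    (by rw [hg]; exact transport2 g h2) y
    (by rw [hg]; intro χ h0 h; exact hyp χ h0 (t2 (fun h => χ h = 1) h))
  rw [hg] at h1 h2
  exact ⟨_, _, h1.conj, h2.conj⟩

theorem master_two {R : FreeGroup X} (hR : NotPow R) (H : Subgroup (FreeGroup X)) (n : ℕ)
    (hn : 0 < n) (U : Finset (FreeGroup X)) (hU : ∀ u ∈ U, u * R ^ n * u⁻¹ ∈ H)
    (h2 : ∀ u ∈ U, u * R * u⁻¹ ∉ H) (y z : H)
    (hyp : ∀ χ : H →* Multiplicative ℚ, χ y = 1 → χ z = 1 →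
      (∀ u ∈ U, χ (loop R H u) = 1) → ∀ h, χ h = 1) :
    (∃ x₀ V, Outcome R H x₀ V ∧ Cov R H U V) ∨
    ∃ θ : H →* Heis, ((θ y).a = 1 ∧ (θ y).b = 0) ∧ ((θ z).a = 0 ∧ (θ z).b = 1) ∧
      ∀ u ∈ U, θ (loop R H u) = 1 := by
  obtain ⟨W, g, hg⟩ := exists_SW' R hR
  obtain ⟨t1, t2⟩ := transport R g H n U hU
  rcases master_two' W H n hn (U.image (fun u => u * g⁻¹)) (by rw [hg]; exact t1)
    (by rw [hg]; exact transport2 g h2) y z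
    (by rw [hg]; intro χ h0 h1 h; exact hyp χ h0 h1 (t2 (fun h => χ h = 1) h))
    with ⟨V, h1, h2⟩ | ⟨θ, h1, h2, h3⟩
  · rw [hg] at h1 h2
    exact Or.inl ⟨_, _, h1.conj, h2.conj⟩
  · rw [hg] at h3
    exact Or.inr ⟨θ, h1, h2, t2 (fun h => θ h = 1) h3⟩

/-- distinctness with integer exponents -/
theorem Outcome.dist' {R : FreeGroup X} {H : Subgroup (FreeGroup X)} {x₀ : X} {n : ℕ} (hn : 0 < n)
    {U V : Finset (FreeGroup X)} (hU : ∀ u ∈ U, u * R ^ n * u⁻¹ ∈ H) (ho : Outcome R H x₀ V)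
    (hc : Cov R H U V) :
    ∀ v ∈ V, ∀ v' ∈ V, ∀ h ∈ H, ∀ i : ℤ, v' = h * v * R ^ i → v = v' := by
  intro v hv v' hv' h hh i he
  obtain ⟨u, hu, a, ha, j, hj⟩ := hc.2 v hv
  have h1 : v * R ^ n * v⁻¹ ∈ H := by
    rw [hj, mem_trans_iff R H u a ha]; exact hU u hu
  obtain ⟨b, hb, k, hk⟩ := zpow_nat hn h1 i
  apply ho.dist v hv v' hv' (h * b) (H.mul_mem hh hb) k
  rw [he, mul_assoc, hk]; group

/-- witnesses for membership in the normal closure -/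
theorem witness (R : FreeGroup X) (n : ℕ) {g : FreeGroup X}
    (hg : g ∈ Subgroup.normalClosure {R ^ n}) : ∃ U : Finset (FreeGroup X),
    g ∈ Subgroup.closure ((fun u => u * R ^ n * u⁻¹) '' (U : Set (FreeGroup X))) := by
  have h0 : Subgroup.normalClosure {R ^ n} ≤ Subgroup.closure
      (Set.range (fun u => u * R ^ n * u⁻¹)) := by
    unfold Subgroup.normalClosure
    apply Subgroup.closure_mono
    intro y hy
    obtain ⟨a, ha, h⟩ := Group.mem_conjugatesOfSet_iff.1 hy
    rw [Set.mem_singleton_iff] at ha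
    subst ha
    obtain ⟨c, hc⟩ := isConj_iff.1 h
    exact ⟨c, hc⟩
  have h1 := h0 hg
  clear hg
  induction h1 using Subgroup.closure_induction with
  | mem g hg => 
    obtain ⟨u, rfl⟩ := hg
    exact ⟨{u}, Subgroup.subset_closure ⟨u, by simp, rfl⟩⟩
  | one => exact ⟨∅, Subgroup.one_mem _⟩
  | mul g h _ _ h1 h2 => 
    obtain ⟨U, hU⟩ := h1
    obtain ⟨V, hV⟩ := h2
    refine ⟨U ∪ V, Subgroup.mul_mem _ (Subgroup.closure_mono ?_ hU) (Subgroup.closure_mono ?_ hV)⟩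
    · exact Set.image_mono (by simp)
    · exact Set.image_mono (by simp)
  | inv g _ h1 =>
    obtain ⟨U, hU⟩ := h1
    exact ⟨U, Subgroup.inv_mem _ hU⟩

end
end OR

namespace OR
section
open scoped Classical
variable {X : Type} {P : Type} [Group P]

/-- the subgroup generated by `Y` and the conjugates of `R ^ n` by elements of `U` -/
def Hyz (R : FreeGroup X) (n : ℕ) (U : Finset (FreeGroup X)) (Y : Set (FreeGroup X)) :
    Subgroup (FreeGroup X) :=
  Subgroup.closure (Y ∪ (fun u => u * R ^ n * u⁻¹) '' (U : Set (FreeGroup X)))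

theorem Hyz_z (R : FreeGroup X) (n : ℕ) (U : Finset (FreeGroup X)) (Y : Set (FreeGroup X)) :
    ∀ u ∈ U, u * R ^ n * u⁻¹ ∈ Hyz R n U Y :=
  fun u hu => Subgroup.subset_closure (Or.inr ⟨u, hu, rfl⟩)

theorem Hyz_y (R : FreeGroup X) (n : ℕ) (U : Finset (FreeGroup X)) (Y : Set (FreeGroup X)) :
    ∀ y ∈ Y, y ∈ Hyz R n U Y :=
  fun _ hy => Subgroup.subset_closure (Or.inl hy)

theorem Hyz_w {R : FreeGroup X} {n : ℕ} {U U' : Finset (FreeGroup X)} (Y : Set (FreeGroup X))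
    (h : U ⊆ U') {g : FreeGroup X}
    (hg : g ∈ Subgroup.closure ((fun u => u * R ^ n * u⁻¹) '' (U : Set (FreeGroup X)))) :
    g ∈ Hyz R n U' Y := by
  refine Subgroup.closure_mono ?_ hg
  exact (Set.image_mono (by simpa using h)).trans Set.subset_union_right

theorem hom_triv {G : Type*} [Group G] {s : Set G} {H : Subgroup G} (hH : H = Subgroup.closure s)
    {Q : Type*} [Group Q] (χ : H →* Q) (h : ∀ a (_ : a ∈ s) (hb : a ∈ H), χ ⟨a, hb⟩ = 1) :
    ∀ a, χ a = 1 := by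
  subst hH
  rintro ⟨a, ha⟩
  induction ha using Subgroup.closure_induction with
  | mem a ha => exact h a ha _
  | one => exact χ.map_one
  | mul a b ha hb h1 h2 =>
    have := χ.map_mul ⟨a, ha⟩ ⟨b, hb⟩
    rw [h1, h2, mul_one] at this
    exact this
  | inv a ha h1 =>
    have := χ.map_inv ⟨a, ha⟩
    rw [h1, inv_one] at this
    exact this

theorem loop_pow {R : FreeGroup X} {H : Subgroup (FreeGroup X)} {u : FreeGroup X} {m : ℕ}
    (h : u * R ^ m * u⁻¹ ∈ H) :
    (⟨u * R ^ m * u⁻¹, h⟩ : H) = loop R H u ^ (m / per R H u) := by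
  apply Subtype.ext
  have h1 := per_iff.1 h
  rw [Subgroup.coe_pow]
  simp only [loop]
  rw [conj_pow, ← pow_mul, Nat.mul_div_cancel' h1]

theorem gen_triv (R : FreeGroup X) (n : ℕ) (U : Finset (FreeGroup X)) (Y : Set (FreeGroup X))
    (χ : Hyz R n U Y →* P) (h1 : ∀ u (hu : u ∈ U), χ ⟨_, Hyz_z R n U Y u hu⟩ = 1)
    (h2 : ∀ y (hy : y ∈ Y), χ ⟨y, Hyz_y R n U Y y hy⟩ = 1) : ∀ h, χ h = 1 := by
  apply hom_triv rfl
  rintro a (ha | ⟨u, hu, rfl⟩) hb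
  · exact h2 a ha
  · exact h1 u hu

theorem z_triv {R : FreeGroup X} {n : ℕ} {U : Finset (FreeGroup X)} {Y : Set (FreeGroup X)}
    (χ : Hyz R n U Y →* P) (h1 : ∀ u ∈ U, χ (loop R _ u) = 1) :
    ∀ u (hu : u ∈ U), χ ⟨_, Hyz_z R n U Y u hu⟩ = 1 := by
  intro u hu
  rw [loop_pow, map_pow, h1 u hu, one_pow]

/-- homs vanishing on all `z`'s vanish on the subgroup they generate -/
theorem z_triv' {R : FreeGroup X} {n : ℕ} {U U' : Finset (FreeGroup X)} {Y : Set (FreeGroup X)}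
    (χ : Hyz R n U Y →* P) (h1 : ∀ u (hu : u ∈ U), χ ⟨_, Hyz_z R n U Y u hu⟩ = 1)
    (hU : U' ⊆ U) {g : FreeGroup X}
    (hg : g ∈ Subgroup.closure ((fun u => u * R ^ n * u⁻¹) '' (U' : Set (FreeGroup X))))
    (hgH : g ∈ Hyz R n U Y) : χ ⟨g, hgH⟩ = 1 := by
  have : g ∈ (χ.ker.map (Hyz R n U Y).subtype) := by
    refine (Subgroup.closure_le _).2 ?_ hg
    rintro _ ⟨u, hu, rfl⟩
    exact ⟨⟨_, Hyz_z R n U Y u (hU hu)⟩, h1 u (hU hu), rfl⟩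
  obtain ⟨⟨a, ha⟩, h2, h3⟩ := this
  have h4 : a = g := h3
  subst h4
  exact h2

/-- all loops at `U` are killed -/
theorem Cov.kill {R : FreeGroup X} {H : Subgroup (FreeGroup X)} {U V : Finset (FreeGroup X)}
    (hc : Cov R H U V) (θ : H →* P) (h : ∀ v ∈ V, θ (loop R H v) = 1) :
    ∀ u ∈ U, θ (loop R H u) = 1 := by
  intro u hu
  obtain ⟨v, hv, a, ha, i, rfl⟩ := hc.1 u hu
  rw [loop_trans R H v a ha, map_mul, map_mul, map_inv, h v hv]; simp

/-- separating an orbit -/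
theorem Outcome.sep {R : FreeGroup X} {H : Subgroup (FreeGroup X)} {x₀ : X} {n : ℕ} (hn : 0 < n)
    {U V : Finset (FreeGroup X)} (hU : ∀ u ∈ U, u * R ^ n * u⁻¹ ∈ H) (ho : Outcome R H x₀ V)
    (hc : Cov R H U V) (u₁ : FreeGroup X) (hu₁ : u₁ ∈ U) :
    ∃ θ : H →* Multiplicative (ZMod (n / per R H u₁)),
      θ (loop R H u₁) = Multiplicative.ofAdd 1 ∧
      (∀ u ∈ U, (¬ ∃ h ∈ H, ∃ i : ℤ, u = h * u₁ * R ^ i) → θ (loop R H u) = 1) ∧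
      (∀ u (hu : u ∈ U), θ ⟨_, hU u hu⟩ = 1) ∧
      ((∀ h, θ h = 1) → per R H u₁ = n) := by
  obtain ⟨v₁, hv₁, a, ha, i, h1⟩ := hc.1 u₁ hu₁
  obtain ⟨θ, hθ⟩ := ho.map (Multiplicative (ZMod (n / per R H u₁)))
    (fun v => if v = v₁ then Multiplicative.ofAdd 1 else 1)
  have hθ' : ∀ v ∈ V, θ (loop R H v) = if v = v₁ then Multiplicative.ofAdd 1 else 1 := by
    intro v hv
    obtain ⟨q, hq⟩ := hθ v hv
    rw [hq, mul_comm q, mul_inv_cancel_right]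
  have e1 : θ (loop R H u₁) = Multiplicative.ofAdd 1 := by
    have : loop R H u₁ = loop R H (a * v₁ * R ^ i) := by rw [h1]
    rw [this, loop_trans R H v₁ a ha, map_mul, map_mul, map_inv, mul_comm (θ ⟨a, ha⟩),
      mul_inv_cancel_right, hθ' v₁ hv₁]; simp
  have e2 : ∀ u ∈ U, (¬ ∃ h ∈ H, ∃ i : ℤ, u = h * u₁ * R ^ i) → θ (loop R H u) = 1 := by
    intro u hu hno
    obtain ⟨v, hv, b, hb, j, h2⟩ := hc.1 u hu
    rw [h2, loop_trans R H v b hb, map_mul, map_mul, map_inv, mul_comm (θ ⟨b, hb⟩),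
      mul_inv_cancel_right, hθ' v hv, if_neg]
    rintro rfl
    apply hno
    refine ⟨b * a⁻¹, H.mul_mem hb (H.inv_mem ha), j - i, ?_⟩
    rw [h2, h1, sub_eq_add_neg, add_comm, zpow_add]; group
  refine ⟨θ, e1, e2, ?_, ?_⟩
  · intro u hu
    rw [loop_pow, map_pow]
    by_cases h : ∃ h ∈ H, ∃ i : ℤ, u = h * u₁ * R ^ i
    · obtain ⟨b, hb, j, rfl⟩ := h
      rw [loop_trans R H u₁ b hb, map_mul, map_mul, map_inv, mul_comm (θ ⟨b, hb⟩),
        mul_inv_cancel_right, per_trans' R H u₁ b hb, e1, ← ofAdd_nsmul]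
      simp
    · rw [e2 u hu h, one_pow]
  · intro h
    rw [h] at e1
    have h3 : (1 : ZMod (n / per R H u₁)) = 0 := by
      have := congrArg Multiplicative.toAdd e1
      exact this.symm
    have hd := per_iff.1 (hU u₁ hu₁)
    have h4 : n / per R H u₁ = 1 := by
      have h5 : ((1 : ℕ) : ZMod (n / per R H u₁)) = 0 := by exact_mod_cast h3
      rw [ZMod.natCast_eq_zero_iff] at h5
      exact Nat.dvd_one.1 h5
    have h6 := Nat.div_mul_cancel hd
    rw [h4, one_mul] at h6
    exact h6

/-- Freiheitssatz -/
theorem freiheitssatz (l : List (X × Bool)) (hl : FreeGroup.IsCyclicallyReduced l)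
    (hR : NotPow (FreeGroup.mk l)) (a : X × Bool) (ha : a ∈ l) (w : FreeGroup X)
    (hw : w ∈ Subgroup.normalClosure {FreeGroup.mk l})
    (hw2 : w ∈ Subgroup.closure (FreeGroup.of '' {x | x ≠ a.1})) : w = 1 := by
  obtain ⟨U, hU⟩ := witness (FreeGroup.mk l) 1 (by rwa [pow_one])
  obtain ⟨W, ⟨g, hg⟩, hW0⟩ := exists_SW l hl hR a ha
  set R := FreeGroup.mk l
  obtain ⟨t1, t2⟩ := transport R g (Hyz R 1 U ∅) 1 U (Hyz_z R 1 U ∅)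
  obtain ⟨V, h1, h2⟩ := master_zero' W (Hyz R 1 U ∅) 1 one_pos (U.image (fun u => u * g⁻¹))
    (by rw [hg]; exact t1) (by
      rw [hg]; intro χ h
      apply gen_triv
      · exact z_triv χ (t2 (fun h => χ h = 1) h)
      · simp)
  obtain ⟨ρ, h3, _, h4⟩ := h1.rho
  have h5 := h2.kill ρ h3
  rw [hg] at h5
  refine (h4 ?_).2 w (Hyz_w _ subset_rfl hU) ?_
  · apply gen_triv
    · exact z_triv ρ (t2 (fun h => ρ h = 1) h5)
    · simp
  · rw [hW0]; exact hw2

/-- a presentation -/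
structure Pres (R : FreeGroup X) (n : ℕ) {G : Type} [Group G] (π : FreeGroup X →* G) : Prop where
  np : NotPow R
  pos : 0 < n
  surj : Function.Surjective π
  ker : ∀ g, π g = 1 ↔ g ∈ Subgroup.normalClosure {R ^ n}

variable {R : FreeGroup X} {n : ℕ} {G : Type} [Group G] {π : FreeGroup X →* G}

theorem Pres.pow (h : Pres R n π) : π R ^ n = 1 := by
  rw [← map_pow, h.ker]; exact Subgroup.subset_normalClosure rfl

theorem Pres.z (h : Pres R n π) (u : FreeGroup X) : π (u * R ^ n * u⁻¹) = 1 := by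
  rw [map_mul, map_mul, map_pow, h.pow]; simp

theorem ord_aux (hR : NotPow R) (hn : 0 < n) (U : Finset (FreeGroup X)) (h1 : 1 ∈ U) :
    per R (Hyz R n U ∅) 1 = n := by
  obtain ⟨x₀, V, ho, hc⟩ := master_zero hR (Hyz R n U ∅) n hn U (Hyz_z R n U ∅) (by
    intro χ h
    apply gen_triv
    · exact z_triv χ h
    · simp)
  obtain ⟨θ, _, _, h3, h4⟩ := ho.sep hn (Hyz_z R n U ∅) hc 1 h1
  apply h4
  apply gen_triv
  · exact h3
  · simp

theorem Pres.ord (h : Pres R n π) : orderOf (π R) = n := by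
  apply Nat.dvd_antisymm
  · exact orderOf_dvd_of_pow_eq_one h.pow
  · have h1 := pow_orderOf_eq_one (π R)
    rw [← map_pow, h.ker] at h1
    obtain ⟨U, hU⟩ := witness R n h1
    have h2 := ord_aux h.np h.pos (insert 1 U) (Finset.mem_insert_self _ _)
    nth_rewrite 1 [← h2]
    rw [← per_iff]
    simpa using Hyz_w ∅ (Finset.subset_insert 1 U) hU

theorem Pres.mal' (h : Pres R n π) {g : G} {i j : ℕ} (hg : g * π R ^ i * g⁻¹ = π R ^ j)
    (hj : π R ^ j ≠ 1) : g ∈ Subgroup.zpowers (π R) := by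
  obtain ⟨g, rfl⟩ := h.surj g
  have h1 : g * R ^ i * g⁻¹ * (R ^ j)⁻¹ ∈ Subgroup.normalClosure {R ^ n} := by
    rw [← h.ker]; simp [hg]
  obtain ⟨U₀, hU₀⟩ := witness R n h1
  set U := insert 1 (insert g U₀) with hU
  set H := Hyz R n U {R} with hH
  have hRH : R ∈ H := Hyz_y R n U {R} R rfl
  have hUU : U₀ ⊆ U := fun u hu => by simp [hU, hu]
  have hgH : g * R ^ i * g⁻¹ ∈ H := by
    have := H.mul_mem (Hyz_w {R} hUU hU₀) (H.pow_mem hRH j)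
    simpa using this
  have hl1 : loop R H 1 = ⟨R, hRH⟩ := by
    have : per R H 1 = 1 := by
      rw [← Nat.dvd_one, ← per_iff]; simpa using hRH
    apply Subtype.ext
    simp [loop, this]
  obtain ⟨x₀, V, ho, hc⟩ := master_zero h.np H n h.pos U (Hyz_z R n U {R}) (by
    intro χ hχ
    apply gen_triv
    · exact z_triv χ hχ
    · intro y hy
      rw [Set.mem_singleton_iff] at hy
      subst hy
      have := hχ 1 (by simp [hU])
      rw [hl1] at this
      exact this)
  have hpi : ∀ a ∈ H, π a ∈ Subgroup.zpowers (π R) := by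
    intro a ha
    have : H ≤ (Subgroup.zpowers (π R)).comap π := by
      rw [hH]
      unfold Hyz
      rw [Subgroup.closure_le]
      rintro a (ha | ⟨u, hu, rfl⟩)
      · rw [Set.mem_singleton_iff] at ha
        subst ha
        exact Subgroup.mem_zpowers _
      · show π _ ∈ Subgroup.zpowers (π R)
        rw [h.z u]; exact Subgroup.one_mem _
    exact this ha
  by_cases hor : ∃ b ∈ H, ∃ k : ℤ, 1 = b * g * R ^ k
  · obtain ⟨b, hb, k, hk⟩ := hor
    have : g = b⁻¹ * R ^ (-k) := by
      rw [zpow_neg, eq_mul_inv_iff_mul_eq]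
      exact eq_inv_of_mul_eq_one_right (by rw [← mul_assoc]; exact hk.symm)
    rw [this, map_mul, map_zpow]
    exact Subgroup.mul_mem _ (hpi _ (H.inv_mem hb)) (Subgroup.zpow_mem _ (Subgroup.mem_zpowers _) _)
  · exfalso
    obtain ⟨θ, h2, h3, h4, h5⟩ := ho.sep h.pos (Hyz_z R n U {R}) hc g (by simp [hU])
    have h6 := h5 (by
      apply gen_triv
      · exact h4
      · intro y hy
        rw [Set.mem_singleton_iff] at hy
        subst hy
        have := h3 1 (by simp [hU]) hor
        rw [hl1] at this
        exact this)
    have h7 := per_iff.1 hgH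
    rw [h6] at h7
    obtain ⟨q, rfl⟩ := h7
    apply hj
    rw [← hg, pow_mul, h.pow]; simp

theorem Pres.zpow_nat (h : Pres R n π) {a : G} (ha : a ∈ Subgroup.zpowers (π R)) :
    ∃ i : ℕ, a = π R ^ i := by
  have hf : IsOfFinOrder (π R) := isOfFinOrder_iff_pow_eq_one.2 ⟨n, h.pos, h.pow⟩
  obtain ⟨i, hi⟩ := hf.mem_powers_iff_mem_zpowers.2 ha
  exact ⟨i, hi.symm⟩

theorem Pres.mal (h : Pres R n π) {g a : G} (ha : a ∈ Subgroup.zpowers (π R))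
    (hg : g * a * g⁻¹ ∈ Subgroup.zpowers (π R))
    (ha1 : a ≠ 1) : g ∈ Subgroup.zpowers (π R) := by
  obtain ⟨i, rfl⟩ := h.zpow_nat ha
  obtain ⟨j, hj⟩ := h.zpow_nat hg
  apply h.mal' hj
  rw [← hj]
  intro h1
  apply ha1
  rw [mul_inv_eq_one] at h1
  simpa using h1

theorem fg_pow_one {m : ℕ} (hm : 0 < m) {g : FreeGroup X} (h : g ^ m = 1) : g = 1 :=
  (pow_eq_one_iff_left hm.ne').1 h

/-- common part of the torsion results -/
theorem tors_aux (hR : NotPow R) (hn : 0 < n) {g : FreeGroup X} {m : ℕ} (hm : 0 < m)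
    (hg : g ^ m ∈ Subgroup.normalClosure {R ^ n}) :
    ∃ (U V : Finset (FreeGroup X)) (k : FreeGroup X → FreeGroup X),
      g ∈ Hyz R n U {g} ∧ Hyz R n U {g} = Subgroup.closure
      ((fun v => k v * (v * R ^ per R (Hyz R n U {g}) v * v⁻¹) * (k v)⁻¹) ''
          (V : Set (FreeGroup X))) := by
  obtain ⟨U, hU⟩ := witness R n hg
  set H := Hyz R n U {g} with hH
  have hgH : g ∈ H := Hyz_y R n U {g} g rfl
  obtain ⟨x₀, V, ho, hc⟩ := master_zero hR H n hn U (Hyz_z R n U {g}) (by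
    intro χ hχ
    have hz := z_triv χ hχ
    apply gen_triv
    · exact hz
    · intro y hy
      rw [Set.mem_singleton_iff] at hy
      subst hy
      have := z_triv' χ hz subset_rfl hU (H.pow_mem hgH m)
      have h2 : χ ⟨y, hgH⟩ ^ m = 1 := by rw [← map_pow]; exact this
      have h3 := congrArg Multiplicative.toAdd h2
      rw [toAdd_pow] at h3
      have h4 : Multiplicative.toAdd (χ ⟨y, hgH⟩) = 0 := by
        rcases smul_eq_zero.1 h3 with h | h
        · omega
        · exact h
      exact h4)
  obtain ⟨ρ, h3, _, h4⟩ := ho.rho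
  have hz := z_triv ρ (hc.kill ρ h3)
  obtain ⟨⟨k, _, h5⟩, _⟩ := h4 (by
    apply gen_triv
    · exact hz
    · intro y hy
      rw [Set.mem_singleton_iff] at hy
      subst hy
      have := z_triv' ρ hz subset_rfl hU (H.pow_mem hgH m)
      have h2 : ρ ⟨y, hgH⟩ ^ m = 1 := by rw [← map_pow]; exact this
      exact fg_pow_one hm h2)
  exact ⟨U, V, k, hgH, h5⟩

theorem Q_tf (hR : NotPow R) {g : FreeGroup X} {m : ℕ} (hm : 0 < m)
    (hg : g ^ m ∈ Subgroup.normalClosure {R}) : g ∈ Subgroup.normalClosure {R} := by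
  obtain ⟨U, V, k, h1, h2⟩ := tors_aux (n := 1) hR one_pos hm (by rwa [pow_one])
  rw [h2] at h1
  refine (Subgroup.closure_le _).2 ?_ h1
  rintro _ ⟨v, hv, rfl⟩
  have : R ∈ Subgroup.normalClosure {R} := Subgroup.subset_normalClosure rfl
  exact Subgroup.normalClosure_normal.conj_mem _
    (Subgroup.normalClosure_normal.conj_mem _ (Subgroup.pow_mem _ this _) _) _

theorem Pres.tors (h : Pres R n π) {g : G} {m : ℕ} (hm : 0 < m) (hg : g ^ m = 1) :
    ∃ c, c * g * c⁻¹ ∈ Subgroup.zpowers (π R) := by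
  by_cases hg1 : g = 1
  · exact ⟨1, by rw [hg1]; simp [Subgroup.one_mem]⟩
  obtain ⟨g, rfl⟩ := h.surj g
  rw [← map_pow, h.ker] at hg
  obtain ⟨U, V, k, h1, h2⟩ := tors_aux h.np h.pos hm hg
  set H := Hyz R n U {g} with hH
  have hpi : ∀ a ∈ H, π a ∈ Subgroup.zpowers (π g) := by
    intro a ha
    have : H ≤ (Subgroup.zpowers (π g)).comap π := by
      rw [hH]
      unfold Hyz
      rw [Subgroup.closure_le]
      rintro a (ha | ⟨u, hu, rfl⟩)
      · rw [Set.mem_singleton_iff] at ha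
        subst ha
        exact Subgroup.mem_zpowers _
      · show π _ ∈ Subgroup.zpowers (π g)
        rw [h.z u]; exact Subgroup.one_mem _
    exact this ha
  by_contra hno
  apply hg1
  have h3 : H ≤ π.ker := by
    rw [h2, Subgroup.closure_le]
    rintro _ ⟨v, hv, rfl⟩
    by_contra hne
    apply hno
    set c := π (k v * v)
    have h4 := hpi (k v * (v * R ^ per R H v * v⁻¹) * (k v)⁻¹) (h2.ge (Subgroup.subset_closure ⟨v, hv, rfl⟩))
    have h5 : π (k v * (v * R ^ per R H v * v⁻¹) * (k v)⁻¹) = c * π R ^ per R H v * c⁻¹ := by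
      simp [c, mul_assoc]
    rw [h5] at h4
    have h6 : π R ^ per R H v ≠ 1 := by
      intro h7
      apply hne
      show π _ = 1
      rw [h5, h7]; simp
    obtain ⟨q, hq⟩ := h4
    have hq : π g ^ q = c * π R ^ per R H v * c⁻¹ := hq
    have hcom : π g * (c * π R ^ per R H v * c⁻¹) * (π g)⁻¹ = c * π R ^ per R H v * c⁻¹ := by
      rw [← hq]; group
    refine ⟨c⁻¹, ?_⟩
    apply h.mal' (i := per R H v) (j := per R H v) ?_ h6
    have : c⁻¹ * π g * c⁻¹⁻¹ * π R ^ per R H v * (c⁻¹ * π g * c⁻¹⁻¹)⁻¹ =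
      c⁻¹ * (π g * (c * π R ^ per R H v * c⁻¹) * (π g)⁻¹) * c := by group
    rw [this, hcom]; group
  exact h3 h1

end
end OR

namespace OR
section
open scoped Classical
variable {X : Type} {P : Type} [Group P] {R : FreeGroup X} {n : ℕ}
  {G : Type} [Group G] {π : FreeGroup X →* G}

/-- linear functionals on the Heisenberg group -/
def Heis.lin (α β : ℚ) : Heis →* Multiplicative ℚ where
  toFun p := Multiplicative.ofAdd (α * p.a + β * p.b)
  map_one' := by simp
  map_mul' p q := by
    rw [← ofAdd_add]; congr 1; simp; ring

theorem Heis.lin_one {α β : ℚ} {p : Heis} : Heis.lin α β p = 1 ↔ α * p.a + β * p.b = 0 :=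
  Iff.rfl

/-- finitely many relators have a common witness -/
theorem Pres.wit (h : Pres R n π) (W : Finset (FreeGroup X)) (hW : ∀ w ∈ W, π w = 1)
    (U₀ : Finset (FreeGroup X)) :
    ∃ U : Finset (FreeGroup X), U₀ ⊆ U ∧ ∀ w ∈ W,
      w ∈ Subgroup.closure ((fun u => u * R ^ n * u⁻¹) '' (U : Set (FreeGroup X))) := by
  have : ∀ w : FreeGroup X, ∃ U : Finset (FreeGroup X), π w = 1 → 
      w ∈ Subgroup.closure ((fun u => u * R ^ n * u⁻¹) '' (U : Set (FreeGroup X))) := by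
    intro w
    by_cases hw : π w = 1
    · obtain ⟨U, hU⟩ := witness R n ((h.ker w).1 hw)
      exact ⟨U, fun _ => hU⟩
    · exact ⟨∅, fun h => absurd h hw⟩
  choose f hf using this
  refine ⟨U₀ ∪ W.biUnion f, Finset.subset_union_left, ?_⟩
  intro w hw
  refine Subgroup.closure_mono (Set.image_mono ?_) (hf w (hW w hw))
  intro u hu
  simp only [Finset.coe_union, Finset.coe_biUnion, Set.mem_union, Set.mem_iUnion]
  exact Or.inr ⟨w, hw, hu⟩

theorem Pres.map_Hyz (h : Pres R n π) (U : Finset (FreeGroup X)) (Y : Set (FreeGroup X)) :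
    (Hyz R n U Y).map π = Subgroup.closure (π '' Y) := by
  unfold Hyz
  rw [MonoidHom.map_closure, Set.image_union]
  apply le_antisymm
  · rw [Subgroup.closure_le]
    rintro a (ha | ⟨_, ⟨u, hu, rfl⟩, rfl⟩)
    · exact Subgroup.subset_closure ha
    · simp only [h.z u]; exact Subgroup.one_mem _
  · exact Subgroup.closure_mono Set.subset_union_left

theorem Pres.no_R (h : Pres R n π) (hn : 1 < n) {H : Subgroup (FreeGroup X)}
    (tf : ∀ a ∈ H, ∀ m : ℕ, 0 < m → π a ^ m = 1 → π a = 1) (u : FreeGroup X) :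
    u * R * u⁻¹ ∉ H := by
  intro hu
  have h1 := tf _ hu n h.pos (by
    rw [← map_pow, conj_pow]; exact h.z u)
  have h2 : π R = 1 := by
    simp only [map_mul, map_inv, mul_inv_eq_one] at h1
    simpa using h1
  have h3 := h.ord
  rw [h2, orderOf_one] at h3
  omega

theorem Pres.loop_one (h : Pres R n π) {H : Subgroup (FreeGroup X)}
    (tf : ∀ a ∈ H, ∀ m : ℕ, 0 < m → π a ^ m = 1 → π a = 1) (u : FreeGroup X) :
    π (loop R H u) = 1 := by
  refine tf _ (loop R H u).2 n h.pos ?_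
  simp only [loop]
  rw [← map_pow, conj_pow, ← pow_mul, mul_comm, pow_mul, ← conj_pow, map_pow, h.z u, one_pow]

theorem Pres.cyc_fin (h : Pres R n π) {U : Finset (FreeGroup X)} {Y : Set (FreeGroup X)}
    (tf : ∀ a ∈ Hyz R n U Y, ∀ m : ℕ, 0 < m → π a ^ m = 1 → π a = 1)
    {x₀ : X} {V : Finset (FreeGroup X)} (ho : Outcome R (Hyz R n U Y) x₀ V)
    (hc : Cov R (Hyz R n U Y) U V)
    (hno : ¬ ∀ (P : Type) [Group P] (p₁ p₂ : P), ∃ θ : Hyz R n U Y →* P,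
      (∀ u (hu : u ∈ U), θ ⟨_, Hyz_z R n U Y u hu⟩ = 1) ∧ p₁ ∈ θ.range ∧ p₂ ∈ θ.range) :
    ∃ a ∈ Hyz R n U Y, ∀ b ∈ Hyz R n U Y, π b ∈ Subgroup.zpowers (π a) := by
  obtain ⟨ρ, h3, h4, _⟩ := ho.rho
  have hz := z_triv ρ (hc.kill ρ h3)
  rcases free_dichotomy ρ.range with ⟨⟨_, a, rfl⟩, ha⟩ | ⟨b₁, b₂, hb⟩
  · refine ⟨a, a.2, ?_⟩
    intro b hb
    obtain ⟨k, hk⟩ := Subgroup.mem_zpowers_iff.1 (ha ⟨ρ ⟨b, hb⟩, ⟨_, rfl⟩⟩)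
    have hk' : ρ a ^ k = ρ ⟨b, hb⟩ := congrArg Subtype.val hk
    have h5 : ρ (a ^ (-k) * ⟨b, hb⟩) = 1 := by
      rw [map_mul, map_zpow, zpow_neg, hk', inv_mul_cancel]
    have h6 := h4 _ h5
    have h7 : Subgroup.normalClosure (loop R (Hyz R n U Y) '' (V : Set (FreeGroup X))) ≤
        (π.comp (Hyz R n U Y).subtype).ker := by
      apply Subgroup.normalClosure_le_normal
      rintro _ ⟨v, hv, rfl⟩
      exact h.loop_one tf v
    have h8 : π ((a : FreeGroup X) ^ (-k) * b) = 1 := h7 h6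
    rw [map_mul, map_zpow, zpow_neg, inv_mul_eq_one] at h8
    exact ⟨k, h8⟩
  · exfalso
    apply hno
    intro P _ p₁ p₂
    obtain ⟨θ, e1, e2⟩ := hb P p₁ p₂
    refine ⟨θ.comp ρ.rangeRestrict, ?_, ?_, ?_⟩
    · intro u hu
      have : ρ.rangeRestrict ⟨_, Hyz_z R n U Y u hu⟩ = 1 := Subtype.ext (hz u hu)
      rw [MonoidHom.comp_apply, this, map_one]
    · obtain ⟨c, hc⟩ := ρ.rangeRestrict_surjective b₁
      exact ⟨c, by rw [MonoidHom.comp_apply, hc, e1]⟩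
    · obtain ⟨c, hc⟩ := ρ.rangeRestrict_surjective b₂
      exact ⟨c, by rw [MonoidHom.comp_apply, hc, e2]⟩

/-- two lines in the plane: a nonzero functional -/
theorem exists_lin (a b a' b' : ℚ) (h : a * b' = a' * b) :
    ∃ α β : ℚ, (α ≠ 0 ∨ β ≠ 0) ∧ α * a + β * b = 0 ∧ α * a' + β * b' = 0 := by
  by_cases h1 : a = 0 ∧ b = 0
  · by_cases h2 : a' = 0 ∧ b' = 0
    · exact ⟨1, 0, by simp, by simp [h1], by simp [h2]⟩
    · refine ⟨-b', a', ?_, by simp [h1], by ring⟩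
      rcases not_and_or.1 h2 with h | h <;> simp [h]
  · refine ⟨-b, a, ?_, by ring, by linarith⟩
    rcases not_and_or.1 h1 with h | h <;> simp [h]

theorem heis_contra {U : Finset (FreeGroup X)} {Y : Set (FreeGroup X)}
    (key : ∀ θ : Hyz R n U Y →* Heis, 
      (∀ u (hu : u ∈ U), θ ⟨_, Hyz_z R n U Y u hu⟩ = 1) →
      ∃ α β : ℚ, (α ≠ 0 ∨ β ≠ 0) ∧ ∀ b, Heis.lin α β (θ b) = 1) :
    ¬ ∀ (P : Type) [Group P] (p₁ p₂ : P), ∃ θ : Hyz R n U Y →* P,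
      (∀ u (hu : u ∈ U), θ ⟨_, Hyz_z R n U Y u hu⟩ = 1) ∧ p₁ ∈ θ.range ∧ p₂ ∈ θ.range := by
  intro h
  obtain ⟨θ, h1, ⟨b₁, h2⟩, ⟨b₂, h3⟩⟩ := h Heis ⟨1, 0, 0⟩ ⟨0, 1, 0⟩
  obtain ⟨α, β, h4, h5⟩ := key θ h1
  have h6 := h5 b₁
  have h7 := h5 b₂
  rw [h2, Heis.lin_one] at h6
  rw [h3, Heis.lin_one] at h7
  simp at h6 h7
  simp [h6, h7] at h4

theorem Pres.one_cyc (h : Pres R n π) (hn : 1 < n) {U : Finset (FreeGroup X)} {Y : Set (FreeGroup X)}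
    (tf : ∀ a ∈ Hyz R n U Y, ∀ m : ℕ, 0 < m → π a ^ m = 1 → π a = 1)
    (y : Hyz R n U Y)
    (hyp : ∀ χ : Hyz R n U Y →* Multiplicative ℚ, χ y = 1 → 
      (∀ u (hu : u ∈ U), χ ⟨_, Hyz_z R n U Y u hu⟩ = 1) → ∀ y' ∈ Y, ∀ h, χ ⟨y', h⟩ = 1) :
    ∃ a ∈ Hyz R n U Y, ∀ b ∈ Hyz R n U Y, π b ∈ Subgroup.zpowers (π a) := by
  have hyp' : ∀ χ : Hyz R n U Y →* Multiplicative ℚ, χ y = 1 → 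
      (∀ u (hu : u ∈ U), χ ⟨_, Hyz_z R n U Y u hu⟩ = 1) → ∀ h, χ h = 1 := by
    intro χ h1 h2
    exact gen_triv R n U Y χ h2 (fun y' hy' => hyp χ h1 h2 y' hy' _)
  obtain ⟨x₀, V, ho, hc⟩ := master_one h.np (Hyz R n U Y) n h.pos U (Hyz_z R n U Y)
    (fun u _ => h.no_R hn tf u) y (fun χ h1 h2 => hyp' χ h1 (z_triv χ h2))
  apply h.cyc_fin tf ho hc
  apply heis_contra
  intro θ hθ
  obtain ⟨α, β, h1, h2, _⟩ := exists_lin (θ y).a (θ y).b 0 0 (by simp)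
  refine ⟨α, β, h1, ?_⟩
  exact hyp' ((Heis.lin α β).comp θ) (Heis.lin_one.2 h2) (fun u hu => by
    rw [MonoidHom.comp_apply, hθ u hu, map_one])

theorem Pres.two_cyc (h : Pres R n π) (hn : 1 < n) {U : Finset (FreeGroup X)} {c g : FreeGroup X}
    (tf : ∀ a ∈ Hyz R n U {c, g}, ∀ m : ℕ, 0 < m → π a ^ m = 1 → π a = 1)
    {k : ℤ} (hk : k ≠ 0) 
    (hw : g * c ^ k * g⁻¹ * (c ^ k)⁻¹ ∈
      Subgroup.closure ((fun u => u * R ^ n * u⁻¹) '' (U : Set (FreeGroup X)))) :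
    ∃ a ∈ Hyz R n U {c, g}, ∀ b ∈ Hyz R n U {c, g}, π b ∈ Subgroup.zpowers (π a) := by
  have hcH : c ∈ Hyz R n U {c, g} := Hyz_y R n U _ c (by simp)
  have hgH : g ∈ Hyz R n U {c, g} := Hyz_y R n U _ g (by simp)
  have hyp' : ∀ χ : Hyz R n U {c, g} →* Multiplicative ℚ, χ ⟨c, hcH⟩ = 1 → χ ⟨g, hgH⟩ = 1 → 
      (∀ u (hu : u ∈ U), χ ⟨_, Hyz_z R n U {c, g} u hu⟩ = 1) → ∀ h, χ h = 1 := by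
    intro χ h1 h2 h3
    refine gen_triv R n U _ χ h3 ?_
    rintro y (rfl | rfl)
    · exact h1
    · exact h2
  have hrel : ∀ (P : Type) [Group P] (θ : Hyz R n U {c, g} →* P),
      (∀ u (hu : u ∈ U), θ ⟨_, Hyz_z R n U {c, g} u hu⟩ = 1) →
      θ ⟨g, hgH⟩ * θ ⟨c, hcH⟩ ^ k = θ ⟨c, hcH⟩ ^ k * θ ⟨g, hgH⟩ := by
    intro P _ θ hθ
    have h1 := z_triv' θ hθ subset_rfl hw (Hyz_w _ subset_rfl hw)
    have h2 : (⟨_, Hyz_w _ subset_rfl hw⟩ : Hyz R n U {c, g}) =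
      ⟨g, hgH⟩ * ⟨c, hcH⟩ ^ k * ⟨g, hgH⟩⁻¹ * (⟨c, hcH⟩ ^ k)⁻¹ := rfl
    rw [h2] at h1
    simp only [map_mul, map_inv, map_zpow] at h1
    rwa [mul_inv_eq_one, mul_inv_eq_iff_eq_mul] at h1
  rcases master_two h.np (Hyz R n U {c, g}) n h.pos U (Hyz_z R n U _)
    (fun u _ => h.no_R hn tf u) ⟨c, hcH⟩ ⟨g, hgH⟩ (fun χ h1 h2 h3 => hyp' χ h1 h2 (z_triv χ h3))
    with ⟨x₀, V, ho, hc⟩ | ⟨θ, h1, h2, h3⟩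
  · apply h.cyc_fin tf ho hc
    apply heis_contra
    intro θ hθ
    have h1 := congrArg Heis.c (hrel _ θ hθ)
    obtain ⟨α, β, h1, h2, h3⟩ := exists_lin (θ ⟨c, hcH⟩).a (θ ⟨c, hcH⟩).b (θ ⟨g, hgH⟩).a
      (θ ⟨g, hgH⟩).b (by
        simp only [Heis.mul_c, Heis.pow_a, Heis.pow_b] at h1
        have hk' : (k : ℚ) ≠ 0 := by exact_mod_cast hk
        apply mul_left_cancel₀ hk'
        linarith)
    refine ⟨α, β, h1, ?_⟩
    exact hyp' ((Heis.lin α β).comp θ) (Heis.lin_one.2 h2) (Heis.lin_one.2 h3) (fun u hu => by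
      rw [MonoidHom.comp_apply, hθ u hu, map_one])
  · exact absurd (hrel _ θ (z_triv θ h3)) (Heis.not_comm _ _ h1 h2 k hk)

theorem Pres.thmE (h : Pres R n π) (hn : 1 < n) {c g : G}
    (tf : ∀ a ∈ Subgroup.closure {c, g}, ∀ m : ℕ, 0 < m → a ^ m = 1 → a = 1)
    {k l : ℤ} (hk : k ≠ 0) (hl : l ≠ 0) (hrel : g * c ^ k * g⁻¹ = c ^ l) :
    ∃ a ∈ Subgroup.closure {c, g}, c ∈ Subgroup.zpowers a ∧ g ∈ Subgroup.zpowers a := by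
  obtain ⟨c, rfl⟩ := h.surj c
  obtain ⟨g, rfl⟩ := h.surj g
  obtain ⟨U, -, hU⟩ := h.wit {g * c ^ k * g⁻¹ * (c ^ l)⁻¹} (by simp [hrel]) ∅
  specialize hU _ (Finset.mem_singleton_self _)
  have hm : ∀ a ∈ Hyz R n U {c, g}, π a ∈ Subgroup.closure {π c, π g} := by
    intro a ha
    have := Subgroup.mem_map_of_mem π ha
    rwa [h.map_Hyz, Set.image_pair] at this
  have tf' : ∀ a ∈ Hyz R n U {c, g}, ∀ m : ℕ, 0 < m → π a ^ m = 1 → π a = 1 :=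
    fun a ha m h0 h1 => tf _ (hm a ha) m h0 h1
  have hcH : c ∈ Hyz R n U {c, g} := Hyz_y R n U _ c (by simp)
  have hgH : g ∈ Hyz R n U {c, g} := Hyz_y R n U _ g (by simp)
  have key : ∃ a ∈ Hyz R n U {c, g}, ∀ b ∈ Hyz R n U {c, g}, π b ∈ Subgroup.zpowers (π a) := by
    by_cases hkl : k = l
    · subst hkl
      exact h.two_cyc hn tf' hk hU
    · apply h.one_cyc hn tf' ⟨g, hgH⟩
      intro χ h1 h2
      have h3 := z_triv' χ h2 subset_rfl hU (Hyz_w _ subset_rfl hU)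
      have h4 : (⟨_, Hyz_w _ subset_rfl hU⟩ : Hyz R n U {c, g}) =
        ⟨g, hgH⟩ * ⟨c, hcH⟩ ^ k * ⟨g, hgH⟩⁻¹ * (⟨c, hcH⟩ ^ l)⁻¹ := rfl
      rw [h4] at h3
      simp only [map_mul, map_inv, map_zpow, h1, one_mul, inv_one, mul_one] at h3
      have h5 : χ ⟨c, hcH⟩ = 1 := by
        rw [← zpow_neg, ← zpow_add] at h3
        have h6 : (k + -l) • Multiplicative.toAdd (χ ⟨c, hcH⟩) = 0 := h3
        rcases smul_eq_zero.1 h6 with h | h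
        · omega
        · exact h
      rintro y (rfl | rfl) _
      · exact h5
      · exact h1
  obtain ⟨a, ha, hb⟩ := key
  exact ⟨π a, hm a ha, hb c hcH, hb g hgH⟩

end
end OR

namespace OR
section
open scoped Classical
variable {X : Type} {P : Type} [Group P] {R : FreeGroup X} {n : ℕ}
  {G : Type} [Group G] {π : FreeGroup X →* G}

/-- the subgroup generated by the `L`-conjugates of `S` -/
def rn {G : Type*} [Group G] (L : Subgroup G) (S : Set G) : Subgroup G :=
  Subgroup.closure {g | ∃ l ∈ L, ∃ s ∈ S, g = l * s * l⁻¹}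

theorem rn_lift {F : Type*} [Group F] (π : F →* G) (K : Subgroup F) (S : Set F) {g : G}
    (hg : g ∈ rn (K.map π) (π '' S)) : ∃ w ∈ rn K S, π w = g := by
  have : rn (K.map π) (π '' S) ≤ (rn K S).map π := by
    refine (Subgroup.closure_le _).2 ?_
    rintro _ ⟨_, ⟨l, hl, rfl⟩, _, ⟨s, hs, rfl⟩, rfl⟩
    exact ⟨l * s * l⁻¹, Subgroup.subset_closure ⟨l, hl, s, hs, rfl⟩, by simp⟩
  obtain ⟨w, hw, h⟩ := this hg
  exact ⟨w, hw, h⟩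

theorem rn_kill {F : Type*} [Group F] {K H : Subgroup F} (hK : K ≤ H) {S : Set F}
    (hS : ∀ s ∈ S, s ∈ H) (χ : H →* P) (h : ∀ s (hs : s ∈ S), χ ⟨s, hS s hs⟩ = 1) {w : F}
    (hw : w ∈ rn K S) : ∀ hw' : w ∈ H, χ ⟨w, hw'⟩ = 1 := by
  have : rn K S ≤ χ.ker.map H.subtype := by
    refine (Subgroup.closure_le _).2 ?_
    rintro _ ⟨l, hl, s, hs, rfl⟩
    refine ⟨⟨l, hK hl⟩ * ⟨s, hS s hs⟩ * ⟨l, hK hl⟩⁻¹, ?_, rfl⟩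
    show χ _ = 1
    rw [map_mul, map_mul, h s hs, map_inv]; simp
  obtain ⟨⟨a, ha⟩, h2, h3⟩ := this hw
  have h4 : a = w := h3
  subst h4
  intro _
  exact h2

theorem rn_le {F : Type*} [Group F] {K H : Subgroup F} (hK : K ≤ H) {S : Set F}
    (hS : ∀ s ∈ S, s ∈ H) : rn K S ≤ H := by
  refine (Subgroup.closure_le _).2 ?_
  rintro _ ⟨l, hl, s, hs, rfl⟩
  exact H.mul_mem (H.mul_mem (hK hl) (hS s hs)) (H.inv_mem (hK hl))

theorem Pres.fg (h : Pres R n π) {L : Subgroup G} (hL : L.FG) (Y₀ : Finset (FreeGroup X))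
    (hY₀ : ∀ y ∈ Y₀, π y ∈ L) :
    ∃ Y : Finset (FreeGroup X), Y₀ ⊆ Y ∧ Subgroup.closure (π '' (Y : Set (FreeGroup X))) = L := by
  obtain ⟨S, hS⟩ := hL
  choose f hf using h.surj
  refine ⟨Y₀ ∪ S.image f, Finset.subset_union_left, ?_⟩
  apply le_antisymm
  · rw [Subgroup.closure_le]
    rintro _ ⟨y, hy, rfl⟩
    rcases Finset.mem_union.1 (Finset.mem_coe.1 hy) with hy | hy
    · exact hY₀ y hy
    · obtain ⟨s, hs, rfl⟩ := Finset.mem_image.1 hy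
      rw [hf, ← hS]
      exact Subgroup.subset_closure hs
  · rw [← hS]
    apply Subgroup.closure_mono
    intro s hs
    exact ⟨f s, by simp only [Finset.coe_union, Finset.coe_image]; exact Or.inr ⟨s, hs, rfl⟩, hf s⟩

theorem Pres.setup (h : Pres R n π) {L : Subgroup G} {Y : Finset (FreeGroup X)}
    (hY : Subgroup.closure (π '' (Y : Set (FreeGroup X))) = L) {S : Set (FreeGroup X)}
    (hS : S ⊆ Y) (hL : L ≤ rn L (π '' S)) (U₀ W : Finset (FreeGroup X))
    (hW : ∀ w ∈ W, π w = 1) :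
    ∃ U, U₀ ⊆ U ∧ (∀ w ∈ W,
      w ∈ Subgroup.closure ((fun u => u * R ^ n * u⁻¹) '' (U : Set (FreeGroup X)))) ∧
    ∀ (P : Type) [Group P] (χ : Hyz R n U Y →* P),
      (∀ u (hu : u ∈ U), χ ⟨_, Hyz_z R n U Y u hu⟩ = 1) →
      (∀ s (hs : s ∈ S), χ ⟨s, Hyz_y R n U Y s (hS hs)⟩ = 1) → ∀ a, χ a = 1 := by
  have hY' : (Subgroup.closure (Y : Set (FreeGroup X))).map π = L := by
    rw [MonoidHom.map_closure, hY]
  have h1 : ∀ y ∈ Y, ∃ w ∈ rn (Subgroup.closure (Y : Set (FreeGroup X))) S, π w = π y := by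
    intro y hy
    apply rn_lift
    rw [hY']
    apply hL
    rw [← hY]
    exact Subgroup.subset_closure ⟨y, hy, rfl⟩
  choose! f hf using h1
  obtain ⟨U, hU, hU2⟩ := h.wit (W ∪ Y.image (fun y => y * (f y)⁻¹)) (by
    intro w hw
    rcases Finset.mem_union.1 hw with hw | hw
    · exact hW w hw
    · obtain ⟨y, hy, rfl⟩ := Finset.mem_image.1 hw
      rw [map_mul, map_inv, (hf y hy).2, mul_inv_cancel]) U₀
  refine ⟨U, hU, fun w hw => hU2 w (Finset.mem_union_left _ hw), ?_⟩
  intro P _ χ hz hs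
  apply gen_triv R n U _ χ hz
  intro y hy
  have hK : Subgroup.closure (Y : Set (FreeGroup X)) ≤ Hyz R n U Y :=
    Subgroup.closure_mono Set.subset_union_left
  have hfy : f y ∈ Hyz R n U Y := rn_le hK (fun s hs => Hyz_y R n U Y s (hS hs)) (hf y hy).1
  have h3 := rn_kill hK (fun s hs => Hyz_y R n U Y s (hS hs)) χ hs (hf y hy).1 hfy
  have h4 := hU2 (y * (f y)⁻¹) (Finset.mem_union_right _ (Finset.mem_image.2 ⟨y, hy, rfl⟩))
  have h5 := z_triv' χ hz subset_rfl h4 (Hyz_w _ subset_rfl h4)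
  have h6 : (⟨y, Hyz_y R n U Y y hy⟩ : Hyz R n U Y) = ⟨_, Hyz_w _ subset_rfl h4⟩ * ⟨f y, hfy⟩ := by
    apply Subtype.ext; simp
  rw [h6, map_mul, h5, h3, one_mul]

/-- a torsion-free f.g. subgroup normally generated by one element is cyclic -/
theorem Pres.b1 (h : Pres R n π) (hn : 1 < n) {L : Subgroup G} (hfg : L.FG)
    (tf : ∀ a ∈ L, ∀ m : ℕ, 0 < m → a ^ m = 1 → a = 1) {c : G} (hc : c ∈ L)
    (hL : L ≤ rn L {c}) : ∃ a, L = Subgroup.zpowers a := by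
  obtain ⟨c, rfl⟩ := h.surj c
  obtain ⟨Y, hY1, hY⟩ := h.fg hfg {c} (by simpa using hc)
  have hcY : c ∈ Y := hY1 (by simp)
  obtain ⟨U, _, _, hU⟩ := h.setup hY (S := {c}) (by simpa using hcY) (by simpa using hL) ∅ ∅ (by simp)
  have hm : (Hyz R n U Y).map π = L := by rw [h.map_Hyz, hY]
  have hm' : ∀ a ∈ Hyz R n U Y, π a ∈ L := by
    intro a ha
    rw [← hm]; exact Subgroup.mem_map_of_mem π ha
  obtain ⟨a, ha, hb⟩ := h.one_cyc hn (fun a ha => tf _ (hm' a ha)) ⟨c, Hyz_y R n U Y c hcY⟩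
    (by
      intro χ h1 h2 y hy hy'
      apply hU _ χ h2
      rintro s rfl
      exact h1)
  refine ⟨π a, le_antisymm ?_ ?_⟩
  · intro b hb'
    rw [← hm] at hb'
    obtain ⟨b, hb', rfl⟩ := hb'
    exact hb b hb'
  · rw [Subgroup.zpowers_le]; exact hm' a ha

theorem q_pow {m : ℕ} (hm : 0 < m) {a : Multiplicative ℚ} (h : a ^ m = 1) : a = 1 := by
  have h3 : m • Multiplicative.toAdd a = 0 := h
  rcases smul_eq_zero.1 h3 with h | h
  · omega
  · exact h

theorem Pres.a1 (h : Pres R n π) {L : Subgroup G} (hfg : L.FG) {s₁ s₂ r : G}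
    (h1 : s₁ ∈ L) (h2 : s₂ ∈ L) (hr : r ∈ L) (hL : L ≤ rn L {s₁, s₂}) {m₀ m₁ m₂ : ℕ}
    (hm₀ : 0 < m₀) (hm₁ : 0 < m₁) (hm₂ : 0 < m₂) (hr0 : r ^ m₀ = 1) (hs₁ : s₁ ^ m₁ ∈ rn L {r})
    (hs₂ : s₂ ^ m₂ ∈ rn L {r}) :
    L ≤ Subgroup.closure {t | t ∈ L ∧ ∃ m, 0 < m ∧ t ^ m = 1} := by
  obtain ⟨s₁, rfl⟩ := h.surj s₁
  obtain ⟨s₂, rfl⟩ := h.surj s₂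
  obtain ⟨r, rfl⟩ := h.surj r
  obtain ⟨Y, hY1, hY⟩ := h.fg hfg {s₁, s₂, r} (by simp [h1, h2, hr])
  have y1 : s₁ ∈ Y := hY1 (by simp)
  have y2 : s₂ ∈ Y := hY1 (by simp)
  have y3 : r ∈ Y := hY1 (by simp)
  have hY' : (Subgroup.closure (Y : Set (FreeGroup X))).map π = L := by
    rw [MonoidHom.map_closure, hY]
  obtain ⟨w₁, e1, e1'⟩ := rn_lift π (Subgroup.closure (Y : Set (FreeGroup X))) {r}
    (g := π s₁ ^ m₁) (by rw [hY']; simpa using hs₁)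
  obtain ⟨w₂, e2, e2'⟩ := rn_lift π (Subgroup.closure (Y : Set (FreeGroup X))) {r}
    (g := π s₂ ^ m₂) (by rw [hY']; simpa using hs₂)
  obtain ⟨U, _, hU1, hU⟩ := h.setup hY (S := {s₁, s₂})
    (by rintro y (rfl | rfl) <;> assumption) (by simpa [Set.image_pair] using hL) ∅
    {s₁ ^ m₁ * w₁⁻¹, s₂ ^ m₂ * w₂⁻¹, r ^ m₀} (by simp [e1', e2', hr0])
  have hm : (Hyz R n U Y).map π = L := by rw [h.map_Hyz, hY]
  have hm' : ∀ a ∈ Hyz R n U Y, π a ∈ L := by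
    intro a ha
    rw [← hm]; exact Subgroup.mem_map_of_mem π ha
  have hK : Subgroup.closure (Y : Set (FreeGroup X)) ≤ Hyz R n U Y :=
    Subgroup.closure_mono Set.subset_union_left
  have hw : ∀ w ∈ rn (Subgroup.closure (Y : Set (FreeGroup X))) {r}, w ∈ Hyz R n U Y :=
    fun w hw => rn_le hK (by rintro _ rfl; exact Hyz_y R n U Y _ y3) hw
  have key : ∀ (P : Type) [Group P], (∀ m : ℕ, 0 < m → ∀ a : P, a ^ m = 1 → a = 1) →
      ∀ χ : Hyz R n U Y →* P, (∀ u (hu : u ∈ U), χ ⟨_, Hyz_z R n U Y u hu⟩ = 1) →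
      ∀ a, χ a = 1 := by
    intro P _ hP χ hχ
    have k1 : ∀ w ∈ ({s₁ ^ m₁ * w₁⁻¹, s₂ ^ m₂ * w₂⁻¹, r ^ m₀} : Finset (FreeGroup X)),
        ∀ hh, χ ⟨w, hh⟩ = 1 := fun w hw hh => z_triv' χ hχ subset_rfl (hU1 w hw) hh
    have k2 : χ ⟨r, Hyz_y R n U Y _ y3⟩ = 1 := by
      apply hP m₀ hm₀
      rw [← map_pow]
      exact k1 (r ^ m₀) (by simp) _
    have k3 : ∀ w (hw' : w ∈ rn (Subgroup.closure (Y : Set (FreeGroup X))) {r}),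
        χ ⟨w, hw w hw'⟩ = 1 := by
      intro w hw'
      exact rn_kill hK (by rintro _ rfl; exact Hyz_y R n U Y _ y3) χ
        (by rintro _ rfl; exact k2) hw' _
    have k4 : ∀ s (hs : s ∈ Y) m w (_ : w ∈ rn (Subgroup.closure (Y : Set (FreeGroup X))) {r}),
        0 < m → s ^ m * w⁻¹ ∈ ({s₁ ^ m₁ * w₁⁻¹, s₂ ^ m₂ * w₂⁻¹, r ^ m₀} : Finset (FreeGroup X)) →
        χ ⟨s, Hyz_y R n U Y _ hs⟩ = 1 := by
      intro s hs m w hw' hm hin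
      apply hP m hm
      have k5 := k1 _ hin (Subgroup.mul_mem _ (Subgroup.pow_mem _ (Hyz_y R n U Y _ hs) _)
        (Subgroup.inv_mem _ (hw w hw')))
      have k6 : (⟨s ^ m * w⁻¹, (Subgroup.mul_mem _ (Subgroup.pow_mem _ (Hyz_y R n U Y _ hs) _)
        (Subgroup.inv_mem _ (hw w hw')))⟩ : Hyz R n U Y) = ⟨s, Hyz_y R n U Y _ hs⟩ ^ m *
          ⟨w, hw w hw'⟩⁻¹ := rfl
      rw [k6, map_mul, map_inv, k3 w hw', map_pow] at k5
      simpa using k5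
    apply hU P χ hχ
    rintro s (rfl | rfl)
    · exact k4 _ y1 m₁ w₁ e1 hm₁ (by simp)
    · exact k4 _ y2 m₂ w₂ e2 hm₂ (by simp)
  obtain ⟨x₀, V, ho, hc⟩ := master_zero h.np (Hyz R n U Y) n h.pos U (Hyz_z R n U Y) (by
    intro χ hχ
    exact key _ (fun m hm a => q_pow hm) χ (z_triv χ hχ))
  obtain ⟨ρ, h3, _, h4⟩ := ho.rho
  obtain ⟨⟨k, hk, h5⟩, _⟩ := h4 (key _ (fun m hm a => fg_pow_one hm) ρ
    (z_triv ρ (hc.kill ρ h3)))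
  rw [← hm]
  nth_rewrite 1 [h5]
  rw [MonoidHom.map_closure]
  apply Subgroup.closure_mono
  rintro _ ⟨_, ⟨v, hv, rfl⟩, rfl⟩
  refine ⟨Subgroup.mem_map_of_mem π ?_, n, h.pos, ?_⟩
  · exact Subgroup.mul_mem _ (Subgroup.mul_mem _ (hk v hv) (per_mem R _ v)) (Subgroup.inv_mem _ (hk v hv))
  · rw [← map_pow, conj_pow, conj_pow, ← pow_mul, mul_comm, pow_mul, ← conj_pow]
    simp only [map_mul, map_pow, map_inv, h.pow, one_pow]; simp


theorem Pres.a2 (h : Pres R n π) {L : Subgroup G} (hfg : L.FG) (w₁ w₂ : FreeGroup X) (i₁ i₂ : ℕ)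
    (h1 : π (w₁ * R ^ i₁ * w₁⁻¹) ∈ L) (h2 : π (w₂ * R ^ i₂ * w₂⁻¹) ∈ L)
    (hL : L ≤ rn L {π (w₁ * R ^ i₁ * w₁⁻¹), π (w₂ * R ^ i₂ * w₂⁻¹)}) :
    (∃ t m, 0 < m ∧ t ^ m = 1 ∧ L = Subgroup.zpowers t) ∨
    (w₁ ≠ w₂ ∧ ∃ t₁ t₂, L = Subgroup.closure {t₁, t₂} ∧ 
      (∀ m, π (w₁ * R ^ i₁ * w₁⁻¹) ^ m = 1 → t₁ ^ m = 1) ∧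
      (∀ m, π (w₂ * R ^ i₂ * w₂⁻¹) ^ m = 1 → t₂ ^ m = 1)) := by
  set s₁ := w₁ * R ^ i₁ * w₁⁻¹ with hs₁
  set s₂ := w₂ * R ^ i₂ * w₂⁻¹ with hs₂
  obtain ⟨Y, hY1, hY⟩ := h.fg hfg {s₁, s₂} (by simp only [Finset.mem_insert, Finset.mem_singleton]; rintro y (rfl | rfl) <;> assumption)
  have y1 : s₁ ∈ Y := hY1 (by simp)
  have y2 : s₂ ∈ Y := hY1 (by simp)
  obtain ⟨U, hU0, -, hU⟩ := h.setup hY (S := {s₁, s₂})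
    (by rintro y (rfl | rfl) <;> assumption) (by rw [Set.image_pair]; exact hL) {w₁, w₂} ∅ (by simp)
  have hm : (Hyz R n U Y).map π = L := by rw [h.map_Hyz, hY]
  have u1 : w₁ ∈ U := hU0 (by simp)
  have u2 : w₂ ∈ U := hU0 (by simp)
  set H := Hyz R n U Y with hH
  have m1 : s₁ ∈ H := Hyz_y R n U Y _ y1
  have m2 : s₂ ∈ H := Hyz_y R n U Y _ y2
  have hU' : ∀ (P : Type) [Group P] (χ : H →* P),
      (∀ u (hu : u ∈ U), χ ⟨_, Hyz_z R n U Y u hu⟩ = 1) →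
      χ ⟨s₁, m1⟩ = 1 → χ ⟨s₂, m2⟩ = 1 → ∀ a, χ a = 1 := by
    intro P _ χ hχ k1 k2
    apply hU P χ hχ
    rintro s (rfl | rfl)
    · exact k1
    · exact k2
  have lp1 : (⟨s₁, m1⟩ : H) = loop R H w₁ ^ (i₁ / per R H w₁) := loop_pow m1
  have lp2 : (⟨s₂, m2⟩ : H) = loop R H w₂ ^ (i₂ / per R H w₂) := loop_pow m2
  have key : ∀ (P : Type) [Group P] (χ : H →* P), (∀ u ∈ U, χ (loop R H u) = 1) → ∀ a, χ a = 1 := by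
    intro P _ χ hχ
    apply hU' P χ (z_triv χ hχ)
    · rw [lp1, map_pow, hχ _ u1, one_pow]
    · rw [lp2, map_pow, hχ _ u2, one_pow]
  obtain ⟨x₀, V, ho, hc⟩ := master_zero h.np H n h.pos U (Hyz_z R n U Y) (fun χ hχ => key _ χ hχ)
  have hdist := ho.dist' h.pos (Hyz_z R n U Y) hc
  obtain ⟨ρ, h3, _, h4⟩ := ho.rho
  obtain ⟨⟨k, hk, h5⟩, _⟩ := h4 (key _ ρ (hc.kill ρ h3))
  obtain ⟨v₁, hv₁, a₁, ha₁, j₁, e1⟩ := hc.1 w₁ u1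
  obtain ⟨v₂, hv₂, a₂, ha₂, j₂, e2⟩ := hc.1 w₂ u2
  set t : FreeGroup X → G := fun v => π (k v * (v * R ^ per R H v * v⁻¹) * (k v)⁻¹) with ht
  have tpow : ∀ v m, t v ^ m = 1 ↔ n ∣ per R H v * m := by
    intro v m
    simp only [ht]
    rw [← map_pow, conj_pow, conj_pow, ← pow_mul]
    simp only [map_mul, map_inv, mul_inv_eq_one, mul_eq_left]
    rw [map_pow, ← orderOf_dvd_iff_pow_eq_one, h.ord]
  have hLt : L = Subgroup.closure (t '' (V : Set (FreeGroup X))) := by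
    rw [← hm]
    nth_rewrite 1 [h5]
    rw [MonoidHom.map_closure, Set.image_image]
  have other : ∀ v ∈ V, v ≠ v₁ → v ≠ v₂ → t v = 1 := by
    intro v hv n1 n2
    obtain ⟨u, hu, a, ha, i, he⟩ := hc.2 v hv
    obtain ⟨θ, q1, q2, q3, q4⟩ := ho.sep h.pos (Hyz_z R n U Y) hc u hu
    have hp : per R H v = per R H u := by rw [he, per_trans' R H u a ha]
    have hno : ∀ v' ∈ V, v ≠ v' → ∀ a' ∈ H, ∀ j' : ℤ, ∀ w, w = a' * v' * R ^ j' →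
        ¬ ∃ h ∈ H, ∃ i : ℤ, w = h * u * R ^ i := by
      rintro v' hv' hne a' ha' j' w hw ⟨b, hb, l, hl⟩
      apply hne
      apply hdist v hv v' hv' (a'⁻¹ * b * a⁻¹) (H.mul_mem (H.mul_mem (H.inv_mem ha') hb) (H.inv_mem ha)) (-i + l - j')
      have z1 : u = a⁻¹ * v * R ^ (-i) := by rw [he]; group
      have z2 : v' = a'⁻¹ * w * R ^ (-j') := by rw [hw]; group
      rw [z2, hl]
      nth_rewrite 1 [z1]
      rw [sub_eq_add_neg, zpow_add, zpow_add]; group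
    have hper : per R H u = n := by
      apply q4
      apply hU' _ θ q3
      · rw [lp1, map_pow, q2 w₁ u1 (hno v₁ hv₁ n1 a₁ ha₁ j₁ w₁ e1), one_pow]
      · rw [lp2, map_pow, q2 w₂ u2 (hno v₂ hv₂ n2 a₂ ha₂ j₂ w₂ e2), one_pow]
    have := (tpow v 1).2 (by rw [hp, hper, mul_one])
    rwa [pow_one] at this
  have hL2 : L = Subgroup.closure {t v₁, t v₂} := by
    rw [hLt]
    apply le_antisymm
    · rw [Subgroup.closure_le]
      rintro _ ⟨v, hv, rfl⟩
      by_cases n1 : v = v₁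
      · subst n1; exact Subgroup.subset_closure (by simp)
      by_cases n2 : v = v₂
      · subst n2; exact Subgroup.subset_closure (by simp)
      show t v ∈ Subgroup.closure _
      rw [other v hv n1 n2]; exact Subgroup.one_mem _
    · apply Subgroup.closure_mono
      rintro _ (rfl | rfl)
      · exact ⟨v₁, hv₁, rfl⟩
      · exact ⟨v₂, hv₂, rfl⟩
  by_cases hv : v₁ = v₂
  · left
    refine ⟨t v₁, n, h.pos, (tpow _ _).2 (dvd_mul_left _ _), ?_⟩
    rw [hL2, hv, Set.pair_eq_singleton, Subgroup.zpowers_eq_closure]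
  · right
    have hne : w₁ ≠ w₂ := by
      intro he
      apply hv
      apply hdist v₁ hv₁ v₂ hv₂ (a₂⁻¹ * a₁) (H.mul_mem (H.inv_mem ha₂) ha₁) (j₁ - j₂)
      have z2 : v₂ = a₂⁻¹ * w₂ * R ^ (-j₂) := by rw [e2]; group
      rw [z2, ← he, e1, sub_eq_add_neg, zpow_add]; group
    refine ⟨hne, t v₁, t v₂, hL2, ?_, ?_⟩
    · intro m hm
      obtain ⟨θ, q1, q2, q3, q4⟩ := ho.sep h.pos (Hyz_z R n U Y) hc w₁ u1
      have hno : ¬ ∃ h ∈ H, ∃ i : ℤ, w₂ = h * w₁ * R ^ i := by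
        rintro ⟨b, hb, l, hl⟩
        apply hv
        apply hdist v₁ hv₁ v₂ hv₂ (a₂⁻¹ * b * a₁) (H.mul_mem (H.mul_mem (H.inv_mem ha₂) hb) ha₁)
          (j₁ + l - j₂)
        have z2 : v₂ = a₂⁻¹ * w₂ * R ^ (-j₂) := by rw [e2]; group
        rw [z2, hl, e1, sub_eq_add_neg, zpow_add, zpow_add]; group
      rw [tpow]
      have hp : per R H v₁ = per R H w₁ := by
        conv_rhs => rw [e1, per_trans' R H v₁ a₁ ha₁]
      rw [hp]
      have hni : n ∣ i₁ * m := by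
        rw [hs₁, ← map_pow, conj_pow, ← pow_mul] at hm
        simp only [map_mul, map_inv, mul_inv_eq_one, mul_eq_left] at hm
        rwa [map_pow, ← orderOf_dvd_iff_pow_eq_one, h.ord] at hm
      have hk1 : θ ⟨s₁, m1⟩ ^ m = 1 := by
        obtain ⟨q, hq⟩ := hni
        rw [← map_pow]
        have : (⟨s₁, m1⟩ : H) ^ m = ⟨_, Hyz_z R n U Y w₁ u1⟩ ^ q := by
          apply Subtype.ext
          rw [Subgroup.coe_pow, Subgroup.coe_pow]
          simp only [hs₁]
          rw [conj_pow, conj_pow, ← pow_mul, ← pow_mul, hq]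
        rw [this, map_pow, q3 w₁ u1, one_pow]
      have hχ := hU' _ ((powMonoidHom m).comp θ) (fun u hu => by
        rw [MonoidHom.comp_apply, q3 u hu, map_one]) hk1 (by
        rw [MonoidHom.comp_apply, lp2, map_pow, q2 w₂ u2 hno, one_pow, map_one]) (loop R H w₁)
      rw [MonoidHom.comp_apply, q1] at hχ
      have hχ' : m • (1 : ZMod (n / per R H w₁)) = 0 := hχ
      rw [nsmul_eq_mul, mul_one, ZMod.natCast_eq_zero_iff] at hχ'
      have hd := per_iff.1 (Hyz_z R n U Y w₁ u1)
      have := Nat.mul_dvd_mul_left (per R H w₁) hχ'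
      rwa [Nat.mul_div_cancel' hd] at this
    · intro m hm
      obtain ⟨θ, q1, q2, q3, q4⟩ := ho.sep h.pos (Hyz_z R n U Y) hc w₂ u2
      have hno : ¬ ∃ h ∈ H, ∃ i : ℤ, w₁ = h * w₂ * R ^ i := by
        rintro ⟨b, hb, l, hl⟩
        apply hv
        symm
        apply hdist v₂ hv₂ v₁ hv₁ (a₁⁻¹ * b * a₂) (H.mul_mem (H.mul_mem (H.inv_mem ha₁) hb) ha₂)
          (j₂ + l - j₁)
        have z2 : v₁ = a₁⁻¹ * w₁ * R ^ (-j₁) := by rw [e1]; group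
        rw [z2, hl, e2, sub_eq_add_neg, zpow_add, zpow_add]; group
      rw [tpow]
      have hp : per R H v₂ = per R H w₂ := by
        conv_rhs => rw [e2, per_trans' R H v₂ a₂ ha₂]
      rw [hp]
      have hni : n ∣ i₂ * m := by
        rw [hs₂, ← map_pow, conj_pow, ← pow_mul] at hm
        simp only [map_mul, map_inv, mul_inv_eq_one, mul_eq_left] at hm
        rwa [map_pow, ← orderOf_dvd_iff_pow_eq_one, h.ord] at hm
      have hk1 : θ ⟨s₂, m2⟩ ^ m = 1 := by
        obtain ⟨q, hq⟩ := hni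
        rw [← map_pow]
        have : (⟨s₂, m2⟩ : H) ^ m = ⟨_, Hyz_z R n U Y w₂ u2⟩ ^ q := by
          apply Subtype.ext
          rw [Subgroup.coe_pow, Subgroup.coe_pow]
          simp only [hs₂]
          rw [conj_pow, conj_pow, ← pow_mul, ← pow_mul, hq]
        rw [this, map_pow, q3 w₂ u2, one_pow]
      have hχ := hU' _ ((powMonoidHom m).comp θ) (fun u hu => by
        rw [MonoidHom.comp_apply, q3 u hu, map_one]) (by
        rw [MonoidHom.comp_apply, lp1, map_pow, q2 w₁ u1 hno, one_pow, map_one]) hk1 (loop R H w₂)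
      rw [MonoidHom.comp_apply, q1] at hχ
      have hχ' : m • (1 : ZMod (n / per R H w₂)) = 0 := hχ
      rw [nsmul_eq_mul, mul_one, ZMod.natCast_eq_zero_iff] at hχ'
      have hd := per_iff.1 (Hyz_z R n U Y w₂ u2)
      have := Nat.mul_dvd_mul_left (per R H w₂) hχ'
      rwa [Nat.mul_div_cancel' hd] at this

end
end OR

namespace OR
section
open scoped Classical

/-- affine group of a module -/
@[ext] structure Aff (A W : Type) [CommRing A] [AddCommGroup W] [Module A W] where
  w : W
  u : Aˣ

namespace Aff
variable {A W : Type} [CommRing A] [AddCommGroup W] [Module A W]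

instance : Mul (Aff A W) := ⟨fun p q => ⟨p.w + (p.u : A) • q.w, p.u * q.u⟩⟩
instance : One (Aff A W) := ⟨⟨0, 1⟩⟩
instance : Inv (Aff A W) := ⟨fun p => ⟨-((p.u⁻¹ : Aˣ) : A) • p.w, p.u⁻¹⟩⟩

@[simp] theorem mul_w (p q : Aff A W) : (p * q).w = p.w + (p.u : A) • q.w := rfl
@[simp] theorem mul_u (p q : Aff A W) : (p * q).u = p.u * q.u := rfl
@[simp] theorem one_w : (1 : Aff A W).w = 0 := rfl
@[simp] theorem one_u : (1 : Aff A W).u = 1 := rfl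
@[simp] theorem inv_w (p : Aff A W) : (p⁻¹).w = -((p.u⁻¹ : Aˣ) : A) • p.w := rfl
@[simp] theorem inv_u (p : Aff A W) : (p⁻¹).u = p.u⁻¹ := rfl

instance : Group (Aff A W) := Group.ofLeftAxioms
  (fun p q r => by
    ext
    · simp [add_assoc, mul_smul]
    · simp [mul_assoc])
  (fun p => by ext <;> simp)
  (fun p => by ext <;> simp)

/-- the linear part -/
def toU : Aff A W →* Aˣ where
  toFun p := p.u
  map_one' := rfl
  map_mul' _ _ := rfl

theorem pow_w {p : Aff A W} (hp : p.u = 1) (k : ℕ) : p ^ k = ⟨k • p.w, 1⟩ := by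
  induction k with
  | zero => ext <;> simp
  | succ k ih => 
    rw [pow_succ, ih]
    ext
    · simp [add_smul]
    · simp [hp]

end Aff

theorem nzd {k M : Type} [CommRing k] [CommGroup M] {c : M} (hc : ∀ i : ℕ, 0 < i → c ^ i ≠ 1)
    (x : MonoidAlgebra k M) (hx : (MonoidAlgebra.of k M c - 1) * x = 0) : x = 0 := by
  have h1 : ∀ g, x.coeff (c⁻¹ * g) = x.coeff g := by
    intro g
    have h2 : MonoidAlgebra.of k M c * x = x := by
      rw [sub_mul, one_mul, sub_eq_zero] at hx; exact hx
    have h3 := congrArg (fun y : MonoidAlgebra k M => y.coeff g) h2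
    simp only [MonoidAlgebra.of_apply] at h3
    rw [← h3]
    have h4 := MonoidAlgebra.coeff_single_mul_eq_mul_coeff (x := x) (r := (1 : k)) (m := c) (m₁ := g)
      (c⁻¹ * g) (fun m' _ => by rw [eq_inv_mul_iff_mul_eq])
    rw [h4, one_mul]
  have h2 : ∀ (i : ℕ) g, x.coeff ((c⁻¹) ^ i * g) = x.coeff g := by
    intro i
    induction i with
    | zero => simp
    | succ i ih =>
      intro g
      rw [pow_succ, mul_assoc, ih, h1]
  by_contra hne
  obtain ⟨g, hg⟩ : ∃ g, x.coeff g ≠ 0 := by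
    by_contra h
    push Not at h
    exact hne (MonoidAlgebra.ext (Finsupp.ext h))
  have hinj : Function.Injective (fun i : ℕ => (c⁻¹) ^ i * g) := by
    intro i j hij
    have hij : c ^ i = c ^ j := by
      simpa using hij
    by_contra hij'
    rcases Nat.lt_or_gt_of_ne hij' with h | h
    · apply hc (j - i) (by omega)
      rw [pow_sub _ h.le, hij, mul_inv_cancel]
    · apply hc (i - j) (by omega)
      rw [pow_sub _ h.le, hij, mul_inv_cancel]
  have hfin : (Set.range (fun i : ℕ => (c⁻¹) ^ i * g)).Finite := by
    apply (Finsupp.hasFiniteSupport x.coeff).subset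
    rintro _ ⟨i, rfl⟩
    simp only [Function.mem_support]
    rw [h2]; exact hg
  exact Set.infinite_range_of_injective hinj hfin

theorem loc_cyc_fin {M : Type} [CommGroup M]
    (hM : ∀ x y : M, ∃ b, x ∈ Subgroup.zpowers b ∧ y ∈ Subgroup.zpowers b) (S : Finset M) :
    ∃ b, ∀ x ∈ S, x ∈ Subgroup.zpowers b := by
  induction S using Finset.induction_on with
  | empty => exact ⟨1, by simp⟩
  | insert a s ha ih =>
    obtain ⟨b, hb⟩ := ih
    obtain ⟨d, h1, h2⟩ := hM a b
    refine ⟨d, ?_⟩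
    intro x hx
    rcases Finset.mem_insert.1 hx with rfl | hx
    · exact h1
    · exact (Subgroup.zpowers_le.2 h2) (hb x hx)

theorem deriv_cyc {K : Type} [Group K] [IsFreeGroup K] {M : Type} [CommGroup M]
    (hM : ∀ x y : M, ∃ b, x ∈ Subgroup.zpowers b ∧ y ∈ Subgroup.zpowers b)
    (φ : K →* M) {n : ℕ} (hn : 1 < n) {c : M} (hc : ∀ i : ℕ, 0 < i → c ^ i ≠ 1)
    (K₀ : Subgroup K) (hK₀ : K₀ ≤ Subgroup.closure {g | ∃ y, φ y = 1 ∧ g = y ^ n})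
    (f : M → K) (hf : ∀ m, φ (f m) = m) (hcom : ∀ i j, f i * f j * (f j * f i)⁻¹ ∈ K₀) :
    ∃ b : M, ∀ m, m ∈ Subgroup.zpowers b := by
  have : Fact (1 < n) := ⟨hn⟩
  set k := ZMod n
  set A := MonoidAlgebra k M
  let W := M →₀ A
  let η : M →* Aˣ := (MonoidAlgebra.of k M).toHomUnits
  have hη : ∀ m, (η m : A) = MonoidAlgebra.of k M m := fun m => rfl
  let Φ : K →* Aff A W := IsFreeGroup.lift (fun x => ⟨Finsupp.single (φ (IsFreeGroup.of x)) 1,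
    η (φ (IsFreeGroup.of x))⟩)
  have hΦ : ∀ x, Φ (IsFreeGroup.of x) = ⟨Finsupp.single (φ (IsFreeGroup.of x)) 1,
    η (φ (IsFreeGroup.of x))⟩ := fun x => IsFreeGroup.lift_of _ _
  have hu : ∀ g, (Φ g).u = η (φ g) := by
    intro g
    have : (Aff.toU.comp Φ) = η.comp φ := by
      apply IsFreeGroup.ext_hom
      intro x
      rw [MonoidHom.comp_apply, hΦ]; rfl
    exact DFunLike.congr_fun this g
  -- augmentation
  let ev : W →ₗ[A] A := Finsupp.linearCombination A (fun m : M => MonoidAlgebra.of k M m - 1)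
  have hev : ∀ g, ev (Φ g).w = MonoidAlgebra.of k M (φ g) - 1 := by
    let B : Subgroup (Aff A W) :=
      { carrier := {p | ev p.w = (p.u : A) - 1}
        one_mem' := by simp
        mul_mem' := by
          intro p q hp hq
          simp only [Set.mem_ofPred_eq] at hp hq ⊢
          simp only [Aff.mul_w, Aff.mul_u, map_add, map_smul, hp, hq, Units.val_mul, smul_eq_mul]
          ring
        inv_mem' := by
          intro p hp
          simp only [Set.mem_ofPred_eq] at hp ⊢
          simp only [Aff.inv_w, Aff.inv_u, map_smul, hp, smul_eq_mul]
          rw [mul_sub, neg_mul, Units.inv_mul]; ring }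
    have hB : ∀ g, Φ g ∈ B := by
      intro g
      let Φ' : K →* B := IsFreeGroup.lift (fun x => ⟨Φ (IsFreeGroup.of x), by
        rw [hΦ]
        show ev _ = _
        rw [Finsupp.linearCombination_single, one_smul, hη]⟩)
      have : B.subtype.comp Φ' = Φ := by
        apply IsFreeGroup.ext_hom
        intro x
        rw [MonoidHom.comp_apply]
        simp only [Φ']
        rw [IsFreeGroup.lift_of]; rfl
      rw [← this]
      exact (Φ' g).2
    intro g
    have h1 : ev (Φ g).w = ((Φ g).u : A) - 1 := hB g
    rw [h1, hu, hη]
  have hker : K₀ ≤ Φ.ker := by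
    refine hK₀.trans ((Subgroup.closure_le _).2 ?_)
    rintro _ ⟨y, hy, rfl⟩
    show Φ (y ^ n) = 1
    rw [map_pow, Aff.pow_w (by rw [hu, hy, map_one])]
    ext
    · simp only [Aff.one_w]
      have : (n : A) = 0 := by
        have h2 : ((n : k) : k) = 0 := ZMod.natCast_self n
        have h3 := congrArg (algebraMap k A) h2
        rwa [map_natCast, map_zero] at h3
      rw [← Nat.cast_smul_eq_nsmul A, this, zero_smul]
    · simp
  have hcomm : ∀ i j, (MonoidAlgebra.of k M i - 1) • (Φ (f j)).w =
      (MonoidAlgebra.of k M j - 1) • (Φ (f i)).w := by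
    intro i j
    have h1 : Φ (f i * f j * (f j * f i)⁻¹) = 1 := hker (hcom i j)
    rw [map_mul, map_inv, mul_inv_eq_one, map_mul, map_mul] at h1
    have h2 := congrArg Aff.w h1
    simp only [Aff.mul_w, hu, hf, hη] at h2
    rw [sub_smul, sub_smul, one_smul, one_smul, sub_eq_sub_iff_add_eq_add, add_comm, h2, add_comm]
  obtain ⟨b, hb⟩ := loc_cyc_fin hM (Φ (f c)).w.support
  refine ⟨b, ?_⟩
  intro m
  have hsup : (Φ (f m)).w.support ⊆ (Φ (f c)).w.support := by
    intro x hx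
    rw [Finsupp.mem_support_iff] at hx ⊢
    intro h0
    apply hx
    apply nzd hc
    have := DFunLike.congr_fun (hcomm c m) x
    rw [Finsupp.smul_apply, Finsupp.smul_apply, h0, smul_zero] at this
    exact this
  -- pass to the quotient
  let q : M →* M ⧸ Subgroup.zpowers b := QuotientGroup.mk' _
  let Q := MonoidAlgebra.mapDomainRingHom k q
  have hQ : ∀ x, Q (MonoidAlgebra.of k M x) = MonoidAlgebra.of k _ (q x) := by
    intro x
    simp [Q, MonoidAlgebra.mapDomain_single]
  have h1 := hev (f m)
  rw [hf] at h1
  have h2 : Q (ev (Φ (f m)).w) = 0 := by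
    simp only [ev]
    rw [Finsupp.linearCombination_apply, Finsupp.sum, map_sum]
    apply Finset.sum_eq_zero
    intro x hx
    have hx' := hb x (hsup hx)
    rw [smul_eq_mul, map_mul, map_sub, map_one, hQ]
    have : q x = 1 := (QuotientGroup.eq_one_iff x).2 hx'
    rw [this, map_one, sub_self, mul_zero]
  rw [h1, map_sub, map_one, hQ, sub_eq_zero] at h2
  have h3 : q m = 1 := by
    apply MonoidAlgebra.of_injective (R := k)
    rw [h2, map_one]
  exact (QuotientGroup.eq_one_iff m).1 h3

end
end OR

namespace OR
section
open scoped Classical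
variable {X : Type} {R : FreeGroup X} {n : ℕ} {G : Type} [Group G] {π : FreeGroup X →* G}

theorem Pres.T_iff (h : Pres R n π) (g : FreeGroup X) :
    π g ∈ Subgroup.normalClosure {π R} ↔ g ∈ Subgroup.normalClosure {R} := by
  have h1 : (Subgroup.normalClosure {R}).map π = Subgroup.normalClosure {π R} := by
    rw [Subgroup.map_normalClosure _ _ h.surj, Set.image_singleton]
  rw [← h1]
  constructor
  · rintro ⟨g', hg', he⟩
    have h2 : π (g * g'⁻¹) = 1 := by rw [map_mul, map_inv, he, mul_inv_cancel]
    rw [h.ker] at h2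
    have h3 : Subgroup.normalClosure {R ^ n} ≤ Subgroup.normalClosure {R} := by
      apply Subgroup.normalClosure_le_normal
      rintro _ rfl
      exact (Subgroup.normalClosure {R}).pow_mem
        (Subgroup.subset_normalClosure (Set.mem_singleton R)) n
    have := Subgroup.mul_mem _ (h3 h2) hg'
    simpa using this
  · exact fun hg => Subgroup.mem_map_of_mem π hg

theorem Pres.T_tf (h : Pres R n π) {a : G} {m : ℕ} (hm : 0 < m)
    (ha : a ^ m ∈ Subgroup.normalClosure {π R}) : a ∈ Subgroup.normalClosure {π R} := by
  obtain ⟨a, rfl⟩ := h.surj a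
  rw [← map_pow, h.T_iff] at ha
  rw [h.T_iff]
  exact Q_tf h.np hm ha

theorem Pres.T_tfz (h : Pres R n π) {a : G} {m : ℤ} (hm : m ≠ 0)
    (ha : a ^ m ∈ Subgroup.normalClosure {π R}) : a ∈ Subgroup.normalClosure {π R} := by
  apply h.T_tf (m := m.natAbs) (by omega)
  rcases Int.natAbs_eq m with h | h
  · rw [h, zpow_natCast] at ha; exact ha
  · rw [h, zpow_neg, zpow_natCast] at ha
    simpa using ha

theorem Pres.tors_T (h : Pres R n π) {a : G} {m : ℕ} (hm : 0 < m) (ha : a ^ m = 1) :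
    a ∈ Subgroup.normalClosure {π R} :=
  h.T_tf hm (by rw [ha]; exact Subgroup.one_mem _)

/-- commuting with a torsion element -/
theorem Pres.comm_tors (h : Pres R n π) {s a : G} {m : ℕ} (hm : 0 < m) (hs : s ^ m = 1)
    (hs1 : s ≠ 1) (hc : a * s * a⁻¹ = s) : a ^ n = 1 := by
  obtain ⟨d, hd⟩ := h.tors hm hs
  have h1 : d * a * d⁻¹ ∈ Subgroup.zpowers (π R) := by
    apply h.mal hd
    · have : d * a * d⁻¹ * (d * s * d⁻¹) * (d * a * d⁻¹)⁻¹ = d * (a * s * a⁻¹) * d⁻¹ := by group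
      rwa [this, hc]
    · intro h2
      apply hs1
      rw [mul_inv_eq_one] at h2
      simpa using h2
  obtain ⟨i, hi⟩ := h.zpow_nat h1
  have h2 : (d * a * d⁻¹) ^ n = 1 := by rw [hi, ← pow_mul, mul_comm, pow_mul, h.pow, one_pow]
  rw [conj_pow, mul_inv_eq_one] at h2
  simpa using h2

/-- the commensurator of `c` -/
def comms (c : G) : Subgroup G where
  carrier := {g | ∃ k l : ℤ, k ≠ 0 ∧ l ≠ 0 ∧ g * c ^ k * g⁻¹ = c ^ l}
  one_mem' := ⟨1, 1, one_ne_zero, one_ne_zero, by simp⟩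
  mul_mem' := by
    rintro g g' ⟨k, l, hk, hl, h⟩ ⟨k', l', hk', hl', h'⟩
    refine ⟨k' * k, l * l', mul_ne_zero hk' hk, mul_ne_zero hl hl', ?_⟩
    have : g * g' * c ^ (k' * k) * (g * g')⁻¹ = g * ((g' * c ^ k' * g'⁻¹) ^ k) * g⁻¹ := by
      rw [conj_zpow, ← zpow_mul]; group
    rw [this, h', ← zpow_mul, mul_comm l' k, zpow_mul, ← conj_zpow, h, zpow_mul]
  inv_mem' := by
    rintro g ⟨k, l, hk, hl, h⟩
    refine ⟨l, k, hl, hk, ?_⟩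
    rw [← h]; group

theorem Pres.comms_tf (h : Pres R n π) {c : G} (hc : c ∉ Subgroup.normalClosure {π R})
    {s : G} (hs : s ∈ comms c) {m : ℕ} (hm : 0 < m) (hsm : s ^ m = 1) : s = 1 := by
  by_contra hs1
  obtain ⟨k, l, hk, hl, hr⟩ := hs
  have hT := h.tors_T hm hsm
  have hkl : k = l := by
    by_contra hne
    apply hc
    apply h.T_tfz (m := l - k) (by omega)
    rw [zpow_sub, ← hr]
    have : s * c ^ k * s⁻¹ * (c ^ k)⁻¹ = s * (c ^ k * s⁻¹ * (c ^ k)⁻¹) := by group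
    rw [this]
    exact Subgroup.mul_mem _ hT (Subgroup.normalClosure_normal.conj_mem _ (Subgroup.inv_mem _ hT) _)
  subst hkl
  have := h.comm_tors (a := c ^ k) hm hsm hs1 (by
    rw [mul_inv_eq_iff_eq_mul] at hr ⊢; exact hr.symm)
  apply hc
  apply h.T_tfz (m := k * n) (mul_ne_zero hk (by exact_mod_cast h.pos.ne'))
  rw [zpow_mul, zpow_natCast, this]; exact Subgroup.one_mem _

theorem self_comms (c : G) : c ∈ comms c := ⟨1, 1, one_ne_zero, one_ne_zero, by simp⟩

theorem Pres.malnormal (h : Pres R n π) (hn : 1 < n) {c : G}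
    (hc : c ∉ Subgroup.normalClosure {π R}) :
    (comms c).IsMalnormal ∧ Nonempty (comms c ≃* Multiplicative ℤ) := by
  have hcinf : ∀ k : ℤ, k ≠ 0 → c ^ k ≠ 1 := by
    intro k hk he
    apply hc
    apply h.T_tfz hk
    rw [he]; exact Subgroup.one_mem _
  have tf : ∀ a ∈ comms c, ∀ m : ℕ, 0 < m → a ^ m = 1 → a = 1 :=
    fun a ha m hm he => h.comms_tf hc ha hm he
  have tf' : ∀ a ∈ comms c, ∀ g ∈ comms c, ∀ b ∈ Subgroup.closure {a, g}, ∀ m : ℕ, 0 < m →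
      b ^ m = 1 → b = 1 := by
    intro a ha g hg b hb
    apply tf
    refine (Subgroup.closure_le _).2 ?_ hb
    rintro x (rfl | rfl) <;> assumption
  have hle : ∀ a ∈ comms c, ∀ g ∈ comms c, Subgroup.closure {a, g} ≤ comms c := by
    intro a ha g hg
    refine (Subgroup.closure_le _).2 ?_
    rintro x (rfl | rfl) <;> assumption
  have hcc := self_comms c
  have key : ∀ g ∈ comms c, ∀ g' ∈ comms c, ∃ b ∈ comms c, g ∈ Subgroup.zpowers b ∧
      g' ∈ Subgroup.zpowers b ∧ c ∈ Subgroup.zpowers b := by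
    intro g hg g' hg'
    obtain ⟨k, l, hk, hl, hr⟩ := hg
    obtain ⟨a, ha, ⟨i, hi⟩, hga⟩ := h.thmE hn (tf' c hcc g ⟨k, l, hk, hl, hr⟩) hk hl hr
    have ha' := hle _ hcc _ ⟨k, l, hk, hl, hr⟩ ha
    obtain ⟨k', l', hk', hl', hr'⟩ := hg'
    have hi : a ^ i = c := hi
    have hi0 : i ≠ 0 := by
      rintro rfl
      rw [zpow_zero] at hi
      exact hcinf 1 one_ne_zero (by rw [← hi]; simp)
    obtain ⟨b, hb, hab, hgb⟩ := h.thmE hn (tf' a ha' g' ⟨k', l', hk', hl', hr'⟩)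
      (mul_ne_zero hi0 hk') (mul_ne_zero hi0 hl') (by rw [zpow_mul, zpow_mul, hi, hr'])
    refine ⟨b, hle _ ha' _ ⟨k', l', hk', hl', hr'⟩ hb, (Subgroup.zpowers_le.2 hab) hga, hgb, ?_⟩
    rw [← hi]
    exact Subgroup.zpow_mem _ hab _
  have key2 : ∀ x ∈ comms c, x ≠ 1 → ∃ i j : ℤ, i ≠ 0 ∧ j ≠ 0 ∧ x ^ i = c ^ j := by
    intro x hx hx1
    obtain ⟨b, hb, ⟨j, hj⟩, -, ⟨i, hi⟩⟩ := key x hx x hx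
    have hj : b ^ j = x := hj
    have hi : b ^ i = c := hi
    refine ⟨i, j, ?_, ?_, ?_⟩
    · rintro rfl
      rw [zpow_zero] at hi
      exact hcinf 1 one_ne_zero (by rw [← hi]; simp)
    · rintro rfl
      rw [zpow_zero] at hj
      exact hx1 hj.symm
    · rw [← hi, ← hj, ← zpow_mul, ← zpow_mul, mul_comm]
  have hMT : ∀ x ∈ comms c, x ∈ Subgroup.normalClosure {π R} → x = 1 := by
    intro x hx hxT
    by_contra hx1
    obtain ⟨i, j, hi, hj, he⟩ := key2 x hx hx1
    apply hc
    apply h.T_tfz hj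
    rw [← he]
    exact Subgroup.zpow_mem _ hxT _
  have hcomm : ∀ x ∈ comms c, ∀ y ∈ comms c, x * y = y * x := by
    intro x hx y hy
    obtain ⟨b, hb, ⟨j, hj⟩, ⟨i, hi⟩, -⟩ := key x hx y hy
    have hj : b ^ j = x := hj
    have hi : b ^ i = y := hi
    rw [← hj, ← hi, ← zpow_add, ← zpow_add, add_comm]
  constructor
  · rintro g ⟨x, hx1, hx, hgx⟩
    obtain ⟨i, j, hi, hj, he⟩ := key2 x hx hx1
    obtain ⟨i', j', hi', hj', he'⟩ := key2 _ hgx (by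
      intro h2
      apply hx1
      rw [mul_inv_eq_one] at h2
      simpa using h2)
    refine ⟨j * i', j' * i, mul_ne_zero hj hi', mul_ne_zero hj' hi, ?_⟩
    calc g * c ^ (j * i') * g⁻¹ = (g * x * g⁻¹) ^ (i' * i) := by
          rw [zpow_mul, ← he, conj_zpow, ← zpow_mul, mul_comm i]
      _ = c ^ (j' * i) := by rw [zpow_mul, he', ← zpow_mul]
  · set T := Subgroup.normalClosure {π R} with hT
    set q := QuotientGroup.mk' T with hq
    set Mq := (comms c).map q with hMq
    let _ : CommGroup Mq := { (inferInstance : Group Mq) with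
      mul_comm := by
        rintro ⟨_, x, hx, rfl⟩ ⟨_, y, hy, rfl⟩
        apply Subtype.ext
        show q x * q y = q y * q x
        rw [← map_mul, ← map_mul, hcomm x hx y hy] }
    have hsur : ∀ m : Mq, ∃ f : FreeGroup X, π f ∈ comms c ∧ q (π f) = m := by
      rintro ⟨_, x, hx, rfl⟩
      obtain ⟨f, rfl⟩ := h.surj x
      exact ⟨f, hx, rfl⟩
    choose f hf1 hf2 using hsur
    have hRK : ∀ u, q (π (u * R * u⁻¹)) = 1 := by
      intro u
      apply (QuotientGroup.eq_one_iff _).2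
      rw [map_mul, map_mul, map_inv]
      have hRT : π R ∈ Subgroup.normalClosure {π R} :=
        Subgroup.subset_normalClosure (Set.mem_singleton _)
      exact Subgroup.normalClosure_normal.conj_mem _ hRT (π u)
    obtain ⟨⟨_, b, hb, rfl⟩, hgen⟩ := deriv_cyc (M := Mq) (K := Mq.comap (q.comp π)) (n := n)
      (by
        rintro ⟨_, x, hx, rfl⟩ ⟨_, y, hy, rfl⟩
        obtain ⟨b, hb, ⟨j, hj⟩, ⟨i, hi⟩, -⟩ := key x hx y hy
        have hj : b ^ j = x := hj
        have hi : b ^ i = y := hi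
        refine ⟨⟨q b, b, hb, rfl⟩, ⟨j, ?_⟩, ⟨i, ?_⟩⟩
        · apply Subtype.ext
          show (q b) ^ j = q x
          rw [← map_zpow, hj]
        · apply Subtype.ext
          show (q b) ^ i = q y
          rw [← map_zpow, hi])
      ((q.comp π).subgroupComap Mq) hn (c := ⟨q c, c, hcc, rfl⟩)
      (by
        intro i hi he
        have he : (q c) ^ i = 1 := congrArg Subtype.val he
        rw [← map_pow] at he
        exact hc (h.T_tf hi ((QuotientGroup.eq_one_iff _).1 he)))
      ((π.comp (Mq.comap (q.comp π)).subtype).ker)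
      (by
        rintro ⟨k, hk⟩ hk1
        have hk1 : π k = 1 := hk1
        obtain ⟨U, hU⟩ := witness R n ((h.ker k).1 hk1)
        have hh : k ∈ (Subgroup.closure {g : Mq.comap (q.comp π) |
            ∃ y, (q.comp π).subgroupComap Mq y = 1 ∧ g = y ^ n}).map (Subgroup.subtype _) := by
          refine (Subgroup.closure_le _).2 ?_ hU
          rintro _ ⟨u, hu, rfl⟩
          have hm : u * R * u⁻¹ ∈ Mq.comap (q.comp π) := by
            rw [Subgroup.mem_comap, MonoidHom.comp_apply, hRK]
            exact Subgroup.one_mem _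
          refine ⟨⟨u * R * u⁻¹, hm⟩ ^ n, Subgroup.subset_closure ⟨⟨u * R * u⁻¹, hm⟩, ?_, rfl⟩, ?_⟩
          · apply Subtype.ext
            exact hRK u
          · show (u * R * u⁻¹) ^ n = _
            rw [conj_pow]
        obtain ⟨k', h1, h2⟩ := hh
        have : k' = ⟨k, hk⟩ := Subtype.ext h2
        rw [← this]; exact h1)
      (fun m => ⟨f m, by rw [Subgroup.mem_comap, MonoidHom.comp_apply, hf2]; exact m.2⟩)
      (by
        intro m
        apply Subtype.ext
        exact hf2 m)
      (by
        intro i j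
        show π (f i * f j * (f j * f i)⁻¹) = 1
        rw [map_mul, map_inv, map_mul, map_mul, hcomm _ (hf1 i) _ (hf1 j), mul_inv_cancel])
    have hgen' : ∀ x ∈ comms c, x ∈ Subgroup.zpowers b := by
      intro x hx
      obtain ⟨k, hk⟩ := hgen ⟨q x, x, hx, rfl⟩
      have hk : (q b) ^ k = q x := congrArg Subtype.val hk
      refine ⟨k, ?_⟩
      rw [← map_zpow] at hk
      have h1 : (b ^ k)⁻¹ * x ∈ T := QuotientGroup.eq.1 hk
      have h2 := hMT _ (Subgroup.mul_mem _ (Subgroup.inv_mem _ (Subgroup.zpow_mem _ hb k)) hx) h1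
      rwa [inv_mul_eq_one] at h2
    have hMb : comms c = Subgroup.zpowers b :=
      le_antisymm hgen' (Subgroup.zpowers_le.2 hb)
    rw [hMb]
    have hinj : Function.Injective ((zpowersHom G b).rangeRestrict) := by
      rw [MonoidHom.rangeRestrict_injective_iff, injective_iff_map_eq_one]
      intro k hk
      have hk : b ^ (Multiplicative.toAdd k) = 1 := hk
      by_contra hk0
      have hk0 : Multiplicative.toAdd k ≠ 0 := hk0
      obtain ⟨i, hi⟩ := hgen' c hcc
      have hi : b ^ i = c := hi
      apply hcinf _ hk0
      rw [← hi, ← zpow_mul, mul_comm, zpow_mul, hk, one_zpow]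
    have e := MulEquiv.ofBijective _ ⟨hinj, (zpowersHom G b).rangeRestrict_surjective⟩
    exact ⟨e.symm⟩

end
end OR

namespace OR
section
open scoped Classical

/-- reduced words in two subgroups -/
inductive RW {P : Type} [Group P] (H : Bool → Subgroup P) : Bool → P → Prop
  | single (t : Bool) (s : P) : s ∈ H t → s ≠ 1 → RW H t s
  | cons (t : Bool) (s w : P) : s ∈ H t → s ≠ 1 → RW H (!t) w → RW H t (s * w)

/-- an equivariant tree mapping to the Bass-Serre tree of a free product -/
structure GS {F P : Type} [Group F] [Group P] (H : Bool → Subgroup P) (ψ : F →* P)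
    (I : Type) where
  p : I → P
  r : Bool → F × I → F × I → Prop
  eqv : ∀ t g e e', r t e e' → r t (g * e.1, e.2) (g * e'.1, e'.2)
  hp : ∀ t e e', r t e e' → (ψ e.1 * p e.2)⁻¹ * (ψ e'.1 * p e'.2) ∈ H t
  conn : ∀ e e', Relation.EqvGen (fun a b => ∃ t, r t a b) e e'
  coch : ∀ (A : Type) [Group A] (α : F × I → A), ∃ U : Bool → F × I → A,
    (∀ t e e', r t e e' → U t e = U t e') ∧ ∀ e, α e = (U true e)⁻¹ * U false e

variable {F P : Type} [Group F] [Group P] {H : Bool → Subgroup P} {ψ : F →* P} {I : Type}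

theorem eqvGen_inv {E A : Type} {r : E → E → Prop} {U : E → A}
    (h : ∀ e e', r e e' → U e = U e') {e e' : E} (he : Relation.EqvGen r e e') : U e = U e' := by
  induction he with
  | rel _ _ h1 => exact h _ _ h1
  | refl => rfl
  | symm _ _ _ ih => exact ih.symm
  | trans _ _ _ _ _ i1 i2 => exact i1.trans i2

theorem GS.eqvG (S : GS H ψ I) (t : Bool) (g : F) {e e' : F × I}
    (h : Relation.EqvGen (S.r t) e e') :
    Relation.EqvGen (S.r t) (g * e.1, e.2) (g * e'.1, e'.2) := by
  induction h with
  | rel _ _ h1 => exact .rel _ _ (S.eqv _ _ _ _ h1)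
  | refl => exact .refl _
  | symm _ _ _ ih => exact ih.symm
  | trans _ _ _ _ _ i1 i2 => exact i1.trans _ _ _ i2

theorem GS.hpG (S : GS H ψ I) (t : Bool) {e e' : F × I}
    (h : Relation.EqvGen (S.r t) e e') :
    (ψ e.1 * S.p e.2)⁻¹ * (ψ e'.1 * S.p e'.2) ∈ H t := by
  induction h with
  | rel _ _ h1 => exact S.hp _ _ _ h1
  | refl => simp [(H t).one_mem]
  | symm _ _ _ ih => have := (H t).inv_mem ih; simpa using this
  | trans _ _ _ _ _ i1 i2 =>
    have := (H t).mul_mem i1 i2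
    convert this using 1
    group

theorem GS.fold (S : GS H ψ I) {a b : F} {i j : I} (hne : i ≠ j) (t : Bool)
    (hr : Relation.EqvGen (S.r t) (a, i) (b, j)) (hpp : ψ a * S.p i = ψ b * S.p j) :
    Nonempty (GS H ψ {k // k ≠ j}) := by
  set q : F × I → F × {k // k ≠ j} := fun e =>
    if h : e.2 = j then (e.1 * b⁻¹ * a, ⟨i, hne⟩) else (e.1, ⟨e.2, h⟩) with hq
  set ι : F × {k // k ≠ j} → F × I := fun e => (e.1, e.2.1) with hι
  have hqj : ∀ g, q (g, j) = (g * b⁻¹ * a, ⟨i, hne⟩) := fun g => by simp [hq]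
  have hqn : ∀ g k (h : k ≠ j), q (g, k) = (g, ⟨k, h⟩) := fun g k h => by simp [hq, h]
  have hqι : ∀ e, q (ι e) = e := by
    rintro ⟨g, k, hk⟩
    exact hqn g k hk
  have hqg : ∀ g e, q (g * e.1, e.2) = (g * (q e).1, (q e).2) := by
    rintro g ⟨e, k⟩
    by_cases h : k = j
    · subst h
      simp only [hqj, mul_assoc]
    · simp only [hqn _ _ h]
  have hqp : ∀ e, ψ (q e).1 * S.p (q e).2.1 = ψ e.1 * S.p e.2 := by
    rintro ⟨e, k⟩
    by_cases h : k = j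
    · subst h
      simp only [hqj]
      rw [map_mul, mul_assoc, hpp, map_mul, map_inv]
      group
    · simp only [hqn _ _ h]
  refine ⟨{ p := fun k => S.p k.1
            r := fun t c d => ∃ e e', S.r t e e' ∧ q e = c ∧ q e' = d
            eqv := ?_
            hp := ?_
            conn := ?_
            coch := ?_ }⟩
  · rintro t g _ _ ⟨e, e', h, rfl, rfl⟩
    exact ⟨_, _, S.eqv t g _ _ h, hqg _ _, hqg _ _⟩
  · rintro t _ _ ⟨e, e', h, rfl, rfl⟩
    rw [hqp, hqp]
    exact S.hp _ _ _ h
  · intro e e'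
    have : ∀ c d, Relation.EqvGen (fun a b => ∃ t, S.r t a b) c d →
        Relation.EqvGen (fun c d => ∃ t, ∃ e e', S.r t e e' ∧ q e = c ∧ q e' = d) (q c) (q d) := by
      intro c d h
      induction h with
      | rel _ _ h1 => 
        obtain ⟨t, h1⟩ := h1
        exact .rel _ _ ⟨t, _, _, h1, rfl, rfl⟩
      | refl => exact .refl _
      | symm _ _ _ ih => exact ih.symm
      | trans _ _ _ _ _ i1 i2 => exact i1.trans _ _ _ i2
    have := this _ _ (S.conn (ι e) (ι e'))
    rwa [hqι, hqι] at this
  · intro A _ α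
    obtain ⟨U, hU1, hU2⟩ := S.coch A (α ∘ q)
    have key : ∀ s e, U s (ι (q e)) = U s e := by
      rintro s ⟨g, k⟩
      by_cases h : k = j
      · subst h
        have h1 : U t (g * b⁻¹ * a, i) = U t (g, k) := by
          have := eqvGen_inv (hU1 t) (S.eqvG t (g * b⁻¹) hr)
          simpa using this
        have h2 : α (q (g * b⁻¹ * a, i)) = α (q (g, k)) := by
          rw [hqj, hqn _ _ hne]
        have h3 := hU2 (g * b⁻¹ * a, i)
        have h4 := hU2 (g, k)
        simp only [Function.comp] at h3 h4
        rw [h2, h4] at h3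
        rw [hqj]
        show U s (g * b⁻¹ * a, i) = _
        cases t with
        | true =>
          rw [h1] at h3
          cases s with
          | true => exact h1
          | false => exact (mul_left_cancel h3).symm
        | false =>
          rw [h1] at h3
          cases s with
          | false => exact h1
          | true => exact (inv_injective (mul_right_cancel h3)).symm
      · rw [hqn _ _ h]
    refine ⟨fun s e => U s (ι e), ?_, ?_⟩
    · rintro s _ _ ⟨e, e', h, rfl, rfl⟩
      simp only [key]
      exact hU1 _ _ _ h
    · intro e
      have := hU2 (ι e)
      simpa only [Function.comp, hqι] using this

/-- reduced paths -/
inductive Red (S : GS H ψ I) : Bool → F × I → F × I → Prop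
  | nil (t : Bool) (e : F × I) : Red S t e e
  | cons (t : Bool) (e e1 e2 : F × I) : Relation.EqvGen (S.r t) e e1 →
      ψ e.1 * S.p e.2 ≠ ψ e1.1 * S.p e1.2 → Red S (!t) e1 e2 → Red S t e e2

theorem Red.transl {S : GS H ψ I} {t : Bool} {e e' : F × I} (h : Red S t e e') (g : F) :
    Red S t (g * e.1, e.2) (g * e'.1, e'.2) := by
  induction h with
  | nil t e => exact .nil _ _
  | cons t e e1 e2 h1 h2 h3 ih =>
    refine .cons _ _ _ _ (S.eqvG t g h1) ?_ ih
    intro h4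
    apply h2
    simp only [map_mul, mul_assoc] at h4
    exact mul_left_cancel h4

theorem Red.rw {S : GS H ψ I} {t : Bool} {e e' : F × I} (h : Red S t e e') :
    e = e' ∨ RW H t ((ψ e.1 * S.p e.2)⁻¹ * (ψ e'.1 * S.p e'.2)) := by
  induction h with
  | nil t e => exact .inl rfl
  | cons t e e1 e2 h1 h2 h3 ih =>
    right
    have h4 : (ψ e.1 * S.p e.2)⁻¹ * (ψ e1.1 * S.p e1.2) ≠ 1 := by
      intro h5
      exact h2 (inv_mul_eq_one.1 h5)
    rcases ih with rfl | ih
    · exact .single _ _ (S.hpG t h1) h4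
    · have := RW.cons _ _ _ (S.hpG t h1) h4 ih
      convert this using 1
      group

theorem GS.red (S : GS H ψ I)
    (hnf : ∀ t e e', Relation.EqvGen (S.r t) e e' → ψ e.1 * S.p e.2 = ψ e'.1 * S.p e'.2 →
      e.2 = e'.2) (e e' : F × I) : ∃ g, ψ g = 1 ∧ ∃ t, Red S t e (g * e'.1, e'.2) := by
  have hnf' : ∀ t e e', Relation.EqvGen (S.r t) e e' →
      ψ e.1 * S.p e.2 = ψ e'.1 * S.p e'.2 → ∃ g, ψ g = 1 ∧ e = (g * e'.1, e'.2) := by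
    intro t e e' h1 h2
    have h3 := hnf t e e' h1 h2
    refine ⟨e.1 * e'.1⁻¹, ?_, ?_⟩
    · rw [h3] at h2
      rw [map_mul, map_inv, mul_right_cancel h2, mul_inv_cancel]
    · ext <;> simp [h3]
  have step : ∀ t e e1, Relation.EqvGen (S.r t) e e1 →
      (∃ g, ψ g = 1 ∧ ∃ s, Red S s e1 (g * e'.1, e'.2)) →
      ∃ g, ψ g = 1 ∧ ∃ s, Red S s e (g * e'.1, e'.2) := by
    intro t e e1 h1
    rintro ⟨g, hg, s, hs⟩
    by_cases h2 : ψ e.1 * S.p e.2 = ψ e1.1 * S.p e1.2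
    · obtain ⟨g', hg', rfl⟩ := hnf' t e e1 h1 h2
      refine ⟨g' * g, by rw [map_mul, hg, hg', one_mul], s, ?_⟩
      have := hs.transl g'
      simpa only [mul_assoc] using this
    · by_cases hst : s = !t
      · subst hst
        exact ⟨g, hg, t, .cons _ _ _ _ h1 h2 hs⟩
      · have hst : s = t := by revert hst; cases s <;> cases t <;> simp
        subst hst
        generalize hE : (g * e'.1, e'.2) = E at hs
        cases hs with
        | nil => subst hE; exact ⟨g, hg, s, .cons _ _ _ _ h1 h2 (.nil _ _)⟩
        | cons _ _ e2 _ h3 h4 h5 =>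
          subst hE
          have h6 := h1.trans _ _ _ h3
          by_cases h7 : ψ e.1 * S.p e.2 = ψ e2.1 * S.p e2.2
          · obtain ⟨g', hg', rfl⟩ := hnf' s e e2 h6 h7
            refine ⟨g' * g, by rw [map_mul, hg, hg', one_mul], !s, ?_⟩
            have := h5.transl g'
            simpa only [mul_assoc] using this
          · exact ⟨g, hg, s, .cons _ _ _ _ h6 h7 h5⟩
  have : ∀ c d, Relation.EqvGen (fun a b => ∃ t, S.r t a b) c d →
      ((∃ g, ψ g = 1 ∧ ∃ s, Red S s c (g * e'.1, e'.2)) ↔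
      ∃ g, ψ g = 1 ∧ ∃ s, Red S s d (g * e'.1, e'.2)) := by
    intro c d h
    induction h with
    | rel x y h1 =>
      obtain ⟨t, h1⟩ := h1
      exact ⟨step t _ _ (.symm _ _ (.rel _ _ h1)), step t _ _ (.rel _ _ h1)⟩
    | refl => rfl
    | symm _ _ _ ih => exact ih.symm
    | trans _ _ _ _ _ i1 i2 => exact i1.trans i2
  rw [this _ _ (S.conn e e')]
  exact ⟨1, map_one _, true, by rw [one_mul]; exact .nil _ _⟩

theorem GS.noFold (S : GS H ψ I) (hsurj : Function.Surjective ψ) (hH : ∀ t w, RW H t w → w ≠ 1)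
    (hnf : ∀ t e e', Relation.EqvGen (S.r t) e e' → ψ e.1 * S.p e.2 = ψ e'.1 * S.p e'.2 →
      e.2 = e'.2) (i j : I) : i = j := by
  obtain ⟨g, hg⟩ := hsurj (S.p i * (S.p j)⁻¹)
  obtain ⟨g', hg', t, h⟩ := S.red hnf (1, i) (g, j)
  rcases h.rw with h | h
  · exact congrArg Prod.snd h
  · exfalso
    apply hH _ _ h
    simp [hg', hg]

theorem GS.final (S : GS H ψ I) (hsurj : Function.Surjective ψ) (i : I) (hi : ∀ j, j = i) :
    ∃ Q : Bool → Subgroup F, (∀ t, ∀ g ∈ Q t, ψ g ∈ H t) ∧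
      Subgroup.closure (⋃ t, (Q t : Set F)) = ⊤ ∧
      ∀ (A : Type) [Group A] (f : ∀ t, Q t →* A), ∃ φ : F →* A, ∀ t (s : Q t), φ s = f t s := by
  obtain ⟨a, ha⟩ := hsurj (S.p i)⁻¹
  have ha : ψ a * S.p i = 1 := by rw [ha, inv_mul_cancel]
  let Q : Bool → Subgroup F := fun t =>
    { carrier := {g | Relation.EqvGen (S.r t) (a, i) (g * a, i)}
      one_mem' := by
        rw [Set.mem_ofPred_eq, one_mul]; exact .refl _
      mul_mem' := by
        intro g g' h h'
        rw [Set.mem_ofPred_eq] at *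
        refine h.trans _ _ _ ?_
        have := S.eqvG t g h'
        simpa only [mul_assoc] using this
      inv_mem' := by
        intro g h
        rw [Set.mem_ofPred_eq] at *
        have := S.eqvG t g⁻¹ h
        simp only [inv_mul_cancel_left] at this
        exact this.symm }
  have hQ : ∀ t g, g ∈ Q t ↔ Relation.EqvGen (S.r t) (a, i) (g * a, i) := fun t g => Iff.rfl
  have hQr : ∀ t e e', Relation.EqvGen (S.r t) e e' → (e.1 * a⁻¹)⁻¹ * (e'.1 * a⁻¹) ∈ Q t := by
    rintro t ⟨e, k⟩ ⟨e', k'⟩ h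
    rw [hQ]
    have := S.eqvG t (a * e⁻¹) h
    rw [hi k, hi k'] at this
    convert this using 2
    · simp
    · group
  have hcl : Subgroup.closure (⋃ t, (Q t : Set F)) = ⊤ := by
    rw [eq_top_iff]
    intro g _
    have : ∀ e e', Relation.EqvGen (fun a b => ∃ t, S.r t a b) e e' →
        (e.1 * a⁻¹)⁻¹ * (e'.1 * a⁻¹) ∈ Subgroup.closure (⋃ t, (Q t : Set F)) := by
      intro e e' h
      induction h with
      | rel x y h1 =>
        obtain ⟨t, h1⟩ := h1
        exact Subgroup.subset_closure (Set.mem_iUnion.2 ⟨t, hQr t _ _ (.rel _ _ h1)⟩)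
      | refl => simp
      | symm _ _ _ ih =>
        have := Subgroup.inv_mem _ ih
        rwa [mul_inv_rev, inv_inv] at this
      | trans _ _ _ _ _ i1 i2 =>
        have := Subgroup.mul_mem _ i1 i2
        convert this using 1
        group
    have := this _ _ (S.conn (a, i) (g * a, i))
    simpa using this
  refine ⟨Q, ?_, hcl, ?_⟩
  · intro t g hg
    have := S.hpG t hg
    simp only [map_mul, mul_assoc, ha] at this
    simpa using this
  · intro A _ f
    have htr : ∀ t, ∃ τ : F → A, ∀ g (s : Q t), τ (g * s) = τ g * f t s := by
      intro t
      have h1 : ∀ g : F, ((Quotient.out (g : F ⧸ Q t))⁻¹ * g) ∈ Q t := fun g =>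
        QuotientGroup.eq.1 (by simp)
      refine ⟨fun g => f t ⟨_, h1 g⟩, ?_⟩
      intro g s
      rw [← map_mul]
      refine congrArg (f t) (Subtype.ext ?_)
      have h2 : ((g * s : F) : F ⧸ Q t) = (g : F ⧸ Q t) := by
        rw [QuotientGroup.mk_mul_of_mem _ s.2]
      simp only [h2, Subgroup.coe_mul, mul_assoc]
    choose τ hτ using htr
    obtain ⟨U, hU1, hU2⟩ := S.coch A (fun e => τ true (e.1 * a⁻¹) * (τ false (e.1 * a⁻¹))⁻¹)
    set fn : F → A := fun g => U true (g * a, i) * τ true g with hfn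
    have hfn' : ∀ g, fn g = U false (g * a, i) * τ false g := by
      intro g
      have := hU2 (g * a, i)
      simp only [mul_inv_cancel_right] at this
      rw [hfn]
      simp only
      rw [mul_inv_eq_iff_eq_mul] at this
      rw [this]
      group
    have hmul : ∀ t g (s : Q t), fn (g * s) = fn g * f t s := by
      intro t g s
      have h1 : U t (g * a, i) = U t (g * s * a, i) := by
        have := eqvGen_inv (hU1 t) (S.eqvG t g ((hQ t s).1 s.2))
        simpa only [mul_assoc] using this
      cases t with
      | true => simp only [hfn]; rw [hτ, ← h1, mul_assoc]
      | false => rw [hfn', hfn', hτ, ← h1, mul_assoc]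
    have hhom : ∀ g ∈ Subgroup.closure (⋃ t, (Q t : Set F)), ∀ x,
        fn (x * g) = fn x * ((fn 1)⁻¹ * fn g) := by
      intro g hg
      induction hg using Subgroup.closure_induction with
      | mem y hy =>
        obtain ⟨t, ht⟩ := Set.mem_iUnion.1 hy
        intro x
        have h1 := hmul t x ⟨y, ht⟩
        have h2 := hmul t 1 ⟨y, ht⟩
        simp only [one_mul] at h1 h2
        rw [h1, h2]; group
      | one => intro x; simp
      | mul y z _ _ hy hz =>
        intro x
        rw [← mul_assoc, hz, hy, hz y]; group
      | inv y _ hy =>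
        intro x
        have h1 := hy (x * y⁻¹)
        have h2 := hy y⁻¹
        rw [inv_mul_cancel_right] at h1
        rw [inv_mul_cancel] at h2
        rw [← mul_inv_eq_iff_eq_mul] at h1 h2
        rw [← h1, ← h2]; group
    refine ⟨MonoidHom.mk' (fun g => (fn 1)⁻¹ * fn g) ?_, ?_⟩
    · intro x y
      rw [hhom y (by rw [hcl]; trivial)]; group
    · intro t s
      show (fn 1)⁻¹ * fn s = _
      have := hmul t 1 s
      rw [one_mul] at this
      rw [this]; group

theorem GS.main (hsurj : Function.Surjective ψ) (hH : ∀ t w, RW H t w → w ≠ 1) (N : ℕ) :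
    ∀ (I : Type) [Finite I] [Nonempty I] (_ : Nat.card I = N) (_ : GS H ψ I),
    ∃ Q : Bool → Subgroup F, (∀ t, ∀ g ∈ Q t, ψ g ∈ H t) ∧
      Subgroup.closure (⋃ t, (Q t : Set F)) = ⊤ ∧
      ∀ (A : Type) [Group A] (f : ∀ t, Q t →* A), ∃ φ : F →* A, ∀ t (s : Q t), φ s = f t s := by
  induction N using Nat.strong_induction_on with
  | _ N ih =>
    intro I _ _ hc S
    by_cases hnf : ∀ t e e', Relation.EqvGen (S.r t) e e' →
      ψ e.1 * S.p e.2 = ψ e'.1 * S.p e'.2 → e.2 = e'.2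
    · obtain ⟨i⟩ := (inferInstance : Nonempty I)
      exact S.final hsurj i fun j => S.noFold hsurj hH hnf j i
    · push Not at hnf
      obtain ⟨t, ⟨a, i⟩, ⟨b, j⟩, h1, h2, h3⟩ := hnf
      obtain ⟨S'⟩ := S.fold h3 t h1 h2
      have : Nonempty {k // k ≠ j} := ⟨⟨i, h3⟩⟩
      refine ih (Nat.card {k // k ≠ j}) ?_ _ rfl S'
      rw [← hc]
      exact Finite.card_subtype_lt (p := fun k => k ≠ j) (x := j) (by simp)

end
end OR

namespace OR
section
open scoped Classical
variable {X : Type} {P : Type} [Group P] {H : Bool → Subgroup P}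

theorem free_prim {A : Type} [Group A] (β : FreeGroup X → X → A) :
    ∃ u : FreeGroup X → A, ∀ g x, u (g * FreeGroup.of x) = u g * β g x := by
  let σ : X → Equiv.Perm (FreeGroup X × A) := fun x =>
    { toFun := fun e => (e.1 * FreeGroup.of x, e.2 * β e.1 x)
      invFun := fun e => (e.1 * (FreeGroup.of x)⁻¹, e.2 * (β (e.1 * (FreeGroup.of x)⁻¹) x)⁻¹)
      left_inv := by rintro ⟨a, b⟩; simp
      right_inv := by rintro ⟨a, b⟩; simp }
  let Φ : FreeGroup X →* (Equiv.Perm (FreeGroup X × A))ᵐᵒᵖ :=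
    FreeGroup.lift fun x => MulOpposite.op (σ x)
  have hΦx : ∀ x, (Φ (FreeGroup.of x)).unop = σ x := by intro x; simp [Φ]
  have h1 : ∀ g e, ((Φ g).unop e).1 = e.1 * g := by
    intro g
    induction g using FreeGroup.induction_on with
    | C1 => intro e; simp
    | of x => intro e; rw [hΦx]; rfl
    | inv_of x _ =>
      intro e
      rw [map_inv, MulOpposite.unop_inv, hΦx]; rfl
    | mul x y hx hy =>
      intro e
      rw [map_mul, MulOpposite.unop_mul, Equiv.Perm.mul_apply, hy, hx, mul_assoc]
  refine ⟨fun g => ((Φ g).unop (1, 1)).2, ?_⟩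
  intro g x
  simp only
  rw [map_mul, MulOpposite.unop_mul, Equiv.Perm.mul_apply, hΦx]
  show ((Φ g).unop (1, 1)).2 * β ((Φ g).unop (1, 1)).1 x = _
  rw [h1, one_mul]

/-- adjacency in the subdivided Cayley tree -/
inductive InitR (m : X → ℕ) (t : X → ℕ → Bool) : Bool →
    FreeGroup X × Option (Σ x : X, Fin (m x + 1)) →
    FreeGroup X × Option (Σ x : X, Fin (m x + 1)) → Prop
  | start (g : FreeGroup X) (x : X) : InitR m t true (g, none) (g, some ⟨x, ⟨0, by omega⟩⟩)
  | mid (g : FreeGroup X) (x : X) (i : ℕ) (h : i < m x) :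
      InitR m t (t x i) (g, some ⟨x, ⟨i, by omega⟩⟩) (g, some ⟨x, ⟨i + 1, by omega⟩⟩)
  | halt (g : FreeGroup X) (x : X) :
      InitR m t true (g, some ⟨x, ⟨m x, by omega⟩⟩) (g * FreeGroup.of x, none)

/-- position in the target -/
def initP {m : X → ℕ} (s : X → ℕ → P) : Option (Σ x : X, Fin (m x + 1)) → P
  | none => 1
  | some ⟨x, i⟩ => s x i

/-- cochain solution -/
def initU {m : X → ℕ} {A : Type} [Group A] (u : FreeGroup X → A) (b : FreeGroup X → X → ℕ → A) :
    FreeGroup X × Option (Σ x : X, Fin (m x + 1)) → A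
  | (g, none) => u g
  | (g, some ⟨x, i⟩) => u g * b g x i

/-- subdivided Cayley tree -/
theorem GS.start [Finite X] (ψ : FreeGroup X →* P)
    (hgen : Subgroup.closure (⋃ t, (H t : Set P)) = ⊤) :
    ∃ (I : Type) (_ : Finite I) (_ : Nonempty I), Nonempty (GS H ψ I) := by
  have hw0 : ∀ y ∈ Subgroup.closure (⋃ t, (H t : Set P)), ∃ (m : ℕ) (t : ℕ → Bool) (s : ℕ → P),
      s 0 = 1 ∧ s m = y ∧ ∀ i < m, (s i)⁻¹ * s (i + 1) ∈ H (t i) := by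
    have one : ∃ (m : ℕ) (t : ℕ → Bool) (s : ℕ → P),
      s 0 = 1 ∧ s m = 1 ∧ ∀ i < m, (s i)⁻¹ * s (i + 1) ∈ H (t i) :=
      ⟨0, fun _ => true, fun _ => 1, rfl, rfl, by simp⟩
    have step : ∀ y z t, z ∈ H t → (∃ (m : ℕ) (t : ℕ → Bool) (s : ℕ → P),
      s 0 = 1 ∧ s m = y ∧ ∀ i < m, (s i)⁻¹ * s (i + 1) ∈ H (t i)) →
      ∃ (m : ℕ) (t : ℕ → Bool) (s : ℕ → P),
      s 0 = 1 ∧ s m = y * z ∧ ∀ i < m, (s i)⁻¹ * s (i + 1) ∈ H (t i) := by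
      rintro y z t₀ hz ⟨m, t, s, h0, h1, h2⟩
      refine ⟨m + 1, fun i => if i < m then t i else t₀, fun i => if i ≤ m then s i else y * z,
        by simp [h0], by simp, ?_⟩
      intro i hi
      by_cases him : i < m
      · simp only [him, him.le, Nat.succ_le_of_lt him, if_true]
        exact h2 i him
      · have : i = m := by omega
        subst this
        simp [h1, hz]
    intro y hy
    induction hy using Subgroup.closure_induction_right with
    | one => exact one
    | mul_right y hy z hz ih =>
      obtain ⟨t, hz⟩ := Set.mem_iUnion.1 hz
      exact step _ _ t hz ih
    | mul_inv_cancel y hy z hz ih =>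
      obtain ⟨t, hz⟩ := Set.mem_iUnion.1 hz
      exact step _ _ t ((H t).inv_mem hz) ih
  have hw : ∀ x : X, ∃ (m : ℕ) (t : ℕ → Bool) (s : ℕ → P), s 0 = 1 ∧ s m = ψ (FreeGroup.of x) ∧
      ∀ i < m, (s i)⁻¹ * s (i + 1) ∈ H (t i) := fun x => hw0 _ (by rw [hgen]; trivial)
  choose m t s hs0 hsm hst using hw
  refine ⟨Option (Σ x : X, Fin (m x + 1)), inferInstance, inferInstance,
    ⟨{ p := initP s
       r := InitR m t
       eqv := ?_
       hp := ?_
       conn := ?_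
       coch := ?_ }⟩⟩
  · intro t' g e e' h
    cases h with
    | start g' x => exact .start _ _
    | mid g' x i h => exact .mid _ _ _ h
    | halt g' x => rw [← mul_assoc]; exact .halt _ _
  · intro t' e e' h
    cases h with
    | start g' x => simp [initP, hs0]
    | mid g' x i h => simpa [initP, mul_assoc] using hst x i h
    | halt g' x => simp [initP, hsm]
  · have h1 : ∀ g x i (h : i < m x + 1), Relation.EqvGen (fun a b => ∃ t', InitR m t t' a b)
        (g, none) (g, some ⟨x, ⟨i, h⟩⟩) := by
      intro g x i
      induction i with
      | zero => exact fun h => .rel _ _ ⟨_, .start _ _⟩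
      | succ i ih =>
        exact fun h => (ih (by omega)).trans _ _ _ (.rel _ _ ⟨_, .mid _ _ _ (by omega)⟩)
    have h2 : ∀ g x, Relation.EqvGen (fun a b => ∃ t', InitR m t t' a b)
        (g, none) (g * FreeGroup.of x, none) := fun g x =>
      (h1 g x (m x) (by omega)).trans _ _ _ (.rel _ _ ⟨_, .halt _ _⟩)
    have h3 : ∀ g g', Relation.EqvGen (fun a b => ∃ t', InitR m t t' a b)
        (g', none) (g' * g, none) := by
      intro g
      induction g using FreeGroup.induction_on with
      | C1 => intro e; rw [mul_one]; exact .refl _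
      | of x => exact fun g => h2 g x
      | inv_of x _ =>
        intro e
        have := h2 (e * (FreeGroup.of x)⁻¹) x
        rw [inv_mul_cancel_right] at this
        exact this.symm
      | mul x y hx hy =>
        intro e
        rw [← mul_assoc]
        exact (hx _).trans _ _ _ (hy _)
    have h4 : ∀ e, Relation.EqvGen (fun a b => ∃ t', InitR m t t' a b) (1, none) e := by
      rintro ⟨g, _ | ⟨x, i, hi⟩⟩
      · have := h3 g 1
        rwa [one_mul] at this
      · have := h3 g 1
        rw [one_mul] at this
        exact this.trans _ _ _ (h1 _ _ _ _)
    exact fun e e' => (h4 e).symm.trans _ _ _ (h4 e')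
  · intro A _ α
    set α' : FreeGroup X → X → ℕ → A := fun g x i =>
      if h : i < m x + 1 then α (g, some ⟨x, ⟨i, h⟩⟩) else 1 with hα'
    have hα : ∀ g x i (h : i < m x + 1), α (g, some ⟨x, ⟨i, h⟩⟩) = α' g x i := by
      intro g x i h
      rw [hα']; simp only; rw [dif_pos h]
    let b : FreeGroup X → X → ℕ → A := fun g x i =>
      Nat.rec (1 : A) (fun i b => if t x i then b else b * α' g x i * (α' g x (i + 1))⁻¹) i
    have hb : ∀ g x i, b g x (i + 1) =
      if t x i then b g x i else b g x i * α' g x i * (α' g x (i + 1))⁻¹ := fun g x i => rfl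
    have hb0 : ∀ g x, b g x 0 = 1 := fun g x => rfl
    obtain ⟨u, hu⟩ := free_prim (fun g x => b g x (m x))
    refine ⟨fun t' e => if t' then initU u b e else initU u b e * α e, ?_, ?_⟩
    · intro t' e e' h
      cases h with
      | start g' x => simp [initU, hb0]
      | mid g' x i h =>
        cases ht : t x i with
        | true => simp [initU, hb, ht]
        | false => simp [initU, hb, ht, hα, mul_assoc]
      | halt g' x => simp [initU, hu]
    · intro e
      simp

theorem grushko [Finite X] (ψ : FreeGroup X →* P)
    (hgen : Subgroup.closure (⋃ t, (H t : Set P)) = ⊤)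
    (hsurj : Function.Surjective ψ) (hH : ∀ t w, RW H t w → w ≠ 1) :
    ∃ Q : Bool → Subgroup (FreeGroup X), (∀ t, ∀ g ∈ Q t, ψ g ∈ H t) ∧
      Subgroup.closure (⋃ t, (Q t : Set (FreeGroup X))) = ⊤ ∧
      ∀ (A : Type) [Group A] (f : ∀ t, Q t →* A),
        ∃ φ : FreeGroup X →* A, ∀ t (s : Q t), φ s = f t s := by
  obtain ⟨I, _, _, ⟨S⟩⟩ := GS.start ψ hgen
  exact GS.main hsurj hH _ I rfl S
end
end OR

namespace OR
section
open scoped Classical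
variable {X : Type} {R : FreeGroup X} {n : ℕ} {G : Type} [Group G] {π : FreeGroup X →* G}

theorem lift_surj {F G K : Type*} [Group F] [Group G] [Group K] {π : F →* G}
    (hs : Function.Surjective π) (ρ : F →* K) (h : ∀ g, π g = 1 → ρ g = 1) :
    ∃ σ : G →* K, ∀ g, σ (π g) = ρ g :=
  ⟨π.liftOfSurjective hs ⟨ρ, fun g hg => h g hg⟩,
    fun g => MonoidHom.liftOfRightInverse_comp_apply _ _ _ _ g⟩

theorem ncl_le {F : Type*} [Group F] {K : Subgroup F} [K.Normal] {a : F} (h : a ∈ K) :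
    Subgroup.normalClosure {a} ≤ K := by
  apply Subgroup.normalClosure_le_normal
  rintro _ rfl
  exact h

theorem ncl_self {F : Type*} [Group F] (a : F) : a ∈ Subgroup.normalClosure {a} :=
  Subgroup.subset_normalClosure (Set.mem_singleton a)

theorem ncl_conj {F : Type*} [Group F] (a g : F) :
    Subgroup.normalClosure {g * a * g⁻¹} = Subgroup.normalClosure {a} := by
  apply le_antisymm
  · exact ncl_le (Subgroup.normalClosure_normal.conj_mem _ (ncl_self a) g)
  · apply ncl_le
    have := Subgroup.normalClosure_normal.conj_mem _ (ncl_self (g * a * g⁻¹)) g⁻¹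
    have h2 : g⁻¹ * (g * a * g⁻¹) * g⁻¹⁻¹ = a := by group
    rwa [h2] at this

theorem ncl_pow {F : Type*} [Group F] (a : F) (k : ℕ) :
    Subgroup.normalClosure {a ^ k} ≤ Subgroup.normalClosure {a} :=
  ncl_le (Subgroup.pow_mem _ (ncl_self a) k)

theorem Pres.conj (h : Pres R n π) (g : FreeGroup X) : Pres (g * R * g⁻¹) n π where
  np := h.np.conj g
  pos := h.pos
  surj := h.surj
  ker := fun w => by rw [conj_pow, ncl_conj, h.ker]

theorem NotPow.equiv {F F' : Type*} [Group F] [Group F'] {a : F} (h : NotPow a) (θ : F' ≃* F) :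
    NotPow (θ.symm a) := by
  intro S k hk he
  apply h (θ S) k hk
  rw [← map_pow, ← he]; simp

theorem ncl_equiv {F F' : Type*} [Group F] [Group F'] (a w : F') (θ : F' ≃* F) :
    θ w ∈ Subgroup.normalClosure {θ a} ↔ w ∈ Subgroup.normalClosure {a} := by
  have : Subgroup.normalClosure {θ a} = (Subgroup.normalClosure {a}).map θ.toMonoidHom := by
    rw [Subgroup.map_normalClosure _ _ θ.surjective, Set.image_singleton]; rfl
  rw [this]
  exact Subgroup.mem_map_iff_mem (f := θ.toMonoidHom) θ.injective

theorem Pres.equiv (h : Pres R n π) {Y : Type} (θ : FreeGroup Y ≃* FreeGroup X) :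
    Pres (θ.symm R) n (π.comp θ.toMonoidHom) where
  np := h.np.equiv θ
  pos := h.pos
  surj := h.surj.comp θ.surjective
  ker := fun w => by
    show π (θ w) = 1 ↔ _
    rw [h.ker, ← map_pow, ← ncl_equiv _ _ θ]; simp

theorem Pres.std (hR : NotPow R) (hn : 0 < n) : Pres R n (PresentedGroup.mk {R ^ n}) where
  np := hR
  pos := hn
  surj := PresentedGroup.mk_surjective _
  ker := fun _ => PresentedGroup.mk_eq_one_iff

/-- if a letter is missing then the group decomposes -/
theorem Pres.missing (h : Pres R n π) (hn : 1 < n) (S : Set X) (hS : ∃ y, y ∉ S)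
    (hR : R ∈ Subgroup.closure (FreeGroup.of '' S)) : FreelyDecomposable G := by
  obtain ⟨y₀, hy₀⟩ := hS
  have hR0 : ∃ R0 : FreeGroup S, FreeGroup.lift (fun s : S => FreeGroup.of s.1) R0 = R := by
    have : R ∈ (FreeGroup.lift (fun s : S => FreeGroup.of s.1)).range := by
      refine (Subgroup.closure_le _).2 ?_ hR
      rintro _ ⟨s, hs, rfl⟩
      exact ⟨FreeGroup.of ⟨s, hs⟩, by simp⟩
    exact this
  obtain ⟨R0, hR0⟩ := hR0
  have hnp : NotPow R0 := by
    intro a k hk he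
    apply h.np (FreeGroup.lift (fun s : S => FreeGroup.of s.1) a) k hk
    rw [← map_pow, ← he, hR0]
  have h0 : Pres R0 n (PresentedGroup.mk {R0 ^ n}) := Pres.std hnp h.pos
  refine ⟨PresentedGroup {R0 ^ n}, FreeGroup {y // y ∉ S}, inferInstance, inferInstance,
    ⟨PresentedGroup.mk {R0 ^ n} R0, 1, ?_⟩, ⟨FreeGroup.of ⟨y₀, hy₀⟩, 1, FreeGroup.of_ne_one _⟩, ?_⟩
  · intro he
    have := h0.ord
    rw [he, orderOf_one] at this
    omega
  · let ρ : FreeGroup X →* Monoid.Coprod (PresentedGroup {R0 ^ n}) (FreeGroup {y // y ∉ S}) :=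
      FreeGroup.lift fun y => if hy : y ∈ S then Monoid.Coprod.inl (PresentedGroup.mk _ (FreeGroup.of ⟨y, hy⟩))
        else Monoid.Coprod.inr (FreeGroup.of ⟨y, hy⟩)
    have hρ1 : ρ.comp (FreeGroup.lift (fun s : S => FreeGroup.of s.1)) =
        Monoid.Coprod.inl.comp (PresentedGroup.mk {R0 ^ n}) := by
      ext s
      simp [ρ]
    have hρR : ρ (R ^ n) = 1 := by
      have := DFunLike.congr_fun hρ1 (R0 ^ n)
      rw [MonoidHom.comp_apply, MonoidHom.comp_apply, map_pow, hR0] at this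
      rw [this, (h0.ker _).2 (ncl_self _), map_one]
    obtain ⟨f, hf⟩ := lift_surj h.surj ρ (by
      intro g hg
      rw [h.ker] at hg
      exact ncl_le (K := ρ.ker) hρR hg)
    obtain ⟨g1, hg1⟩ := lift_surj h0.surj (π.comp (FreeGroup.lift (fun s : S => FreeGroup.of s.1))) (by
      intro g hg
      rw [h0.ker] at hg
      refine ncl_le (K := (π.comp (FreeGroup.lift (fun s : S => FreeGroup.of s.1))).ker) ?_ hg
      rw [MonoidHom.mem_ker, MonoidHom.comp_apply, map_pow, hR0, h.ker]
      exact ncl_self _)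
    let g2 : FreeGroup {y // y ∉ S} →* G := FreeGroup.lift fun y => π (FreeGroup.of y.1)
    let g := Monoid.Coprod.lift g1 g2
    refine ⟨MonoidHom.toMulEquiv f g ?_ ?_⟩
    · have : (g.comp f).comp π = (MonoidHom.id G).comp π := by
        ext y
        simp only [MonoidHom.comp_apply, hf, MonoidHom.id_apply]
        by_cases hy : y ∈ S
        · simp [ρ, hy, g, hg1]
        · simp [ρ, hy, g, g2]
      ext x
      obtain ⟨w, rfl⟩ := h.surj x
      exact DFunLike.congr_fun this w
    · apply Monoid.Coprod.hom_ext
      · refine MonoidHom.ext fun x => ?_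
        obtain ⟨w, rfl⟩ := h0.surj x
        have := DFunLike.congr_fun hρ1 w
        simp only [MonoidHom.comp_apply, g, Monoid.Coprod.lift_apply_inl, hg1, hf] at this ⊢
        rw [this]; rfl
      · ext y
        simp [g, g2, hf, ρ, y.2]

theorem mk_mem_closure (l : List (X × Bool)) (S : Set X) (h : ∀ a ∈ l, a.1 ∈ S) :
    FreeGroup.mk l ∈ Subgroup.closure (FreeGroup.of '' S) := by
  induction l with
  | nil => exact Subgroup.one_mem _
  | cons a l ih =>
    have : FreeGroup.mk (a :: l) = FreeGroup.mk [a] * FreeGroup.mk l := by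
      rw [FreeGroup.mul_mk]; rfl
    rw [this]
    refine Subgroup.mul_mem _ ?_ (ih fun b hb => h b (List.mem_cons_of_mem _ hb))
    have h1 : FreeGroup.of a.1 ∈ Subgroup.closure (FreeGroup.of '' S) :=
      Subgroup.subset_closure ⟨_, h a List.mem_cons_self, rfl⟩
    obtain ⟨x, b⟩ := a
    cases b with
    | true => exact h1
    | false =>
      have := Subgroup.inv_mem _ h1
      rwa [FreeGroup.of, FreeGroup.inv_mk] at this

theorem Pres.finite (h : Pres R n π) (hn : 1 < n) (hd : ¬ FreelyDecomposable G) : Finite X := by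
  by_contra hX
  rw [not_finite_iff_infinite] at hX
  apply hd
  apply h.missing hn ((R.toWord.map Prod.fst).toFinset : Set X)
  · obtain ⟨y, hy⟩ := Infinite.exists_notMem_finset (R.toWord.map Prod.fst).toFinset
    exact ⟨y, hy⟩
  · have := mk_mem_closure R.toWord ((R.toWord.map Prod.fst).toFinset : Set X) (by
      intro a ha
      simp only [List.coe_toFinset, Set.mem_ofPred_eq]
      exact List.mem_map_of_mem ha)
    rwa [FreeGroup.mk_toWord] at this

theorem RW.of_gen {P : Type} [Group P] {H : Bool → Subgroup P}
    (hgen : Subgroup.closure (⋃ t, (H t : Set P)) = ⊤) (w : P) : w = 1 ∨ ∃ t, RW H t w := by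
  have step : ∀ t, ∀ s ∈ H t, ∀ w, (w = 1 ∨ ∃ t, RW H t w) → (s * w = 1 ∨ ∃ t, RW H t (s * w)) := by
    intro t s hs w hw
    by_cases hs1 : s = 1
    · subst hs1; rwa [one_mul]
    rcases hw with rfl | ⟨t', hw⟩
    · rw [mul_one]; exact .inr ⟨t, .single _ _ hs hs1⟩
    · by_cases htt : t' = !t
      · subst htt
        exact .inr ⟨t, .cons _ _ _ hs hs1 hw⟩
      · have htt : t' = t := by revert htt; cases t <;> cases t' <;> simp
        subst htt
        cases hw with
        | single _ _ h1 h2 =>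
          by_cases h3 : s * w = 1
          · exact .inl h3
          · exact .inr ⟨t', .single _ _ ((H t').mul_mem hs h1) h3⟩
        | cons _ a v h1 h2 h4 =>
          rw [← mul_assoc]
          by_cases h3 : s * a = 1
          · rw [h3, one_mul]; exact .inr ⟨_, h4⟩
          · exact .inr ⟨t', .cons _ _ _ ((H t').mul_mem hs h1) h3 h4⟩
  have hw : w ∈ Subgroup.closure (⋃ t, (H t : Set P)) := by rw [hgen]; trivial
  induction hw using Subgroup.closure_induction_left with
  | one => exact .inl rfl
  | mul_left a ha y hy ih =>
    obtain ⟨t, ha⟩ := Set.mem_iUnion.1 ha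
    exact step t a ha _ ih
  | inv_mul_cancel a ha y hy ih =>
    obtain ⟨t, ha⟩ := Set.mem_iUnion.1 ha
    exact step t _ ((H t).inv_mem ha) _ ih

theorem RW.map {F P : Type} [Group F] [Group P] {Q : Bool → Subgroup F} {H : Bool → Subgroup P}
    (ψ : F →* P) (h1 : ∀ t, ∀ g ∈ Q t, ψ g ∈ H t) (h2 : ∀ t, ∀ g ∈ Q t, ψ g = 1 → g = 1)
    {t : Bool} {w : F} (hw : RW Q t w) : RW H t (ψ w) := by
  induction hw with
  | single t s h3 h4 => exact .single _ _ (h1 _ _ h3) fun h => h4 (h2 _ _ h3 h)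
  | cons t s w h3 h4 _ ih =>
    rw [map_mul]
    exact .cons _ _ _ (h1 _ _ h3) (fun h => h4 (h2 _ _ h3 h)) ih

theorem Pres.decomp (h : Pres R n π) (hn : 1 < n) {P : Type} [Group P] {H : Bool → Subgroup P}
    (hgen : Subgroup.closure (⋃ t, (H t : Set P)) = ⊤) (hH : ∀ t w, RW H t w → w ≠ 1)
    (hnt : ∀ t, ∃ s ∈ H t, s ≠ 1) (ψ : FreeGroup X →* P) (hsurj : Function.Surjective ψ)
    {k : ℕ} (hk : 0 < k) (hker : ∀ g, ψ g = 1 ↔ g ∈ Subgroup.normalClosure {R ^ k}) :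
    FreelyDecomposable G := by
  by_contra hd
  have := h.finite hn hd
  obtain ⟨Q, hQ1, hQ2, hQ3⟩ := grushko ψ hgen hsurj hH
  let Y : Bool → Type := fun t => IsFreeGroup.Generators (Q t)
  let fwd : FreeGroup (Σ t, Y t) →* FreeGroup X :=
    FreeGroup.lift fun y => ((IsFreeGroup.of (G := Q y.1) y.2 : Q y.1) : FreeGroup X)
  obtain ⟨bwd, hbwd⟩ := hQ3 (FreeGroup (Σ t, Y t)) fun t =>
    IsFreeGroup.lift (fun y : Y t => FreeGroup.of (⟨t, y⟩ : Σ t, Y t))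
  have hfb : ∀ t, ∀ s : Q t, fwd (bwd s) = s := by
    intro t
    have : (fwd.comp bwd).comp (Q t).subtype = (Q t).subtype := by
      apply IsFreeGroup.ext_hom
      intro a
      simp only [MonoidHom.comp_apply, Subgroup.subtype_apply, hbwd, IsFreeGroup.lift_of]
      simp [fwd]
    exact fun s => DFunLike.congr_fun this s
  let θ : FreeGroup (Σ t, Y t) ≃* FreeGroup X := MonoidHom.toMulEquiv fwd bwd
    (by
      ext y
      simp only [MonoidHom.comp_apply, fwd, FreeGroup.lift_apply_of, hbwd, IsFreeGroup.lift_of,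
        MonoidHom.id_apply])
    (by
      apply MonoidHom.eq_of_eqOn_dense hQ2
      intro g hg
      obtain ⟨t, hg⟩ := Set.mem_iUnion.1 hg
      exact hfb t ⟨g, hg⟩)
  have hθ : ∀ w, θ.symm w = bwd w := fun w => rfl
  have hbQ : ∀ t, ∀ g ∈ Q t, bwd g ∈ Subgroup.closure (FreeGroup.of '' {y : Σ t, Y t | y.1 = t}) := by
    intro t g hg
    have h1 := hbwd t ⟨g, hg⟩
    simp only at h1
    rw [h1]
    have h2 : ∀ g : Q t, ∃ v : FreeGroup (Y t), FreeGroup.lift (fun y => IsFreeGroup.of (G := Q t) y) v = g := by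
      intro g
      refine ⟨IsFreeGroup.lift (fun y : Y t => FreeGroup.of y) g, ?_⟩
      have : (FreeGroup.lift (fun y => IsFreeGroup.of (G := Q t) y)).comp
          (IsFreeGroup.lift (fun y : Y t => FreeGroup.of y)) = MonoidHom.id _ := by
        apply IsFreeGroup.ext_hom
        intro a
        simp only [MonoidHom.comp_apply, IsFreeGroup.lift_of, FreeGroup.lift_apply_of,
          MonoidHom.id_apply]
      exact DFunLike.congr_fun this g
    obtain ⟨v, hv⟩ := h2 ⟨g, hg⟩
    rw [← hv]
    clear hv h1
    induction v using FreeGroup.induction_on with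
    | C1 => simp only [map_one]; exact Subgroup.one_mem _
    | of y =>
      rw [FreeGroup.lift_apply_of, IsFreeGroup.lift_of]
      exact Subgroup.subset_closure ⟨⟨t, y⟩, rfl, rfl⟩
    | inv_of y ih => simp only [map_inv]; exact Subgroup.inv_mem _ ih
    | mul x y ihx ihy => simp only [map_mul]; exact Subgroup.mul_mem _ ihx ihy
  obtain ⟨l, g, hl, hl0, hlR⟩ := exists_cyc (θ.symm R) (h.equiv θ).np.ne_one
  have hP := (h.equiv θ).conj g
  rw [← hlR] at hP
  by_cases hc : ∃ t, ∀ a ∈ l, a.1.1 = t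
  · obtain ⟨t, ht⟩ := hc
    apply hd
    apply hP.missing hn {y | y.1 = t}
    · by_contra hno
      push Not at hno
      have hsub : ∀ w, bwd w ∈ Subgroup.closure (FreeGroup.of '' {y : Σ t, Y t | y.1 = t}) := by
        intro w
        have : {y : Σ t, Y t | y.1 = t} = Set.univ := by
          ext y; simpa using hno y
        rw [this, Set.image_univ, FreeGroup.closure_range_of]
        trivial
      have hall : ∀ v ∈ Subgroup.closure (FreeGroup.of '' {y : Σ t, Y t | y.1 = t}), ψ (fwd v) ∈ H t := by
        intro v hv
        induction hv using Subgroup.closure_induction with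
        | mem v hv =>
          obtain ⟨⟨t', y⟩, hy, rfl⟩ := hv
          have hy : t' = t := hy
          subst hy
          simp only [fwd, FreeGroup.lift_apply_of]
          exact hQ1 _ _ (Subtype.prop _)
        | one => simp
        | mul a b _ _ ha hb => rw [map_mul, map_mul]; exact Subgroup.mul_mem _ ha hb
        | inv a _ ha => rw [map_inv, map_inv]; exact Subgroup.inv_mem _ ha
      obtain ⟨s, hs, hs1⟩ := hnt (!t)
      obtain ⟨w, rfl⟩ := hsurj s
      have h1 := hall _ (hsub w)
      have h2 : fwd (bwd w) = w := θ.apply_symm_apply w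
      rw [h2] at h1
      refine hH t (ψ w * (ψ w)⁻¹) ?_ (mul_inv_cancel _)
      exact .cons _ _ _ h1 hs1 (.single _ _ (Subgroup.inv_mem _ hs) (by simpa using hs1))
    · exact mk_mem_closure _ _ ht
  · push Not at hc
    have hinj : ∀ t, ∀ w ∈ Q t, ψ w = 1 → w = 1 := by
      intro t w hw hw1
      obtain ⟨a, ha, hat⟩ := hc t
      have h1 : bwd w = 1 := by
        refine freiheitssatz l hl hP.np a ha (bwd w) ?_ ?_
        · rw [hlR, ncl_conj, ← ncl_equiv _ _ θ, MulEquiv.apply_symm_apply, ← hθ,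
            MulEquiv.apply_symm_apply]
          exact ncl_pow _ _ ((hker w).1 hw1)
        · refine Subgroup.closure_mono ?_ (hbQ t w hw)
          apply Set.image_mono
          rintro y hy rfl
          exact hat hy
      have := hfb t ⟨w, hw⟩
      simp only [h1, map_one] at this
      exact this.symm
    have h1 : ψ (R ^ k) = 1 := (hker _).2 (ncl_self _)
    rcases RW.of_gen hQ2 (R ^ k) with h2 | ⟨t, h2⟩
    · exact h.np.ne_one (fg_pow_one hk h2)
    · exact hH t _ (h2.map ψ hQ1 hinj) h1

end
end OR

namespace OR
section
open scoped Classical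
variable {X : Type} {R : FreeGroup X} {n : ℕ} {G : Type} [Group G] {π : FreeGroup X →* G}

/-- reduced words in an amalgam: lists of labelled letters -/
def ARed (D : Bool → Subgroup G) (C : Subgroup G) (l : List (Bool × G)) : Prop :=
  (∀ p ∈ l, p.2 ∈ D p.1 ∧ p.2 ∉ C) ∧ l.IsChain (fun a b => a.1 ≠ b.1)

def apr (l : List (Bool × G)) : G := (l.map Prod.snd).prod

@[simp] theorem apr_nil : apr ([] : List (Bool × G)) = 1 := rfl
@[simp] theorem apr_cons (p : Bool × G) (l : List (Bool × G)) : apr (p :: l) = p.2 * apr l := by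
  simp [apr]
@[simp] theorem apr_append (l l' : List (Bool × G)) : apr (l ++ l') = apr l * apr l' := by
  simp [apr]

variable {D : Bool → Subgroup G} {C : Subgroup G}

theorem ARed.nil : ARed D C [] := ⟨by simp, by simp⟩

theorem ARed.cons_iff {p : Bool × G} {l : List (Bool × G)} :
    ARed D C (p :: l) ↔ (p.2 ∈ D p.1 ∧ p.2 ∉ C) ∧ (∀ q ∈ l.head?, p.1 ≠ q.1) ∧ ARed D C l := by
  unfold ARed
  rw [List.isChain_cons]
  simp only [List.mem_cons, forall_eq_or_imp]
  tauto

theorem ARed.append_iff {l l' : List (Bool × G)} :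
    ARed D C (l ++ l') ↔ ARed D C l ∧ ARed D C l' ∧
      (∀ p ∈ l.getLast?, ∀ q ∈ l'.head?, p.1 ≠ q.1) := by
  unfold ARed
  rw [List.isChain_append]
  simp only [List.mem_append, or_imp, forall_and]
  tauto

theorem ARed.single {t : Bool} {g : G} (h : g ∈ D t) (h' : g ∉ C) : ARed D C [(t, g)] :=
  ⟨by simpa using ⟨h, h'⟩, by simp⟩

def ainv (l : List (Bool × G)) : List (Bool × G) := (l.map (fun p => (p.1, p.2⁻¹))).reverse

theorem apr_ainv (l : List (Bool × G)) : apr (ainv l) = (apr l)⁻¹ := by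
  induction l with
  | nil => simp [ainv]
  | cons p l ih =>
    have : ainv (p :: l) = ainv l ++ [(p.1, p.2⁻¹)] := by simp [ainv]
    rw [this, apr_append, ih]; simp

theorem ARed.inv {l : List (Bool × G)} (h : ARed D C l) : ARed D C (ainv l) := by
  induction l with
  | nil => exact ARed.nil
  | cons p l ih =>
    have : OR.ainv (p :: l) = OR.ainv l ++ [(p.1, p.2⁻¹)] := by simp [OR.ainv]
    rw [ARed.cons_iff] at h
    rw [this, ARed.append_iff]
    refine ⟨ih h.2.2, ARed.single (inv_mem h.1.1) (fun hc => h.1.2 (by simpa using hc)), ?_⟩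
    intro q hq r hr
    simp only [List.head?_cons, Option.mem_def, Option.some.injEq] at hr
    subst hr
    simp only [OR.ainv, List.getLast?_reverse, List.head?_map, Option.mem_def,
      Option.map_eq_some_iff] at hq
    obtain ⟨a, ha, rfl⟩ := hq
    exact (h.2.1 a ha).symm

structure Amalg (D : Bool → Subgroup G) (C : Subgroup G) : Prop where
  le : ∀ t, C ≤ D t
  gen : Subgroup.closure (⋃ t, (D t : Set G)) = ⊤
  red : ∀ l, ARed D C l → l ≠ [] → apr l ∉ C
  univ : ∀ (A : Type) [Group A] (f : ∀ t, D t →* A),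
    (∀ x (hx : x ∈ C), f true ⟨x, le true hx⟩ = f false ⟨x, le false hx⟩) →
    ∃ φ : G →* A, ∀ t (x : D t), φ x = f t x

theorem absorb (hle : ∀ t, C ≤ D t) {l : List (Bool × G)} (h : ARed D C l) {c : G} (hc : c ∈ C) :
    ∃ l' c', ARed D C l' ∧ c' ∈ C ∧ l'.length = l.length ∧ c * apr l = apr l' * c' := by
  cases l with
  | nil => exact ⟨[], c, h, hc, rfl, by simp⟩
  | cons p l =>
    rw [ARed.cons_iff] at h
    refine ⟨(p.1, c * p.2) :: l, 1, ?_, one_mem _, by simp, by simp [mul_assoc]⟩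
    rw [ARed.cons_iff]
    exact ⟨⟨mul_mem (hle _ hc) h.1.1, fun hh => h.1.2 ((Subgroup.mul_mem_cancel_left _ hc).1 hh)⟩,
      h.2.1, h.2.2⟩

theorem nf_mul (hle : ∀ t, C ≤ D t) {l : List (Bool × G)} (h : ARed D C l) {t : Bool} {d : G}
    (hd : d ∈ D t) :
    ∃ l' c', ARed D C l' ∧ c' ∈ C ∧ d * apr l = apr l' * c' := by
  by_cases hdC : d ∈ C
  · obtain ⟨l', c', h1, h2, _, h3⟩ := absorb hle h hdC
    exact ⟨l', c', h1, h2, h3⟩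
  cases l with
  | nil => exact ⟨[(t, d)], 1, ARed.single hd hdC, one_mem _, by simp⟩
  | cons p l =>
    by_cases hp : t = p.1
    · subst hp
      have h0 := h
      rw [ARed.cons_iff] at h
      by_cases hc : d * p.2 ∈ C
      · obtain ⟨l', c', h1, h2, _, h3⟩ := absorb hle h.2.2 hc
        exact ⟨l', c', h1, h2, by rw [← h3]; simp [mul_assoc]⟩
      · refine ⟨(p.1, d * p.2) :: l, 1, ?_, one_mem _, by simp [mul_assoc]⟩
        rw [ARed.cons_iff]
        exact ⟨⟨mul_mem hd h.1.1, hc⟩, h.2.1, h.2.2⟩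
    · refine ⟨(t, d) :: p :: l, 1, ?_, one_mem _, by simp⟩
      rw [ARed.cons_iff]
      refine ⟨⟨hd, hdC⟩, ?_, h⟩
      simpa using hp

theorem nf (hle : ∀ t, C ≤ D t) {w : G} (hw : w ∈ Subgroup.closure (⋃ t, (D t : Set G))) :
    ∃ l c, ARed D C l ∧ c ∈ C ∧ w = apr l * c := by
  induction hw using Subgroup.closure_induction_left with
  | one => exact ⟨[], 1, ARed.nil, one_mem _, by simp⟩
  | mul_left x hx y hy ih =>
    obtain ⟨l, c, h1, h2, rfl⟩ := ih
    obtain ⟨t, ht⟩ := Set.mem_iUnion.1 hx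
    obtain ⟨l', c', h3, h4, h5⟩ := nf_mul hle h1 ht
    exact ⟨l', c' * c, h3, mul_mem h4 h2, by rw [← mul_assoc, h5, mul_assoc]⟩
  | inv_mul_cancel x hx y hy ih =>
    obtain ⟨l, c, h1, h2, rfl⟩ := ih
    obtain ⟨t, ht⟩ := Set.mem_iUnion.1 hx
    obtain ⟨l', c', h3, h4, h5⟩ := nf_mul hle h1 (inv_mem ht)
    exact ⟨l', c' * c, h3, mul_mem h4 h2, by rw [← mul_assoc, h5, mul_assoc]⟩

theorem Amalg.inf (h : Amalg D C) {t t' : Bool} (htt : t ≠ t') {x : G} (h1 : x ∈ D t)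
    (h2 : x ∈ D t') : x ∈ C := by
  by_contra hx
  apply h.red [(t, x⁻¹), (t', x)] ⟨?_, ?_⟩ (by simp)
  · simp
  · intro p hp
    simp only [List.mem_cons, List.not_mem_nil, or_false] at hp
    rcases hp with rfl | rfl
    · exact ⟨inv_mem h1, fun hh => hx (by simpa using hh)⟩
    · exact ⟨h2, hx⟩
  · simpa using htt

theorem Amalg.len2 (h : Amalg D C) {l : List (Bool × G)} (hl : ARed D C l) (h2 : 2 ≤ l.length)
    (t : Bool) : apr l ∉ D t := by
  intro hd
  match l, h2 with
  | p :: q :: l, _ =>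
    have hl0 := hl
    rw [ARed.cons_iff] at hl
    obtain ⟨⟨a1, a2⟩, a3, a4⟩ := hl
    by_cases htp : t = p.1
    · subst htp
      set d := apr (p :: q :: l) with hdd
      by_cases hc : d⁻¹ * p.2 ∈ C
      · apply h.red _ a4 (by simp)
        have : apr (q :: l) = (d⁻¹ * p.2)⁻¹ := by
          rw [hdd, apr_cons p]; group
        rw [this]; exact inv_mem hc
      · apply h.red ((p.1, d⁻¹ * p.2) :: q :: l) _ (by simp)
        · rw [apr_cons]
          simp only
          rw [mul_assoc, ← apr_cons p, ← hdd]; simp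
        · rw [ARed.cons_iff]
          exact ⟨⟨mul_mem (inv_mem hd) a1, hc⟩, a3, a4⟩
    · set d := apr (p :: q :: l) with hdd
      by_cases hc : d ∈ C
      · exact h.red _ hl0 (by simp) hc
      · apply h.red ((t, d⁻¹) :: p :: q :: l) _ (by simp)
        · rw [apr_cons, ← hdd]; simp
        · rw [ARed.cons_iff]
          refine ⟨⟨inv_mem hd, fun hh => hc (by simpa using hh)⟩, by simpa using htp, hl0⟩

theorem Amalg.nf' (h : Amalg D C) (w : G) : ∃ l c, ARed D C l ∧ c ∈ C ∧ w = apr l * c :=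
  nf h.le (by rw [h.gen]; trivial)

/-- (c) -/
theorem Amalg.conj_mem (h : Amalg D C) {t : Bool} {s : G} (hs : s ∈ D t)
    (hsC : ∀ a ∈ D t, a * s * a⁻¹ ∉ C) {g : G} {t' : Bool} (hg : g * s * g⁻¹ ∈ D t') : g ∈ D t := by
  obtain ⟨l, c, hl, hc, rfl⟩ := h.nf' g
  have key : ∀ (l : List (Bool × G)) (a : G), a ∈ D t → ARed D C l → l ≠ [] →
      (∀ p ∈ l.getLast?, p.1 ≠ t) → apr l * a * s * (apr l * a)⁻¹ ∈ D t' → False := by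
    intro l a ha hl hne hlast hm
    refine h.len2 (l := l ++ ((t, a * s * a⁻¹) :: ainv l)) ?_ ?_ t' ?_
    · rw [ARed.append_iff, ARed.cons_iff]
      refine ⟨hl, ⟨⟨mul_mem (mul_mem ha hs) (inv_mem ha), hsC a ha⟩, ?_, hl.inv⟩, ?_⟩
      · intro q hq
        simp only [OR.ainv, List.head?_reverse, List.getLast?_map, Option.mem_def,
          Option.map_eq_some_iff] at hq
        obtain ⟨r, hr, rfl⟩ := hq
        exact (hlast r hr).symm
      · intro p hp q hq
        simp only [List.head?_cons, Option.mem_def, Option.some.injEq] at hq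
        subst hq
        exact hlast p hp
    · have := List.length_pos_of_ne_nil hne
      simp only [List.length_append, List.length_cons]; omega
    · rw [apr_append, apr_cons, apr_ainv]
      convert hm using 1
      group
  rcases List.eq_nil_or_concat l with rfl | ⟨m, p, rfl⟩
  · simpa using h.le t hc
  · simp only [List.concat_eq_append] at *
    by_cases hp : p.1 = t
    · rw [ARed.append_iff] at hl
      obtain ⟨b1, b2, b3⟩ := hl
      have hpD : p.2 ∈ D t := by rw [← hp]; exact (b2.1 p (by simp)).1
      by_cases hm : m = []
      · subst hm
        simpa using mul_mem hpD (h.le t hc)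
      · exfalso
        apply key m (p.2 * c) (mul_mem hpD (h.le t hc)) b1 hm
        · intro q hq; rw [← hp]; exact b3 q hq p (by simp)
        · convert hg using 1; simp [apr_append, mul_assoc]
    · exfalso
      apply key (m ++ [p]) c (h.le t hc) hl (by simp) _ hg
      intro q hq
      simp only [List.getLast?_append, List.getLast?_singleton, Option.some_or, Option.mem_def, Option.some.injEq] at hq
      rw [← hq]; exact hp

/-- (b) -/
theorem Amalg.tors (h : Amalg D C) {w : G} {k : ℕ} (hk : 0 < k) (hw : w ^ k = 1) :
    ∃ g t, g * w * g⁻¹ ∈ D t := by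
  have main : ∀ N (l : List (Bool × G)) (c : G), l.length ≤ N → ARed D C l → c ∈ C →
      (apr l * c) ^ k = 1 → ∃ g t, g * (apr l * c) * g⁻¹ ∈ D t := by
    intro N
    induction N with
    | zero =>
      intro l c hl hr hc _
      have : l = [] := List.length_eq_zero_iff.1 (by omega)
      subst this
      exact ⟨1, true, by simpa using h.le true hc⟩
    | succ N ih =>
      intro l c hlen hr hc hpow
      match l with
      | [] => exact ⟨1, true, by simpa using h.le true hc⟩
      | p :: l =>
      rcases List.eq_nil_or_concat l with rfl | ⟨m, q, rfl⟩
      · exact ⟨1, p.1, by simpa using mul_mem (hr.1 p (by simp)).1 (h.le p.1 hc)⟩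
      simp only [List.concat_eq_append] at *
      have hr0 := hr
      rw [ARed.cons_iff, ARed.append_iff] at hr
      obtain ⟨⟨a1, a2⟩, a3, a4, a5, a6⟩ := hr
      have hq := a5.1 q (by simp)
      by_cases hpq : p.1 = q.1
      · -- shorten
        have hm : m ≠ [] := by
          rintro rfl
          exact a3 q (by simp) hpq
        have hcon : p.2⁻¹ * (apr (p :: (m ++ [q])) * c) * p.2⁻¹⁻¹ = apr m * (q.2 * c * p.2) := by
          simp [mul_assoc]
        have hpow' : (apr m * (q.2 * c * p.2)) ^ k = 1 := by
          rw [← hcon, conj_pow, hpow]; simp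
        have hlen' : m.length + 1 ≤ N := by simp at hlen; omega
        by_cases hcc : q.2 * c * p.2 ∈ C
        · obtain ⟨g, t, hg⟩ := ih m _ (by omega) a4 hcc hpow'
          refine ⟨g * p.2⁻¹, t, ?_⟩
          rw [← hcon] at hg
          convert hg using 1; group
        · have hD : q.2 * c * p.2 ∈ D q.1 := by
            refine mul_mem (mul_mem hq.1 (h.le _ hc)) ?_
            rw [← hpq]; exact a1
          have hR : ARed D C (m ++ [(q.1, q.2 * c * p.2)]) := by
            rw [ARed.append_iff]
            refine ⟨a4, ARed.single hD hcc, ?_⟩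
            intro x hx y hy
            simp only [List.head?_cons, Option.mem_def, Option.some.injEq] at hy
            subst hy
            exact a6 x hx q (by simp)
          obtain ⟨g, t, hg⟩ := ih (m ++ [(q.1, q.2 * c * p.2)]) 1 (by simpa using hlen') hR
            (one_mem _) (by simpa [mul_assoc] using hpow')
          refine ⟨g * p.2⁻¹, t, ?_⟩
          have e : apr (m ++ [(q.1, q.2 * c * p.2)]) * 1 = apr m * (q.2 * c * p.2) := by simp
          rw [e, ← hcon] at hg
          convert hg using 1; group
      · -- powers reduced
        exfalso
        have hqc : ARed D C ((p :: m) ++ [(q.1, q.2 * c)]) := by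
          have : p :: (m ++ [q]) = (p :: m) ++ [q] := rfl
          rw [this, ARed.append_iff] at hr0
          rw [ARed.append_iff]
          refine ⟨hr0.1, ARed.single (mul_mem hq.1 (h.le _ hc))
            (fun hh => hq.2 ((Subgroup.mul_mem_cancel_right _ hc).1 hh)), ?_⟩
          intro x hx y hy
          simp only [List.head?_cons, Option.mem_def, Option.some.injEq] at hy
          subst hy
          exact hr0.2.2 x hx q (by simp)
        have pw : ∀ j : ℕ, ∃ l', ARed D C (p :: l') ∧ apr (p :: l') = (apr (p :: (m ++ [q])) * c) ^ (j + 1) := by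
          intro j
          induction j with
          | zero =>
            refine ⟨m ++ [(q.1, q.2 * c)], hqc, ?_⟩
            simp [mul_assoc]
          | succ j ihj =>
            obtain ⟨l', h1, h2⟩ := ihj
            refine ⟨(m ++ [(q.1, q.2 * c)]) ++ p :: l', ?_, ?_⟩
            · have : p :: ((m ++ [(q.1, q.2 * c)]) ++ p :: l') =
                  ((p :: m) ++ [(q.1, q.2 * c)]) ++ p :: l' := by simp
              rw [this, ARed.append_iff]
              refine ⟨hqc, h1, ?_⟩
              intro x hx y hy
              simp only [List.head?_cons, Option.mem_def, Option.some.injEq] at hy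
              subst hy
              simp only [List.getLast?_append, List.getLast?_singleton, Option.some_or, Option.mem_def, Option.some.injEq] at hx
              rw [← hx]; exact fun hh => hpq hh.symm
            · rw [pow_succ', ← h2]
              simp [mul_assoc]
        obtain ⟨l', h1, h2⟩ := pw (k - 1)
        rw [Nat.sub_add_cancel hk, hpow] at h2
        exact h.red _ h1 (by simp) (by rw [h2]; exact one_mem _)
  obtain ⟨l, c, hl, hc, rfl⟩ := h.nf' w
  exact main _ l c le_rfl hl hc hw

/-- (d) -/
theorem Amalg.fg (h : Amalg D C) (hG : (⊤ : Subgroup G).FG) (hC : C.FG) (t : Bool) : (D t).FG := by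
  obtain ⟨S, hS⟩ := hG
  choose L c hL hc hw using h.nf'
  let F : Bool → Set G := fun t => {x | ∃ s ∈ S, (t, x) ∈ L s}
  have hF : ∀ t, (F t).Finite := by
    intro t
    have : F t ⊆ ⋃ s ∈ S, {x | x ∈ (L s).map Prod.snd} := by
      rintro x ⟨s, hs, hx⟩
      simp only [Set.mem_iUnion]
      exact ⟨s, hs, List.mem_map.2 ⟨_, hx, rfl⟩⟩
    apply Set.Finite.subset _ this
    apply Set.Finite.biUnion S.finite_toSet
    intro s _
    exact List.finite_toSet _
  let D' : Bool → Subgroup G := fun t => C ⊔ Subgroup.closure (F t)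
  have hfg : ∀ t, (D' t).FG := by
    intro t
    refine Subgroup.FG.sup hC ⟨(hF t).toFinset, by simp⟩
  have hle : ∀ t, C ≤ D' t := fun t => le_sup_left
  have hD' : ∀ t, D' t ≤ D t := by
    intro t
    refine sup_le (h.le t) ?_
    rw [Subgroup.closure_le]
    rintro x ⟨s, hs, hx⟩
    exact ((hL s).1 _ hx).1
  have hgen : Subgroup.closure (⋃ t, (D' t : Set G)) = ⊤ := by
    rw [eq_top_iff, ← hS, Subgroup.closure_le]
    intro s hs
    change s ∈ Subgroup.closure (⋃ t, (D' t : Set G))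
    rw [hw s]
    have inn : ∀ t x, x ∈ D' t → x ∈ Subgroup.closure (⋃ t, (D' t : Set G)) := fun t x hx =>
      Subgroup.subset_closure (Set.mem_iUnion.2 ⟨t, hx⟩)
    refine mul_mem ?_ (inn true _ (hle true (hc s)))
    apply Subgroup.list_prod_mem
    intro x hx
    obtain ⟨⟨u, y⟩, hp, rfl⟩ := List.mem_map.1 hx
    exact inn u _ ((le_sup_right : _ ≤ D' u) (Subgroup.subset_closure ⟨s, hs, hp⟩))
  have : D t = D' t := by
    apply le_antisymm _ (hD' t)
    intro d hd
    obtain ⟨l, c, hl, hc, rfl⟩ := nf (D := D') (C := C) hle (w := d) (by rw [hgen]; trivial)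
    have hl' : ARed D C l := ⟨fun p hp => ⟨hD' _ (hl.1 p hp).1, (hl.1 p hp).2⟩, hl.2⟩
    match l with
    | [] => simpa using hle t hc
    | [p] =>
      rw [apr_cons, apr_nil, mul_one] at hd ⊢
      have hp := (hl.1 p (by simp))
      have hp2 : p.2 ∈ D t := (Subgroup.mul_mem_cancel_right _ (h.le t hc)).1 hd
      by_cases htp : p.1 = t
      · subst htp
        exact mul_mem hp.1 (hle _ hc)
      · exact absurd (h.inf htp (hD' _ hp.1) hp2) hp.2
    | p :: q :: l =>
      exact absurd ((Subgroup.mul_mem_cancel_right _ (h.le t hc)).1 hd)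
        (h.len2 hl' (by simp) t)
  rw [this]; exact hfg t
end
end OR

namespace OR
section
open scoped Classical
variable {X : Type} {R : FreeGroup X} {n : ℕ} {G : Type} [Group G] {π : FreeGroup X →* G}

section push
open Monoid
variable {C : Type} [Group C] {D : Bool → Type} [∀ b, Group (D b)] {φ : ∀ b, C →* D b}

theorem amalg_of_push (hinj : ∀ b, Function.Injective (φ b)) (θ : PushoutI φ ≃* G) :
    Amalg (fun t => (θ.toMonoidHom.comp (PushoutI.of (φ := φ) t)).range)
      (θ.toMonoidHom.comp (PushoutI.base φ)).range := by
  have hle : ∀ t, (θ.toMonoidHom.comp (PushoutI.base φ)).range ≤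
      (θ.toMonoidHom.comp (PushoutI.of (φ := φ) t)).range := by
    rintro t _ ⟨c, rfl⟩
    refine ⟨φ t c, ?_⟩
    simp [PushoutI.of_apply_eq_base]
  refine ⟨hle, ?_, ?_, ?_⟩
  · rw [eq_top_iff]
    rintro g -
    obtain ⟨p, rfl⟩ := θ.surjective g
    induction p using PushoutI.induction_on with
    | of i x => exact Subgroup.subset_closure (Set.mem_iUnion.2 ⟨i, x, rfl⟩)
    | base c => exact Subgroup.subset_closure (Set.mem_iUnion.2 ⟨true, hle true ⟨c, rfl⟩⟩)
    | mul x y hx hy => rw [map_mul]; exact mul_mem hx hy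
  · have key : ∀ l, ARed (fun t => (θ.toMonoidHom.comp (PushoutI.of (φ := φ) t)).range)
        (θ.toMonoidHom.comp (PushoutI.base φ)).range l →
        ∃ w : CoprodI.Word D, PushoutI.Reduced φ w ∧ θ (PushoutI.ofCoprodI w.prod) = apr l ∧
          w.fstIdx = l.head?.map Prod.fst := by
      intro l
      induction l with
      | nil =>
        intro _
        exact ⟨CoprodI.Word.empty, by intro g hg; simp [CoprodI.Word.empty] at hg, by simp, rfl⟩
      | cons p l ih =>
        intro hl
        rw [ARed.cons_iff] at hl
        obtain ⟨⟨⟨x, hx⟩, h2⟩, h3, h4⟩ := hl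
        obtain ⟨w, w1, w2, w3⟩ := ih h4
        have hxr : x ∉ (φ p.1).range := by
          rintro ⟨c, rfl⟩
          apply h2
          rw [← hx]
          exact ⟨c, by simp [PushoutI.of_apply_eq_base]⟩
        have hx1 : x ≠ 1 := by
          rintro rfl; exact hxr (one_mem _)
        have hidx : w.fstIdx ≠ some p.1 := by
          rw [w3]
          intro hh
          obtain ⟨q, hq, hq2⟩ := Option.map_eq_some_iff.1 hh
          exact h3 q hq hq2.symm
        refine ⟨CoprodI.Word.cons x w hidx hx1, ?_, ?_, ?_⟩
        · intro g hg
          simp only [CoprodI.Word.cons, List.mem_cons] at hg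
          rcases hg with rfl | hg
          · exact hxr
          · exact w1 g hg
        · rw [CoprodI.Word.prod_cons, map_mul, map_mul, w2, apr_cons, ← hx]
          simp
        · rw [CoprodI.Word.fstIdx_cons]; rfl
    intro l hl hne hmem
    obtain ⟨w, w1, w2, w3⟩ := key l hl
    have : w = .empty := by
      apply w1.eq_empty_of_mem_range hinj
      obtain ⟨c, hc⟩ := hmem
      refine ⟨c, ?_⟩
      apply θ.injective
      rw [w2, ← hc]; rfl
    subst this
    cases l with
    | nil => exact hne rfl
    | cons p l => simp [CoprodI.Word.fstIdx, CoprodI.Word.empty] at w3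
  · intro A _ f hf
    let f' : ∀ t, D t →* A := fun t =>
      (f t).comp (θ.toMonoidHom.comp (PushoutI.of (φ := φ) t)).rangeRestrict
    have hag : ∀ t, (f' t).comp (φ t) = (f' true).comp (φ true) := by
      have h0 : (f' true).comp (φ true) = (f' false).comp (φ false) := by
        ext c
        have := hf (θ (PushoutI.base φ c)) ⟨c, rfl⟩
        simp only [f', MonoidHom.comp_apply]
        convert this using 2
        · apply Subtype.ext
          change θ (PushoutI.of _ (φ _ c)) = _
          rw [PushoutI.of_apply_eq_base]
        · apply Subtype.ext
          change θ (PushoutI.of _ (φ _ c)) = _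
          rw [PushoutI.of_apply_eq_base]
      intro t
      cases t
      · exact h0.symm
      · rfl
    refine ⟨(PushoutI.lift f' _ hag).comp θ.symm.toMonoidHom, ?_⟩
    rintro t ⟨_, x, rfl⟩
    simp [f']
    rfl
end push

section coprod
open Monoid
variable {M : Bool → Type} [∀ t, Group (M t)]

theorem coprod_RW {t : Bool} {w : CoprodI M}
    (h : RW (fun t => (CoprodI.of (M := M) (i := t)).range) t w) : w ≠ 1 := by
  have key : ∃ v : CoprodI.Word M, v.prod = w ∧ v.fstIdx = some t := by
    induction h with
    | single t s hs hs1 =>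
      obtain ⟨x, rfl⟩ := hs
      have hx : x ≠ 1 := by rintro rfl; simp at hs1
      have h0 : (CoprodI.Word.empty : CoprodI.Word M).fstIdx ≠ some t := by
        simp [CoprodI.Word.fstIdx, CoprodI.Word.empty]
      refine ⟨CoprodI.Word.cons x .empty h0 hx, ?_, ?_⟩
      · rw [CoprodI.Word.prod_cons, CoprodI.Word.prod_empty, mul_one]
      · rw [CoprodI.Word.fstIdx_cons]
    | cons t s w hs hs1 _ ih =>
      obtain ⟨v, hv, hv2⟩ := ih
      obtain ⟨x, rfl⟩ := hs
      have hx : x ≠ 1 := by rintro rfl; simp at hs1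
      refine ⟨CoprodI.Word.cons x v (by rw [hv2]; simp) hx, ?_, ?_⟩
      · simp [hv]
      · rw [CoprodI.Word.fstIdx_cons]
  obtain ⟨v, hv, hv2⟩ := key
  rintro rfl
  have : v = CoprodI.Word.empty := by
    apply CoprodI.Word.equiv.symm.injective
    change v.prod = CoprodI.Word.empty.prod
    rw [hv]; rfl
  subst this
  simp [CoprodI.Word.fstIdx, CoprodI.Word.empty] at hv2
end coprod

variable {D : Bool → Subgroup G} {C : Subgroup G}

theorem Amalg.quot (ha : Amalg D C) (h : Pres R n π) (hn : 1 < n) (hd : ¬ FreelyDecomposable G)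
    {k : ℕ} (hk : 0 < k) {r : G} {t₀ : Bool} (hr : r ∈ D t₀)
    (hC : C ≤ Subgroup.normalClosure {r})
    (hker : ∀ g, π g ∈ Subgroup.normalClosure {r} ↔ g ∈ Subgroup.normalClosure {R ^ k}) :
    ∃ t, D t ≤ Subgroup.normalClosure {r} := by
  by_contra hcon
  push Not at hcon
  apply hd
  set N := Subgroup.normalClosure {r} with hN
  have hNn : N.Normal := Subgroup.normalClosure_normal
  let Q : Bool → Type := fun t => D t ⧸ N.subgroupOf (D t)
  let f : ∀ t, D t →* Monoid.CoprodI Q := fun t =>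
    (Monoid.CoprodI.of (M := Q) (i := t)).comp (QuotientGroup.mk' _)
  have hfN : ∀ t (x : D t), (x : G) ∈ N → f t x = 1 := by
    intro t x hx
    have : (QuotientGroup.mk' (N.subgroupOf (D t))) x = 1 := by
      rw [QuotientGroup.mk'_apply, QuotientGroup.eq_one_iff]; exact hx
    simp only [f, MonoidHom.comp_apply, this, map_one]
  obtain ⟨Φ, hΦ⟩ := ha.univ _ f (fun x hx => by rw [hfN _ _ (hC hx), hfN _ _ (hC hx)])
  let back : Monoid.CoprodI Q →* G ⧸ N := Monoid.CoprodI.lift fun t =>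
    QuotientGroup.map (N.subgroupOf (D t)) N (D t).subtype (fun x hx => hx)
  have hback : ∀ g, back (Φ g) = QuotientGroup.mk' N g := by
    have : back.comp Φ = QuotientGroup.mk' N := by
      apply MonoidHom.eq_of_eqOn_dense ha.gen
      intro x hx
      obtain ⟨t, ht⟩ := Set.mem_iUnion.1 hx
      have := hΦ t ⟨x, ht⟩
      simp only at this
      simp only [MonoidHom.comp_apply]
      rw [this]
      simp [f, back]
      rfl
    intro g; rw [← this]; rfl
  have hΦk : ∀ g, Φ g = 1 ↔ g ∈ N := by
    intro g
    constructor
    · intro hg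
      have := hback g
      rw [hg, map_one] at this
      exact (QuotientGroup.eq_one_iff g).1 this.symm
    · intro hg
      have : N ≤ Φ.ker := by
        apply ncl_le
        rw [MonoidHom.mem_ker]
        have := hΦ t₀ ⟨r, hr⟩
        rw [this, hfN]
        exact ncl_self r
      exact this hg
  refine h.decomp hn (H := fun t => (Monoid.CoprodI.of (M := Q) (i := t)).range) ?_
    (fun t w hw => coprod_RW hw) ?_ (Φ.comp π) ?_ hk ?_
  · rw [eq_top_iff]
    rintro w -
    induction w using Monoid.CoprodI.induction_left with
    | one => exact one_mem _
    | mul m x hx => exact mul_mem (Subgroup.subset_closure (Set.mem_iUnion.2 ⟨_, m, rfl⟩)) hx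
  · intro t
    obtain ⟨d, hd, hdN⟩ := Set.not_subset.1 (hcon t)
    refine ⟨_, ⟨QuotientGroup.mk' _ ⟨d, hd⟩, rfl⟩, ?_⟩
    intro hh
    have := (hΦk d).1 ?_
    · exact hdN this
    · have := hΦ t ⟨d, hd⟩
      rw [this]
      exact hh
  · rw [MonoidHom.coe_comp]
    apply Function.Surjective.comp _ h.surj
    intro w
    rw [← MonoidHom.mem_range]
    induction w using Monoid.CoprodI.induction_left with
    | one => exact one_mem _
    | @mul i m x hx =>
      refine mul_mem ?_ hx
      obtain ⟨d, rfl⟩ := QuotientGroup.mk'_surjective _ m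
      exact ⟨d, by rw [hΦ]; rfl⟩
  · intro g
    rw [← hker, ← hΦk]; rfl

/-- kill one factor -/
theorem Amalg.kill (ha : Amalg D C) (t : Bool) (M : Subgroup (D t)) [M.Normal]
    (hC : ∀ x (hx : x ∈ C), (⟨x, ha.le t hx⟩ : D t) ∈ M) :
    ∃ Φ : G →* (D t ⧸ M), (∀ x : D t, Φ x = QuotientGroup.mk' M x) ∧ ∀ x ∈ D (!t), Φ x = 1 := by
  let f : ∀ u, D u →* (D t ⧸ M) := fun u =>
    if hu : u = t then (QuotientGroup.mk' M).comp (Subgroup.inclusion (by rw [hu])) else 1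
  have hft : ∀ x (hx : x ∈ D t), f t ⟨x, hx⟩ = QuotientGroup.mk' M ⟨x, hx⟩ := by
    intro x hx; simp [f]; rfl
  have hfn : ∀ x, f (!t) x = 1 := by
    intro x; simp [f]
  have h1 : ∀ x (hx : x ∈ C), ∀ u, f u ⟨x, ha.le u hx⟩ = 1 := by
    intro x hx u
    by_cases hu : u = t
    · subst hu
      rw [hft, QuotientGroup.mk'_apply, QuotientGroup.eq_one_iff]; exact hC x hx
    · simp [f, hu]
  obtain ⟨Φ, hΦ⟩ := ha.univ _ f (fun x hx => by rw [h1 x hx, h1 x hx])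
  refine ⟨Φ, fun x => by rw [hΦ, ← hft], fun x hx => ?_⟩
  have := hΦ (!t) ⟨x, hx⟩
  rw [this, hfn]
end
end OR

namespace OR
section
open scoped Classical
variable {X : Type} {R : FreeGroup X} {n : ℕ} {G : Type} [Group G] {π : FreeGroup X →* G}

theorem dihedral_of {K : Type} [Group K] [Infinite K] {a b : K} (ha : a ^ 2 = 1) (hb : b ^ 2 = 1)
    (hab : Subgroup.closure {a, b} = ⊤) : Nonempty (K ≃* DihedralGroup 0) := by
  have ha' : a * a = 1 := by rw [← sq, ha]
  have hb' : b * b = 1 := by rw [← sq, hb]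
  set x := a * b with hx
  have hinv : a * x * a⁻¹ = x⁻¹ := by
    rw [hx, mul_inv_rev, ← eq_inv_of_mul_eq_one_left ha', ← eq_inv_of_mul_eq_one_left hb']
    rw [← mul_assoc, ha', one_mul]
  have hz : ∀ i : ℤ, a * x ^ i = x ^ (-i) * a := by
    intro i
    have : a * x ^ i * a⁻¹ = x ^ (-i) := by
      rw [← conj_zpow, hinv]; simp
    rw [← this]; group
  let F : DihedralGroup 0 → K := fun d => match d with
    | .r i => x ^ (show ℤ from i)
    | .sr i => a * x ^ (show ℤ from i)
  have hFr : ∀ i : ℤ, F (.r i) = x ^ i := fun i => rfl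
  have hFs : ∀ i : ℤ, F (.sr i) = a * x ^ i := fun i => rfl
  let f : DihedralGroup 0 →* K := MonoidHom.mk' F (by
    rintro (i | i) (j | j)
    · rw [DihedralGroup.r_mul_r]
      exact zpow_add x (show ℤ from i) (show ℤ from j)
    · rw [DihedralGroup.r_mul_sr]
      change a * x ^ ((show ℤ from j) - (show ℤ from i)) = x ^ (show ℤ from i) * (a * x ^ (show ℤ from j))
      rw [zpow_sub, ← mul_assoc (x ^ _) a, ← neg_neg (show ℤ from i), ← hz, neg_neg, mul_assoc,
        ← zpow_neg, ← zpow_add, ← zpow_add, add_comm]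
    · rw [DihedralGroup.sr_mul_r]
      change a * x ^ ((show ℤ from i) + (show ℤ from j)) = a * x ^ (show ℤ from i) * x ^ (show ℤ from j)
      rw [zpow_add, mul_assoc]
    · rw [DihedralGroup.sr_mul_sr]
      change x ^ ((show ℤ from j) - (show ℤ from i)) = a * x ^ (show ℤ from i) * (a * x ^ (show ℤ from j))
      rw [hz, mul_assoc, ← mul_assoc a a, ha', one_mul, ← zpow_add]
      congr 1; ring)
  have hsurj : Function.Surjective f := by
    rw [← MonoidHom.range_eq_top, eq_top_iff, ← hab, Subgroup.closure_le]
    rintro y (rfl | rfl)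
    · exact ⟨.sr (0 : ℤ), by change y * x ^ (0 : ℤ) = y; simp⟩
    · refine ⟨.sr (1 : ℤ), ?_⟩
      change a * x ^ (1 : ℤ) = y
      rw [zpow_one, hx, ← mul_assoc, ha', one_mul]
  have hxinf : ∀ i : ℤ, i ≠ 0 → x ^ i ≠ 1 := by
    intro i hi he
    have hfin : IsOfFinOrder x := isOfFinOrder_iff_zpow_eq_one.2 ⟨i, hi, he⟩
    have h1 : (Subgroup.zpowers x : Set K).Finite := finite_zpowers.2 hfin
    have : (Set.univ : Set K).Finite := by
      apply Set.Finite.subset (h1.union (h1.image (fun y => a * y)))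
      rintro y -
      obtain ⟨d, rfl⟩ := hsurj y
      rcases d with j | j
      · exact Or.inl ⟨_, rfl⟩
      · exact Or.inr ⟨x ^ (show ℤ from j), ⟨_, rfl⟩, rfl⟩
    exact Set.infinite_univ this
  have hinj : Function.Injective f := by
    rw [injective_iff_map_eq_one]
    rintro (i | i) hi
    · change x ^ (show ℤ from i) = 1 at hi
      by_cases h0 : (show ℤ from i) = 0
      · have : i = 0 := h0
        subst this; rfl
      · exact absurd hi (hxinf _ h0)
    · exfalso
      change a * x ^ (show ℤ from i) = 1 at hi
      generalize (show ℤ from i) = j at hi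
      have h1 : a = x ^ (-j) := by rw [zpow_neg]; exact eq_inv_of_mul_eq_one_left hi
      have h2 : x ^ (-j * 2) = 1 := by
        rw [zpow_mul, ← h1]; exact_mod_cast ha
      have h3 : j = 0 := by
        by_contra h0
        exact hxinf (-j * 2) (by omega) h2
      subst h3
      have h4 : a = 1 := by simpa using h1
      apply hxinf 2 (by norm_num)
      rw [hx, h4, one_mul]; exact_mod_cast hb
  exact ⟨(MulEquiv.ofBijective f ⟨hinj, hsurj⟩).symm⟩

theorem ncl_rn {L : Subgroup G} {S : Set G} {x : L}
    (hx : x ∈ Subgroup.normalClosure {y : L | (y : G) ∈ S}) : (x : G) ∈ rn L S := by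
  have : Subgroup.normalClosure {y : L | (y : G) ∈ S} ≤ (rn L S).comap L.subtype := by
    unfold Subgroup.normalClosure
    rw [Subgroup.closure_le]
    intro y hy
    obtain ⟨s, hs, hc⟩ := Group.mem_conjugatesOfSet_iff.1 hy
    obtain ⟨l, hl⟩ := isConj_iff.1 hc
    refine Subgroup.subset_closure ⟨l, l.2, s, hs, ?_⟩
    rw [← hl]; rfl
  exact this hx

/-- data extracted from virtually-ℤ -/
structure VZ (C : Subgroup G) (z : G) (N : ℕ) : Prop where
  mem : z ∈ C
  inf : ∀ m : ℤ, z ^ m = 1 → m = 0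
  pow : ∀ g ∈ C, ∃ m : ℕ, 0 < m ∧ m ≤ N ∧ g ^ m ∈ Subgroup.zpowers z

theorem VZ.of {C : Subgroup G} (h : VirtuallyZ C) : ∃ z N, VZ C z N := by
  obtain ⟨H, hfin, ⟨e⟩⟩ := h
  let z0 : H := e.symm (Multiplicative.ofAdd 1)
  have hz : ∀ x : H, ∃ i : ℤ, z0 ^ i = x := by
    intro x
    refine ⟨(e x).toAdd, ?_⟩
    apply e.injective
    rw [map_zpow]
    simp [z0, ← ofAdd_zsmul]
  refine ⟨((z0 : C) : G), H.index, (z0 : C).2, ?_, ?_⟩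
  · intro m hm
    have h1 : z0 ^ m = 1 := by
      apply Subtype.ext
      apply Subtype.ext
      simpa using hm
    have h2 : e (z0 ^ m) = 1 := by rw [h1, map_one]
    rw [map_zpow] at h2
    simpa [z0, ← ofAdd_zsmul] using h2
  · intro g hg
    obtain ⟨m, h1, h2, h3⟩ := Subgroup.exists_pow_mem_of_index_ne_zero hfin.index_ne_zero (⟨g, hg⟩ : C)
    refine ⟨m, h1, h2, ?_⟩
    obtain ⟨i, hi⟩ := hz ⟨_, h3⟩
    refine ⟨i, ?_⟩
    have := congrArg (fun y : H => ((y : C) : G)) hi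
    simpa using this

theorem VZ.zinj {C : Subgroup G} {z : G} {N : ℕ} (v : VZ C z N) {i j : ℤ} (h : z ^ i = z ^ j) :
    i = j := by
  have : z ^ (i - j) = 1 := by rw [zpow_sub, h]; simp
  have := v.inf _ this
  omega

theorem VZ.comms {C : Subgroup G} {z : G} {N : ℕ} (v : VZ C z N) : C ≤ comms z := by
  intro g hg
  obtain ⟨m, h1, -, i, hi⟩ := v.pow (g * z * g⁻¹) (mul_mem (mul_mem hg v.mem) (inv_mem hg))
  have hi' : z ^ i = (g * z * g⁻¹) ^ m := hi
  rw [conj_pow] at hi'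
  refine ⟨m, i, by omega, ?_, by rw [hi', zpow_natCast]⟩
  rintro rfl
  rw [zpow_zero] at hi'
  have : z ^ m = 1 := by
    have : z ^ m = g⁻¹ * (g * z ^ m * g⁻¹) * g := by group
    rw [this, ← hi']; group
  have := v.inf m (by exact_mod_cast this)
  omega

/-- elements centralising a power of `z` -/
def cen (z : G) : Subgroup G where
  carrier := {g | ∃ k : ℤ, k ≠ 0 ∧ g * z ^ k * g⁻¹ = z ^ k}
  one_mem' := ⟨1, one_ne_zero, by simp⟩
  mul_mem' := by
    rintro g g' ⟨k, hk, h⟩ ⟨k', hk', h'⟩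
    refine ⟨k * k', mul_ne_zero hk hk', ?_⟩
    have e : g * g' * z ^ (k * k') * (g * g')⁻¹ = g * ((g' * z ^ k' * g'⁻¹) ^ k) * g⁻¹ := by
      rw [conj_zpow, ← zpow_mul, mul_comm k k']; group
    rw [e, h', ← zpow_mul, mul_comm k' k, zpow_mul, ← conj_zpow, h]
  inv_mem' := by
    rintro g ⟨k, hk, h⟩
    refine ⟨k, hk, ?_⟩
    nth_rewrite 1 [← h]
    group

theorem VZ.structure (h : Pres R n π) (hn : 1 < n) {C : Subgroup G} {z : G} {N : ℕ}
    (v : VZ C z N) :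
    ∃ c ∈ C, (∀ m : ℤ, c ^ m = 1 → m = 0) ∧ (C = Subgroup.zpowers c ∨
      ∃ s₁ s₂, s₁ ^ 2 = 1 ∧ s₂ ^ 2 = 1 ∧ s₁ ≠ 1 ∧ s₂ ≠ 1 ∧ C = Subgroup.closure {s₁, s₂}) := by
  set C0 := C ⊓ cen z with hC0
  have hzC0 : z ∈ C0 := ⟨v.mem, 1, one_ne_zero, by simp⟩
  have tf : ∀ a ∈ C0, ∀ m : ℕ, 0 < m → a ^ m = 1 → a = 1 := by
    rintro a ⟨-, k, hk, hak⟩ m hm ham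
    by_contra ha1
    have : (z ^ k) ^ n = 1 := by
      apply h.comm_tors hm ham ha1
      have : a * z ^ k = z ^ k * a := by rw [← mul_inv_eq_iff_eq_mul]; exact hak
      rw [← this]; group
    rw [← zpow_natCast, ← zpow_mul] at this
    have := v.inf _ this
    rcases mul_eq_zero.1 this with h | h
    · exact hk h
    · omega
  -- choose the best root
  let Pm : ℕ → Prop := fun m => ∃ c ∈ C0, z = c ^ m ∨ z = (c ^ m)⁻¹
  have hP1 : Pm 1 := ⟨z, hzC0, by simp⟩
  have hbd : ∀ m, Pm m → m ≤ N := by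
    rintro m ⟨c, hc, hzc⟩
    obtain ⟨q, hq1, hq2, i, hi⟩ := v.pow c hc.1
    have hi' : z ^ i = c ^ q := hi
    have hz2 : ∃ e : ℤ, z = c ^ ((m : ℤ) * e) ∧ (e = 1 ∨ e = -1) := by
      rcases hzc with h | h
      · exact ⟨1, by simpa using h, Or.inl rfl⟩
      · exact ⟨-1, by simpa using h, Or.inr rfl⟩
    obtain ⟨e, he, he1⟩ := hz2
    have hce : c ^ ((m : ℤ) * e * i - q) = 1 := by
      rw [zpow_sub, zpow_mul, ← he, hi']; simp
    have h0 : z ^ ((m : ℤ) * e * i - q) = 1 := by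
      have : z ^ ((m : ℤ) * e * i - q) = (c ^ ((m : ℤ) * e * i - q)) ^ ((m : ℤ) * e) := by
        rw [← zpow_mul, mul_comm ((m : ℤ) * e * i - q), zpow_mul, ← he]
      rw [this, hce, one_zpow]
    have h1 := v.inf _ h0
    have h2 : (m : ℤ) ∣ q := ⟨e * i, by linarith⟩
    have h3 : m ∣ q := by exact_mod_cast h2
    exact (Nat.le_of_dvd hq1 h3).trans hq2
  have hP1N : 1 ≤ N := hbd 1 hP1
  have hspec := Nat.findGreatest_spec (P := Pm) hP1N hP1
  have hmax : ∀ m, Pm m → m ≤ Nat.findGreatest Pm N := fun m hm => Nat.le_findGreatest (hbd m hm) hm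
  set M := Nat.findGreatest Pm N with hM
  have hM1 : 1 ≤ M := hmax 1 hP1
  obtain ⟨c, hc, hzc⟩ := hspec
  have hzc' : ∃ e : ℤ, e ≠ 0 ∧ z = c ^ e ∧ e.natAbs = M := by
    rcases hzc with h | h
    · exact ⟨M, by omega, by simpa using h, by simp⟩
    · exact ⟨-M, by omega, by simpa using h, by simp⟩
  obtain ⟨e, he0, hze, heM⟩ := hzc'
  have hcinf : ∀ m : ℤ, c ^ m = 1 → m = 0 := by
    intro m hm
    apply v.inf
    rw [hze, ← zpow_mul, mul_comm, zpow_mul, hm, one_zpow]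
  have hcyc : C0 = Subgroup.zpowers c := by
    apply le_antisymm
    · intro g hg
      obtain ⟨k, hk, hgk⟩ := hg.2
      have hle : Subgroup.closure {c, g} ≤ C0 := by
        rw [Subgroup.closure_le]
        rintro x (rfl | rfl)
        · exact hc
        · exact hg
      obtain ⟨a, ha, ⟨i, hi⟩, ⟨j, hj⟩⟩ := h.thmE hn (c := c) (g := g)
        (fun a ha => tf a (hle ha)) (k := e * k) (l := e * k) (mul_ne_zero he0 hk)
        (mul_ne_zero he0 hk) (by rw [zpow_mul, ← hze, hgk])
      have hi' : a ^ i = c := hi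
      have hi0 : i ≠ 0 := by
        rintro rfl
        rw [zpow_zero] at hi'
        have := hcinf 1 (by rw [← hi']; simp)
        omega
      have hPm : Pm (i * e).natAbs := by
        refine ⟨a, hle ha, ?_⟩
        have : z = a ^ (i * e) := by rw [zpow_mul, hi', hze]
        rcases Int.natAbs_eq (i * e) with h | h
        · left; rw [← zpow_natCast, ← h]; exact this
        · right; rw [← zpow_natCast, ← zpow_neg, ← h]; exact this
      have := hmax _ hPm
      rw [Int.natAbs_mul, heM] at this
      have hi1 : i.natAbs ≤ 1 := by
        by_contra hcon
        push Not at hcon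
        nlinarith
      have : i = 1 ∨ i = -1 := by omega
      have hac : a ∈ Subgroup.zpowers c := by
        rcases this with rfl | rfl
        · exact ⟨1, by simpa using hi'.symm⟩
        · refine ⟨-1, ?_⟩
          change c ^ (-1 : ℤ) = a
          rw [← hi']; simp
      rw [← hj]
      exact Subgroup.zpow_mem _ hac j
    · rw [Subgroup.zpowers_le]; exact hc
  refine ⟨c, hc.1, hcinf, ?_⟩
  by_cases hCC : C ≤ cen z
  · left; rw [← hcyc, hC0, inf_eq_left.2 hCC]
  right
  have hnorm : ∀ g ∈ C, ∀ x ∈ C0, g * x * g⁻¹ ∈ C0 := by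
    rintro g hg x ⟨hx, k, hk, hxk⟩
    refine ⟨C.mul_mem (C.mul_mem hg hx) (C.inv_mem hg), ?_⟩
    obtain ⟨a, b, ha, hb, hab⟩ := v.comms hg
    refine ⟨b * k, mul_ne_zero hb hk, ?_⟩
    have e1 : z ^ (b * k) = g * z ^ (a * k) * g⁻¹ := by
      rw [zpow_mul, ← hab, conj_zpow, ← zpow_mul]
    have e2 : x * z ^ (a * k) * x⁻¹ = z ^ (a * k) := by
      rw [mul_comm, zpow_mul, ← conj_zpow, hxk]
    rw [e1]
    have : g * x * g⁻¹ * (g * z ^ (a * k) * g⁻¹) * (g * x * g⁻¹)⁻¹ =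
      g * (x * z ^ (a * k) * x⁻¹) * g⁻¹ := by group
    rw [this, e2]
  have hcomm : ∀ g ∈ C, g * c * g⁻¹ = c → g ∈ C0 := by
    intro g hg hgc
    refine ⟨hg, 1, one_ne_zero, ?_⟩
    rw [zpow_one, hze, ← conj_zpow, hgc]
  have hsgn : ∀ g ∈ C, g ∉ C0 → g * c * g⁻¹ = c⁻¹ := by
    intro g hg hgC0
    have m1 := hnorm g hg c hc
    have m2 := hnorm g⁻¹ (inv_mem hg) c hc
    rw [hcyc] at m1 m2
    obtain ⟨i, hi⟩ := m1
    obtain ⟨j, hj⟩ := m2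
    have hi' : c ^ i = g * c * g⁻¹ := hi
    have hj' : c ^ j = g⁻¹ * c * g⁻¹⁻¹ := hj
    have : c ^ (i * j - 1) = 1 := by
      have : c ^ (i * j) = c := by
        rw [mul_comm, zpow_mul, hj', conj_zpow, hi']; group
      rw [zpow_sub, this]; simp
    have hij : i * j = 1 := by have := hcinf _ this; omega
    rcases Int.isUnit_eq_one_or (IsUnit.of_mul_eq_one _ hij) with h1 | h1
    · exfalso
      apply hgC0
      apply hcomm g hg
      rw [← hi', h1, zpow_one]
    · rw [← hi', h1]; simp
  obtain ⟨s, hsC, hs⟩ := Set.not_subset.1 hCC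
  have hs0 : s ∉ C0 := fun hh => hs hh.2
  have hsc := hsgn s hsC hs0
  have hs2 : s ^ 2 = 1 := by
    have : s ^ 2 ∈ C0 := by
      apply hcomm _ (pow_mem hsC 2)
      have : s ^ 2 * c * (s ^ 2)⁻¹ = s * (s * c * s⁻¹) * s⁻¹ := by rw [sq]; group
      rw [this, hsc]
      have : s * c⁻¹ * s⁻¹ = (s * c * s⁻¹)⁻¹ := by group
      rw [this, hsc, inv_inv]
    rw [hcyc] at this
    obtain ⟨i, hi⟩ := this
    have hi' : c ^ i = s ^ 2 := hi
    have e1 : s * c ^ i * s⁻¹ = c ^ (-i) := by rw [← conj_zpow, hsc]; simp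
    have e2 : s * c ^ i * s⁻¹ = c ^ i := by rw [hi', sq]; group
    have e3 : c ^ (2 * i) = 1 := by
      have : c ^ i = c ^ (-i) := e2.symm.trans e1
      have h3 : 2 * i = i - (-i) := by ring
      rw [h3, zpow_sub, ← this]; simp
    have : i = 0 := by have := hcinf _ e3; omega
    rw [← hi', this, zpow_zero]
  have hs1 : s ≠ 1 := by rintro rfl; exact hs0 (one_mem _)
  have hsinv : s * s = 1 := by rw [← sq, hs2]
  have hsi : s⁻¹ = s := inv_eq_of_mul_eq_one_left hsinv
  refine ⟨s, s * c, hs2, ?_, hs1, ?_, ?_⟩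
  · rw [sq]
    have : s * c * (s * c) = (s * c * s⁻¹) * (s * s) * c := by group
    rw [this, hsc, hsinv]; simp
  · intro hh
    apply hs0
    have : s = c⁻¹ := eq_inv_of_mul_eq_one_left hh
    rw [this]; exact inv_mem hc
  · apply le_antisymm
    · have m1 : s ∈ Subgroup.closure {s, s * c} := Subgroup.subset_closure (by simp)
      have m2 : s * c ∈ Subgroup.closure {s, s * c} := Subgroup.subset_closure (by simp)
      have m3 : c ∈ Subgroup.closure {s, s * c} := (Subgroup.mul_mem_cancel_left _ m1).1 m2
      have m4 : C0 ≤ Subgroup.closure {s, s * c} := by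
        rw [hcyc, Subgroup.zpowers_le]; exact m3
      intro g hg
      by_cases hg0 : g ∈ C0
      · exact m4 hg0
      · have : g * s ∈ C0 := by
          apply hcomm _ (mul_mem hg hsC)
          have e : g * s * c * (g * s)⁻¹ = (g * (s * c * s⁻¹)⁻¹ * g⁻¹)⁻¹ := by group
          rw [e, hsc, inv_inv, hsgn g hg hg0, inv_inv]
        exact (Subgroup.mul_mem_cancel_right _ m1).1 (m4 this)
    · rw [Subgroup.closure_le]
      rintro x (rfl | rfl)
      · exact hsC
      · exact mul_mem hsC hc.1

end
end OR

namespace OR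
section
open scoped Classical
variable {X : Type} {R : FreeGroup X} {n : ℕ} {G : Type} [Group G] {π : FreeGroup X →* G}
variable {D : Bool → Subgroup G} {C : Subgroup G}

theorem Pres.fgG (h : Pres R n π) [Finite X] : (⊤ : Subgroup G).FG := by
  have : Group.FG (FreeGroup X) := inferInstance
  have h1 := Group.fg_of_surjective h.surj
  exact Group.fg_def.1 h1

theorem Amalg.pow_rn (ha : Amalg D C) {t₀ : Bool} {r c : G} (hr : r ∈ D t₀)
    (hcyc : C = Subgroup.zpowers c) (hcT : c ∈ Subgroup.normalClosure {r})
    (hcinf : ∀ m : ℤ, c ^ m = 1 → m = 0) :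
    ∃ m : ℕ, 0 < m ∧ c ^ m ∈ rn (D t₀) {r} := by
  by_contra hcon
  push Not at hcon
  let S : Bool → Set G := fun b => {x | x = r ∧ b = t₀}
  let M : ∀ b, Subgroup (D b) := fun b => Subgroup.normalClosure {x : D b | (x : G) ∈ S b}
  have hM : ∀ b, (M b).Normal := fun b => Subgroup.normalClosure_normal
  let ψ : ∀ b, C →* (D b ⧸ M b) := fun b =>
    (QuotientGroup.mk' (M b)).comp (Subgroup.inclusion (ha.le b))
  have hz : ∀ k : ℤ, c ^ k ∈ rn (D t₀) {r} → k = 0 := by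
    intro k hk
    by_contra hk0
    apply hcon k.natAbs (by omega)
    rcases Int.natAbs_eq k with h | h
    · rw [h, zpow_natCast] at hk; exact hk
    · rw [h, zpow_neg, zpow_natCast] at hk
      simpa using hk
  have hinj : ∀ b, Function.Injective (ψ b) := by
    intro b
    rw [injective_iff_map_eq_one]
    rintro ⟨x, hx⟩ hx1
    have hx2 : Subgroup.inclusion (ha.le b) ⟨x, hx⟩ ∈ M b := by
      rw [← QuotientGroup.eq_one_iff]; exact hx1
    have hx3 : x ∈ rn (D b) (S b) := ncl_rn hx2
    have hx4 := hx
    rw [hcyc] at hx4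
    obtain ⟨k, rfl⟩ := hx4
    by_cases hb : b = t₀
    · subst hb
      have : S b = {r} := by ext y; simp [S]
      rw [this] at hx3
      have := hz k hx3
      apply Subtype.ext
      simp [this]
    · have : S b = ∅ := by ext y; simp [S, hb]
      rw [this] at hx3
      have h0 : rn (D b) (∅ : Set G) = ⊥ := by simp [rn]
      rw [h0, Subgroup.mem_bot] at hx3
      exact Subtype.ext hx3
  obtain ⟨Φ, hΦ⟩ := ha.univ (Monoid.PushoutI ψ)
    (fun b => (Monoid.PushoutI.of (φ := ψ) b).comp (QuotientGroup.mk' (M b))) (by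
      intro x hx
      have e := fun b => Monoid.PushoutI.of_apply_eq_base ψ b ⟨x, hx⟩
      exact (e true).trans (e false).symm)
  have hΦr : Φ r = 1 := by
    have h1 := hΦ t₀ ⟨r, hr⟩
    have h2 : QuotientGroup.mk' (M t₀) ⟨r, hr⟩ = 1 := by
      rw [QuotientGroup.mk'_apply, QuotientGroup.eq_one_iff]
      exact Subgroup.subset_normalClosure ⟨rfl, rfl⟩
    simp only [MonoidHom.comp_apply] at h1
    rw [h2, map_one] at h1
    exact h1
  have hΦc : Φ c = 1 := by
    have : Subgroup.normalClosure {r} ≤ Φ.ker := ncl_le hΦr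
    exact this hcT
  have hcC : c ∈ C := by rw [hcyc]; exact Subgroup.mem_zpowers c
  have hb : Monoid.PushoutI.base ψ ⟨c, hcC⟩ = 1 := by
    rw [← Monoid.PushoutI.of_apply_eq_base ψ true ⟨c, hcC⟩, ← hΦc]
    exact (hΦ true ⟨c, ha.le true hcC⟩).symm
  have := Monoid.PushoutI.base_injective hinj (hb.trans (map_one _).symm)
  have hc1 : c = 1 := congrArg Subtype.val this
  have := hcinf 1 (by rw [hc1]; simp)
  omega

/-- killing argument: the factor is the relative normal closure of the given set -/
theorem Amalg.le_rn (ha : Amalg D C) (t : Bool) {S : Set G} {r : G}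
    (hC : C ≤ rn (D t) S) (hSD : ∀ s ∈ S, s ∈ D t)
    (hr : r ∈ D (!t) ∨ r ∈ S)
    (hD : D t ≤ Subgroup.normalClosure {r}) : D t ≤ rn (D t) S := by
  let M : Subgroup (D t) := Subgroup.normalClosure {x : D t | (x : G) ∈ S}
  have hMn : M.Normal := Subgroup.normalClosure_normal
  have hrnM : ∀ x ∈ rn (D t) S, ∀ hx : x ∈ D t, (⟨x, hx⟩ : D t) ∈ M := by
    intro x hx hx'
    have := rn_kill (K := D t) (H := D t) le_rfl hSD (QuotientGroup.mk' M) (by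
      intro s hs
      rw [QuotientGroup.mk'_apply, QuotientGroup.eq_one_iff]
      exact Subgroup.subset_normalClosure hs) hx hx'
    rwa [QuotientGroup.mk'_apply, QuotientGroup.eq_one_iff] at this
  obtain ⟨Φ, h1, h2⟩ := ha.kill t M (fun x hx => hrnM x (hC hx) _)
  have hΦr : Φ r = 1 := by
    rcases hr with hr | hr
    · exact h2 r hr
    · have := h1 ⟨r, hSD r hr⟩
      rw [this, QuotientGroup.mk'_apply, QuotientGroup.eq_one_iff]
      exact Subgroup.subset_normalClosure hr
  have hk : Subgroup.normalClosure {r} ≤ Φ.ker := ncl_le hΦr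
  intro x hx
  have h3 : Φ x = 1 := hk (hD hx)
  have h4 := h1 ⟨x, hx⟩
  rw [h3] at h4
  have h5 : (⟨x, hx⟩ : D t) ∈ M := (QuotientGroup.eq_one_iff _).1 h4.symm
  exact ncl_rn h5

theorem rn_self {L : Subgroup G} {S : Set G} {s : G} (hs : s ∈ S) : s ∈ rn L S :=
  Subgroup.subset_closure ⟨1, one_mem _, s, hs, by simp⟩

theorem rn_conj {L : Subgroup G} {S : Set G} {x l : G} (hx : x ∈ rn L S) (hl : l ∈ L) :
    l * x * l⁻¹ ∈ rn L S := by
  unfold rn at hx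
  induction hx using Subgroup.closure_induction with
  | mem y hy =>
    obtain ⟨l', hl', s, hs, rfl⟩ := hy
    exact Subgroup.subset_closure ⟨l * l', mul_mem hl hl', s, hs, by group⟩
  | one => simpa using one_mem _
  | mul y z _ _ h1 h2 =>
    have : l * (y * z) * l⁻¹ = (l * y * l⁻¹) * (l * z * l⁻¹) := by group
    rw [this]; exact mul_mem h1 h2
  | inv y _ h1 =>
    have : l * y⁻¹ * l⁻¹ = (l * y * l⁻¹)⁻¹ := by group
    rw [this]; exact inv_mem h1

theorem Amalg.beta1' (ha : Amalg D C) (h : Pres R n π) (hn : 1 < n) (hd : ¬ FreelyDecomposable G)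
    (hprop : ∀ t, ¬ D t ≤ C) {c : G} (hcyc : C = Subgroup.zpowers c)
    (hcinf : ∀ m : ℤ, c ^ m = 1 → m = 0)
    (hcT : c ∈ Subgroup.normalClosure {π R}) {t₀ : Bool} (hR : π R ∈ D t₀) : False := by
  have := h.finite hn hd
  have hcC : c ∈ C := by rw [hcyc]; exact Subgroup.mem_zpowers c
  have hfg : ∀ t, (D t).FG := ha.fg h.fgG ⟨{c}, by rw [hcyc]; simp [Subgroup.zpowers_eq_closure]⟩
  have hCtf : ∀ x ∈ C, ∀ m : ℕ, 0 < m → x ^ m = 1 → x = 1 := by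
    intro x hx m hm hxm
    rw [hcyc] at hx
    obtain ⟨k, rfl⟩ := hx
    simp only at hxm ⊢
    rw [← zpow_natCast, ← zpow_mul] at hxm
    rcases mul_eq_zero.1 (hcinf _ hxm) with h | h
    · rw [h, zpow_zero]
    · omega
  have htor : ∀ t, ∀ s ∈ D t, ∀ m : ℕ, 0 < m → s ^ m = 1 → s ≠ 1 →
      s ∈ D t₀ ∧ ∃ g ∈ D t₀, g * s * g⁻¹ ∈ Subgroup.zpowers (π R) := by
    intro t s hs m hm hsm hs1
    obtain ⟨g, hg⟩ := h.tors hm hsm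
    have hg' : g * s * g⁻¹ ∈ D t₀ := by
      have : Subgroup.zpowers (π R) ≤ D t₀ := by rw [Subgroup.zpowers_le]; exact hR
      exact this hg
    have hgi : g⁻¹ ∈ D t₀ := by
      apply ha.conj_mem (t := t₀) (s := g * s * g⁻¹) (t' := t) hg'
      · have e : g⁻¹ * (g * s * g⁻¹) * g⁻¹⁻¹ = s := by group
        rw [e]; exact hs
      · intro a haD hac
        have e : a * (g * s * g⁻¹) * a⁻¹ = (a * g) * s * (a * g)⁻¹ := by group
        rw [e] at hac
        have := hCtf _ hac m hm (by rw [conj_pow, hsm]; simp)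
        exact hs1 (conj_eq_one_iff.1 this)
    have hgD : g ∈ D t₀ := by simpa using inv_mem hgi
    refine ⟨?_, g, hgD, hg⟩
    have e : s = g⁻¹ * (g * s * g⁻¹) * g := by group
    rw [e]
    exact mul_mem (mul_mem hgi hg') hgD
  obtain ⟨t, ht⟩ := ha.quot h hn hd (k := 1) one_pos hR
    (by rw [hcyc, Subgroup.zpowers_le]; exact hcT) (fun g => by rw [pow_one]; exact h.T_iff g)
  by_cases htt : t = t₀
  · subst htt
    have hcD : c ∈ D t := ha.le t hcC
    have hL : D t ≤ rn (D t) {π R, c} := by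
      apply ha.le_rn t (r := π R) _ _ (Or.inr (by simp)) ht
      · rw [hcyc, Subgroup.zpowers_le]; exact rn_self (by simp)
      · rintro s (rfl | rfl)
        · exact hR
        · exact hcD
    obtain ⟨m, hm, hcm⟩ := ha.pow_rn hR hcyc hcT hcinf
    have hA := h.a1 (hfg t) hR hcD hR hL h.pos one_pos hm h.pow
      (by rw [pow_one]; exact rn_self (by simp)) hcm
    have hA2 : D t ≤ rn (D t) {π R} := by
      refine hA.trans ?_
      rw [Subgroup.closure_le]
      rintro s ⟨hs, q, hq, hsq⟩
      by_cases hs1 : s = 1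
      · rw [hs1]; exact one_mem _
      obtain ⟨-, g, hg, hgs⟩ := htor t s hs q hq hsq hs1
      have h1 : Subgroup.zpowers (π R) ≤ rn (D t) {π R} := by
        rw [Subgroup.zpowers_le]; exact rn_self (by simp)
      have h2 := rn_conj (h1 hgs) (inv_mem hg)
      have e : g⁻¹ * (g * s * g⁻¹) * g⁻¹⁻¹ = s := by group
      rw [e] at h2
      exact h2
    have e1 : π (1 * R ^ 1 * 1⁻¹) = π R := by simp
    rcases h.a2 (hfg t) 1 1 1 1 (by rw [e1]; exact hR) (by rw [e1]; exact hR)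
      (by rw [e1]; simpa using hA2) with ⟨s, q, hq, hsq, hs⟩ | ⟨h1, -⟩
    · rw [hs] at hcD
      obtain ⟨k, hk⟩ := hcD
      have hk' : s ^ k = c := hk
      have : c ^ (q : ℤ) = 1 := by
        rw [← hk', ← zpow_mul, mul_comm, zpow_mul, zpow_natCast, hsq, one_zpow]
      have := hcinf _ this
      omega
    · exact h1 rfl
  · have ht' : t₀ = !t := by
      cases t <;> cases t₀ <;> simp_all
    subst ht'
    have hcD : c ∈ D t := ha.le t hcC
    have hL : D t ≤ rn (D t) {c} := by
      apply ha.le_rn t (r := π R) _ _ (Or.inl hR) ht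
      · rw [hcyc, Subgroup.zpowers_le]; exact rn_self (by simp)
      · rintro s rfl
        exact hcD
    have htf : ∀ a ∈ D t, ∀ m : ℕ, 0 < m → a ^ m = 1 → a = 1 := by
      intro a haD m hm ham
      by_contra ha1
      have := (htor t a haD m hm ham ha1).1
      exact ha1 (hCtf _ (ha.inf (by simp) haD this) m hm ham)
    obtain ⟨a, haa⟩ := h.b1 hn (hfg t) htf hcD hL
    apply hprop t
    refine hL.trans ?_
    unfold rn
    rw [Subgroup.closure_le]
    rintro _ ⟨l, hl, s, rfl, rfl⟩
    have e : l * s * l⁻¹ = s := by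
      rw [haa] at hl hcD
      obtain ⟨i, rfl⟩ := hl
      obtain ⟨j, rfl⟩ := hcD
      simp only
      rw [← zpow_neg, ← zpow_add, ← zpow_add]; congr 1; ring
    rw [e]; exact hcC

theorem Amalg.beta1 (ha : Amalg D C) (h : Pres R n π) (hn : 1 < n) (hd : ¬ FreelyDecomposable G)
    (hprop : ∀ t, ¬ D t ≤ C) {c : G} (hcyc : C = Subgroup.zpowers c)
    (hcinf : ∀ m : ℤ, c ^ m = 1 → m = 0)
    (hcT : c ∈ Subgroup.normalClosure {π R}) : False := by
  obtain ⟨g, t, hg⟩ := ha.tors h.pos h.pow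
  obtain ⟨w, rfl⟩ := h.surj g
  refine ha.beta1' (h.conj w) hn hd hprop hcyc hcinf ?_ (t₀ := t) ?_
  · rw [map_mul, map_mul, map_inv, ncl_conj]; exact hcT
  · rw [map_mul, map_mul, map_inv]; exact hg

theorem Pres.invol (h : Pres R n π) {s : G} (hs : s ^ 2 = 1) (hs1 : s ≠ 1) :
    0 < n / 2 ∧ ∃ w, s = π (w * R ^ (n / 2) * w⁻¹) := by
  obtain ⟨g, hg⟩ := h.tors two_pos hs
  obtain ⟨i, hi⟩ := h.zpow_nat hg
  have h2 : n ∣ i * 2 := by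
    rw [← h.ord]
    apply orderOf_dvd_of_pow_eq_one
    rw [pow_mul, ← hi, conj_pow, hs]; simp
  have h1 : ¬ n ∣ i := by
    rw [← h.ord]
    intro hh
    have := orderOf_dvd_iff_pow_eq_one.1 hh
    rw [← hi] at this
    exact hs1 (conj_eq_one_iff.1 this)
  obtain ⟨q, hq⟩ := h2
  have hqodd : ¬ 2 ∣ q := by
    rintro ⟨p, rfl⟩
    exact h1 ⟨p, by linarith⟩
  have hne : 2 ∣ n := by
    have : 2 ∣ n * q := ⟨i, by omega⟩
    exact (Nat.prime_two.dvd_mul.1 this).resolve_right hqodd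
  obtain ⟨m, rfl⟩ := hne
  obtain ⟨p, hp⟩ : ∃ p, q = 2 * p + 1 := ⟨q / 2, by omega⟩
  have hi2 : i = m + (2 * m) * p := by
    subst hp; nlinarith
  have hm : 2 * m / 2 = m := by omega
  have hpos := h.pos
  refine ⟨by omega, ?_⟩
  obtain ⟨w, rfl⟩ := h.surj g
  refine ⟨w⁻¹, ?_⟩
  have e : s = (π w)⁻¹ * (π w * s * (π w)⁻¹) * π w := by group
  rw [e, hi, hm, hi2, pow_add, pow_mul, h.pow]
  simp

theorem Pres.ker_pow (h : Pres R n π) {k : ℕ} (hk : k ∣ n) (g : FreeGroup X) :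
    π g ∈ Subgroup.normalClosure {π (R ^ k)} ↔ g ∈ Subgroup.normalClosure {R ^ k} := by
  have h1 : (Subgroup.normalClosure {R ^ k}).map π = Subgroup.normalClosure {π (R ^ k)} := by
    rw [Subgroup.map_normalClosure _ _ h.surj, Set.image_singleton]
  rw [← h1]
  constructor
  · rintro ⟨g', hg', he⟩
    have : π (g * g'⁻¹) = 1 := by rw [map_mul, map_inv, he]; simp
    rw [h.ker] at this
    obtain ⟨q, rfl⟩ := hk
    rw [pow_mul] at this
    have := ncl_pow _ _ this
    simpa using mul_mem this hg'
  · intro hg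
    exact ⟨g, hg, rfl⟩

theorem Amalg.beta2 (ha : Amalg D C) (h : Pres R n π) (hn : 1 < n) (hd : ¬ FreelyDecomposable G)
    [Infinite C] {s₁ s₂ : G} (h1 : s₁ ^ 2 = 1) (h2 : s₂ ^ 2 = 1) (h1' : s₁ ≠ 1) (h2' : s₂ ≠ 1)
    (hC : C = Subgroup.closure {s₁, s₂}) :
    ∃ t, Nonempty (D t ≃* DihedralGroup 0) := by
  have := h.finite hn hd
  have m1 : s₁ ∈ C := by rw [hC]; exact Subgroup.subset_closure (by simp)
  have m2 : s₂ ∈ C := by rw [hC]; exact Subgroup.subset_closure (by simp)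
  have hfg : ∀ t, (D t).FG := ha.fg h.fgG ⟨{s₁, s₂}, by rw [hC]; simp⟩
  obtain ⟨hpos, w₁, e1⟩ := h.invol h1 h1'
  obtain ⟨-, w₂, e2⟩ := h.invol h2 h2'
  have hne : n / 2 ∣ n := by
    have hp : π (R ^ (n / 2)) ^ 2 = 1 := by
      have : π (R ^ (n / 2)) = (π w₁)⁻¹ * s₁ * (π w₁)⁻¹⁻¹ := by
        rw [e1]; simp [mul_assoc]
      rw [this, conj_pow, h1]; simp
    rw [map_pow, ← pow_mul] at hp
    have := orderOf_dvd_of_pow_eq_one hp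
    rw [h.ord] at this
    have h3 := Nat.le_of_dvd (by omega) this
    exact ⟨2, by omega⟩
  have hncl : ∀ w : FreeGroup X, Subgroup.normalClosure {π (w * R ^ (n / 2) * w⁻¹)} =
      Subgroup.normalClosure {π (R ^ (n / 2))} := by
    intro w
    rw [map_mul, map_mul, map_inv, ncl_conj]
  have hCN : C ≤ Subgroup.normalClosure {s₁} := by
    rw [hC, Subgroup.closure_le]
    rintro x (rfl | rfl)
    · exact ncl_self _
    · change x ∈ Subgroup.normalClosure {s₁}
      rw [e1, hncl, ← hncl w₂, ← e2]; exact ncl_self _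
  obtain ⟨t, ht⟩ := ha.quot h hn hd hpos (ha.le true m1) hCN (fun g => by
    rw [e1, hncl]; exact h.ker_pow hne g)
  refine ⟨t, ?_⟩
  have : Infinite (D t) := Infinite.of_injective _ (Subgroup.inclusion_injective (ha.le t))
  have hL : D t ≤ rn (D t) {s₁, s₂} := by
    apply ha.le_rn t (r := s₁) _ _ (Or.inr (by simp)) ht
    · rw [hC, Subgroup.closure_le]
      rintro x hx
      exact rn_self hx
    · rintro s (rfl | rfl)
      · exact ha.le t m1
      · exact ha.le t m2
  rcases h.a2 (hfg t) w₁ w₂ (n / 2) (n / 2) (by rw [← e1]; exact ha.le t m1)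
    (by rw [← e2]; exact ha.le t m2) (by rw [← e1, ← e2]; exact hL) with
    ⟨s, q, hq, hsq, hs⟩ | ⟨-, t₁, t₂, hcl, f1, f2⟩
  · exfalso
    have h1 : (Subgroup.zpowers s : Set G).Finite :=
      finite_zpowers.2 (isOfFinOrder_iff_pow_eq_one.2 ⟨q, hq, hsq⟩)
    rw [← hs] at h1
    exact (Set.infinite_coe_iff.1 this) h1
  · have k1 : t₁ ∈ D t := by rw [hcl]; exact Subgroup.subset_closure (by simp)
    have k2 : t₂ ∈ D t := by rw [hcl]; exact Subgroup.subset_closure (by simp)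
    apply dihedral_of (a := (⟨t₁, k1⟩ : D t)) (b := (⟨t₂, k2⟩ : D t))
    · apply Subtype.ext
      simpa using f1 2 (by rw [← e1]; exact h1)
    · apply Subtype.ext
      simpa using f2 2 (by rw [← e2]; exact h2)
    · rw [eq_top_iff]
      have : (D t) ≤ (Subgroup.closure {(⟨t₁, k1⟩ : D t), ⟨t₂, k2⟩}).map (D t).subtype := by
        rw [MonoidHom.map_closure]
        nth_rewrite 1 [hcl]
        apply Subgroup.closure_mono
        rintro x (rfl | rfl)
        · exact ⟨⟨x, k1⟩, by simp, rfl⟩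
        · exact ⟨⟨x, k2⟩, by simp, rfl⟩
      rintro ⟨x, hx⟩ -
      obtain ⟨y, hy, hyx⟩ := this hx
      have : y = ⟨x, hx⟩ := Subtype.ext hyx
      rwa [← this]

theorem Amalg.final (ha : Amalg D C) (h : Pres R n π) (hn : 1 < n) (hd : ¬ FreelyDecomposable G)
    (hprop : ∀ t, ¬ D t ≤ C) (hC : VirtuallyZ C) :
    (¬ C ≤ Subgroup.normalClosure {π R} ∧ ∃ M : Subgroup G,
      M.IsMalnormal ∧ Nonempty (M ≃* Multiplicative ℤ) ∧ C ≤ M) ∨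
    (Nonempty (C ≃* DihedralGroup 0) ∧ ∃ t, Nonempty (D t ≃* DihedralGroup 0)) := by
  obtain ⟨z, N, v⟩ := VZ.of hC
  by_cases hz : z ∈ Subgroup.normalClosure {π R}
  · right
    obtain ⟨c, hc, hcinf, hcyc | ⟨s₁, s₂, h1, h2, h1', h2', hcl⟩⟩ := v.structure h hn
    · exfalso
      refine ha.beta1 h hn hd hprop hcyc hcinf ?_
      obtain ⟨m, hm, -, i, hi⟩ := v.pow c hc
      apply h.T_tf hm
      rw [← hi]
      exact Subgroup.zpow_mem _ hz i
    · have hinf : Infinite C := by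
        apply Infinite.of_injective (fun i : ℤ => (⟨z, v.mem⟩ : C) ^ i)
        intro i j hij
        exact v.zinj (by simpa using congrArg Subtype.val hij)
      refine ⟨?_, ha.beta2 h hn hd h1 h2 h1' h2' hcl⟩
      have k1 : s₁ ∈ C := by rw [hcl]; exact Subgroup.subset_closure (by simp)
      have k2 : s₂ ∈ C := by rw [hcl]; exact Subgroup.subset_closure (by simp)
      apply dihedral_of (a := (⟨s₁, k1⟩ : C)) (b := (⟨s₂, k2⟩ : C))
      · apply Subtype.ext
        simpa using h1
      · apply Subtype.ext
        simpa using h2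
      · rw [eq_top_iff]
        have : C ≤ (Subgroup.closure {(⟨s₁, k1⟩ : C), ⟨s₂, k2⟩}).map C.subtype := by
          rw [MonoidHom.map_closure]
          nth_rewrite 1 [hcl]
          apply Subgroup.closure_mono
          rintro x (rfl | rfl)
          · exact ⟨⟨x, k1⟩, by simp, rfl⟩
          · exact ⟨⟨x, k2⟩, by simp, rfl⟩
        rintro ⟨x, hx⟩ -
        obtain ⟨y, hy, hyx⟩ := this hx
        have : y = ⟨x, hx⟩ := Subtype.ext hyx
        rwa [← this]
  · left
    obtain ⟨h1, h2⟩ := h.malnormal hn hz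
    exact ⟨fun hh => hz (hh v.mem), comms z, h1, h2, v.comms⟩
end
end OR

theorem OR.VirtuallyZ_congr {C C' : Type} [Group C] [Group C'] (f : C ≃* C') (h : VirtuallyZ C) :
    VirtuallyZ C' := by
  obtain ⟨H, hH, ⟨i⟩⟩ := h
  refine ⟨H.map f.toMonoidHom, ⟨?_⟩, ⟨(H.equivMapOfInjective f.toMonoidHom f.injective).symm.trans i⟩⟩
  have := H.index_map_equiv f
  erw [this]
  exact hH.index_ne_zero

/-- If a freely indecomposable one-relator group with torsion
`G = ⟨X; Rⁿ⟩` splits nontrivially as an amalgam `A ∗_C B` over a virtually-ℤ group `C`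
(here `A = D true`, `B = D false`), then either the image of `C` in `G` is not contained
in `T = ⟪R⟫` and `C` is contained in a malnormal infinite cyclic subgroup of `G`, or
both `A` and `C` are infinite dihedral, or both `B` and `C` are infinite dihedral. -/
theorem statement_11 {X : Type} [Nontrivial X] (R : FreeGroup X) (n : ℕ)
    (hn : 1 < n) (hR : ∀ (S : FreeGroup X) (k : ℕ), 1 ≤ k → R = S ^ k → k = 1)
    (hindec : FreelyIndecomposable (PresentedGroup {R ^ n}))
    (C : Type) [Group C] (hC : VirtuallyZ C)
    (D : Bool → Type) [∀ b, Group (D b)]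
    (φ : ∀ b, C →* D b) (hinj : ∀ b, Function.Injective (φ b))
    (hproper : ∀ b, (φ b).range ≠ ⊤)
    (e : PresentedGroup {R ^ n} ≃* Monoid.PushoutI φ) :
    let ιC : C →* PresentedGroup {R ^ n} :=
      e.symm.toMonoidHom.comp ((Monoid.PushoutI.of (φ := φ) true).comp (φ true))
    (¬ (ιC.range ≤ Subgroup.normalClosure {PresentedGroup.mk {R ^ n} R}) ∧
        ∃ M : Subgroup (PresentedGroup {R ^ n}),
          M.IsMalnormal ∧ Nonempty (M ≃* Multiplicative ℤ) ∧ ιC.range ≤ M) ∨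
      (Nonempty (D true ≃* DihedralGroup 0) ∧ Nonempty (C ≃* DihedralGroup 0)) ∨
      (Nonempty (D false ≃* DihedralGroup 0) ∧ Nonempty (C ≃* DihedralGroup 0)) := by
  intro ιC
  have h := OR.Pres.std (R := R) (n := n) hR (by omega)
  have ha := OR.amalg_of_push hinj e.symm
  have hιC : ιC = e.symm.toMonoidHom.comp (Monoid.PushoutI.base φ) := by
    ext c
    simp only [ιC, MonoidHom.comp_apply, Monoid.PushoutI.of_apply_eq_base]
  have hbi : Function.Injective (e.symm.toMonoidHom.comp (Monoid.PushoutI.base φ)) :=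
    e.symm.injective.comp (Monoid.PushoutI.base_injective hinj)
  have hoi : ∀ t, Function.Injective
      (e.symm.toMonoidHom.comp (Monoid.PushoutI.of (φ := φ) t)) :=
    fun t => e.symm.injective.comp (Monoid.PushoutI.of_injective hinj t)
  have hprop : ∀ t, ¬ (e.symm.toMonoidHom.comp (Monoid.PushoutI.of (φ := φ) t)).range ≤
      (e.symm.toMonoidHom.comp (Monoid.PushoutI.base φ)).range := by
    intro t hle
    apply hproper t
    rw [eq_top_iff]
    intro d _
    obtain ⟨c, hc⟩ := hle ⟨d, rfl⟩
    refine ⟨c, hoi t ?_⟩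
    rw [← hc]
    simp only [MonoidHom.comp_apply, Monoid.PushoutI.of_apply_eq_base]
  have key := ha.final h hn hindec hprop
    (OR.VirtuallyZ_congr (MonoidHom.ofInjective hbi) hC)
  rw [hιC]
  rcases key with h1 | ⟨⟨i⟩, t, ⟨j⟩⟩
  · exact Or.inl h1
  · right
    cases t with
    | true =>
      exact Or.inl ⟨⟨(MonoidHom.ofInjective (hoi true)).trans j⟩,
        ⟨(MonoidHom.ofInjective hbi).trans i⟩⟩
    | false =>
      exact Or.inr ⟨⟨(MonoidHom.ofInjective (hoi false)).trans j⟩,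
        ⟨(MonoidHom.ofInjective hbi).trans i⟩⟩
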